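/- arXiv:2107.12082 — 7 statements merged into one kernel-verified Lean document; each statement's English description precedes it below -/
import Mathlib

section
/- Let φ : ℝ² → [0,∞) be positively 1-homogeneous and twice continuously differentiable on ℝ²∖{0}. Then for every (x,z) ∈ ℝ² with z > 0 one has det ∇²(φ²/2)(x,z) = φ(x/z, 1)³ · φ_xx(x/z, 1), where ∇²(φ²/2) denotes the Hessian matrix of the function φ²/2 and φ_xx denotes the second partial derivative of φ with respect to its first variable. -/
open Set

/-- Partial derivative with respect to the first variable. -/
noncomputable def pdx (φ : ℝ × ℝ → ℝ) (p : ℝ × ℝ) : ℝ :=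
  deriv (fun a => φ (a, p.2)) p.1

/-- Partial derivative with respect to the second variable. -/
noncomputable def pdz (φ : ℝ × ℝ → ℝ) (p : ℝ × ℝ) : ℝ :=
  deriv (fun b => φ (p.1, b)) p.2

/-- Determinant of the Hessian matrix of `g : ℝ² → ℝ`. -/
noncomputable def hessDet (g : ℝ × ℝ → ℝ) (p : ℝ × ℝ) : ℝ :=
  pdx (pdx g) p * pdz (pdz g) p - pdx (pdz g) p * pdz (pdx g) p

theorem stmt0 (φ : ℝ × ℝ → ℝ)
    (hnonneg : ∀ p, 0 ≤ φ p)
    (hhom : ∀ c : ℝ, 0 < c → ∀ p, φ (c • p) = c * φ p)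
    (hreg : ContDiffOn ℝ 2 φ {(0 : ℝ × ℝ)}ᶜ) :
    ∀ x z : ℝ, 0 < z →
      hessDet (fun q => φ q ^ 2 / 2) (x, z) =
        φ (x / z, 1) ^ 3 * pdx (pdx φ) (x / z, 1) := by
  have hf2 : ContDiff ℝ 2 (fun t : ℝ => φ (t, 1)) := by
    rw [← contDiffOn_univ]
    refine hreg.comp (f := fun t : ℝ => ((t, 1) : ℝ × ℝ)) (by fun_prop) ?_
    intro t _
    simp
  obtain ⟨f, hf⟩ : ∃ f : ℝ → ℝ, f = fun t => φ (t, 1) := ⟨_, rfl⟩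
  rw [← hf] at hf2
  have hd1 : ∀ t, HasDerivAt f (deriv f t) t := fun t =>
    (hf2.differentiable (by norm_num) t).hasDerivAt
  have hd2 : ∀ t, HasDerivAt (deriv f) (deriv (deriv f) t) t := fun t => by
    have h : ContDiff ℝ 1 (deriv f) := by
      have : ContDiff ℝ (1 + 1) f := by simpa [one_add_one_eq_two] using hf2
      exact (contDiff_succ_iff_deriv.1 this).2.2
    exact (h.differentiable (by norm_num) t).hasDerivAt
  have hφ : ∀ x z : ℝ, 0 < z → φ (x, z) = z * f (x / z) := by
    intro x z hz
    rw [hf]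
    simp only
    rw [← hhom z hz]
    congr 1
    ext
    · simp; field_simp
    · simp
  have hq : ∀ z x : ℝ, HasDerivAt (fun a : ℝ => a / z) (1 / z) x := fun z x =>
    (hasDerivAt_id x).div_const z
  have hr : ∀ x z : ℝ, 0 < z → HasDerivAt (fun b : ℝ => x / b) (-x / z ^ 2) z := by
    intro x z hz
    have := (hasDerivAt_const z x).div (hasDerivAt_id z) hz.ne'
    have e : -x / z ^ 2 = (0 * id z - x * 1) / id z ^ 2 := by simp
    rw [e]
    exact this
  have hxx : ∀ t, pdx (pdx φ) (t, 1) = deriv (deriv f) t := by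
    intro t
    simp only [pdx, hf]
  have gx : ∀ x z : ℝ, 0 < z → pdx (fun q => φ q ^ 2 / 2) (x, z)
      = z * (f (x / z) * deriv f (x / z)) := by
    intro x z hz
    simp only [pdx, hφ _ z hz]
    have h := (((((hd1 (x / z)).comp x (hq z x)).const_mul z).pow 2).div_const 2)
    refine Eq.trans h.deriv ?_
    simp only [Function.comp_apply]
    field_simp
    norm_num
    ring
  have ev : ∀ z : ℝ, 0 < z → ∀ᶠ b in nhds z, 0 < b := fun z hz => lt_mem_nhds hz
  have gz : ∀ x z : ℝ, 0 < z → pdz (fun q => φ q ^ 2 / 2) (x, z)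
      = z * f (x / z) ^ 2 - x * (f (x / z) * deriv f (x / z)) := by
    intro x z hz
    have h := ((((hasDerivAt_id z).mul ((hd1 (x / z)).comp z (hr x z hz))).pow 2).div_const 2)
    refine Eq.trans (Filter.EventuallyEq.deriv_eq ?_) (h.deriv.trans ?_)
    · filter_upwards [ev z hz] with b hb
      simp [hφ x b hb]
    · simp
      field_simp
      ring
  intro x z hz
  have hF := (hd1 (x / z)).comp x (hq z x)
  have hF' := (hd2 (x / z)).comp x (hq z x)
  have hG := (hd1 (x / z)).comp z (hr x z hz)
  have hG' := (hd2 (x / z)).comp z (hr x z hz)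
  have e1 : pdx (pdx (fun q => φ q ^ 2 / 2)) (x, z)
      = deriv f (x / z) ^ 2 + f (x / z) * deriv (deriv f) (x / z) := by
    rw [pdx]
    simp only [gx _ z hz]
    refine Eq.trans ((hF.mul hF').const_mul z).deriv ?_
    simp only [Function.comp_apply]
    field_simp
  have e2 : pdx (pdz (fun q => φ q ^ 2 / 2)) (x, z)
      = f (x / z) * deriv f (x / z)
        - x / z * (deriv f (x / z) ^ 2 + f (x / z) * deriv (deriv f) (x / z)) := by
    rw [pdx]
    simp only [gz _ z hz]
    refine Eq.trans (((hF.pow 2).const_mul z).sub ((hasDerivAt_id x).mul (hF.mul hF'))).deriv ?_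
    simp
    field_simp
    ring
  have e3 : pdz (pdx (fun q => φ q ^ 2 / 2)) (x, z)
      = f (x / z) * deriv f (x / z)
        - x / z * (deriv f (x / z) ^ 2 + f (x / z) * deriv (deriv f) (x / z)) := by
    rw [pdz]
    refine Eq.trans (Filter.EventuallyEq.deriv_eq ?_)
      (((hasDerivAt_id z).mul (hG.mul hG')).deriv.trans ?_)
    · filter_upwards [ev z hz] with b hb
      simp [gx x b hb]
    · simp
      field_simp
      ring
  have e4 : pdz (pdz (fun q => φ q ^ 2 / 2)) (x, z)
      = f (x / z) ^ 2 - 2 * (x / z) * (f (x / z) * deriv f (x / z))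
        + (x / z) ^ 2 * (deriv f (x / z) ^ 2 + f (x / z) * deriv (deriv f) (x / z)) := by
    rw [pdz]
    refine Eq.trans (Filter.EventuallyEq.deriv_eq ?_)
      ((((hasDerivAt_id z).mul (hG.pow 2)).sub ((hG.mul hG').const_mul x)).deriv.trans ?_)
    · filter_upwards [ev z hz] with b hb
      simp [gz x b hb]
    · simp
      field_simp
      ring
  have e5 : φ (x / z, 1) = f (x / z) := by rw [hf]
  rw [hessDet, e1, e2, e3, e4, hxx, e5]
  ring
end

section
/- Let φ be a norm on ℝ² that is C² on ℝ²∖{0} and such that φ² is uniformly convex. Then there exist constants 0 < c₁ ≤ c₂ such that c₁/φ(t,1)³ ≤ φ_xx(t,1) ≤ c₂/φ(t,1)³ for every t ∈ ℝ. -/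
open Set

/-- `φ : ℝ² → [0,∞)` is a norm: convex, positively 1-homogeneous, symmetric and
positive away from the origin. -/
def IsNorm2 (φ : ℝ × ℝ → ℝ) : Prop :=
  ConvexOn ℝ Set.univ φ ∧ (∀ c : ℝ, 0 < c → ∀ p, φ (c • p) = c * φ p) ∧
    (∀ p, φ (-p) = φ p) ∧ (∀ p : ℝ × ℝ, p ≠ 0 → 0 < φ p)

/-- `φ²` is uniformly convex: there is `m > 0` with `D²(φ²)(p)[v,v] ≥ m|v|²`
for all `p ≠ 0` and all `v ∈ ℝ²`. -/
def UnifConvexSq (φ : ℝ × ℝ → ℝ) : Prop :=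
  ∃ m : ℝ, 0 < m ∧ ∀ p : ℝ × ℝ, p ≠ 0 → ∀ v : ℝ × ℝ,
    m * (v.1 ^ 2 + v.2 ^ 2) ≤
      (fderiv ℝ (fun q => fderiv ℝ (fun r => φ r ^ 2) q) p v) v

open Topology

theorem aux_hom (φ : ℝ × ℝ → ℝ) (h : ∀ c : ℝ, 0 < c → ∀ p, φ (c • p) = c * φ p)
    (c : ℝ) (hc : 0 < c) (p : ℝ × ℝ) : fderiv ℝ φ (c • p) = fderiv ℝ φ p := by
  have h1 : (fun q => φ (c • q)) = c • φ := by
    funext q; simp [h c hc q]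
  have h2 := fderiv_comp_smul (𝕜 := ℝ) (f := φ) (x := p) c
  rw [h1, fderiv_const_smul_field] at h2
  exact (smul_right_injective _ hc.ne' h2).symm

theorem aux_hom2 (φ : ℝ × ℝ → ℝ) (h : ∀ c : ℝ, 0 < c → ∀ p, φ (c • p) = c * φ p)
    (c : ℝ) (hc : 0 < c) (p : ℝ × ℝ) :
    fderiv ℝ (fderiv ℝ φ) (c • p) = c⁻¹ • fderiv ℝ (fderiv ℝ φ) p := by
  have h1 : (fun q => fderiv ℝ φ (c • q)) = fderiv ℝ φ := by
    funext q; exact aux_hom φ h c hc q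
  have h2 := fderiv_comp_smul (𝕜 := ℝ) (f := fderiv ℝ φ) (x := p) c
  rw [h1] at h2
  rw [h2, smul_smul, inv_mul_cancel₀ hc.ne', one_smul]

theorem aux_line (p : ℝ × ℝ) : HasDerivAt (fun c : ℝ => c • p) p 1 := by
  simpa using (hasDerivAt_id (1:ℝ)).smul_const p

theorem aux_euler1 (φ : ℝ × ℝ → ℝ) (h : ∀ c : ℝ, 0 < c → ∀ p, φ (c • p) = c * φ p)
    (p : ℝ × ℝ) (hd : DifferentiableAt ℝ φ p) : fderiv ℝ φ p p = φ p := by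
  have h1 : HasFDerivAt φ (fderiv ℝ φ p) ((1:ℝ) • p) := by simpa using hd.hasFDerivAt
  have h2 := h1.comp_hasDerivAt (1:ℝ) (aux_line p)
  have h3 : HasDerivAt (fun c : ℝ => c * φ p) (φ p) 1 := by
    simpa using (hasDerivAt_id (1:ℝ)).mul_const (φ p)
  refine h2.unique (h3.congr_of_eventuallyEq ?_)
  filter_upwards [lt_mem_nhds (zero_lt_one (α := ℝ))] with c hc
  exact h c hc p

theorem aux_euler2 (φ : ℝ × ℝ → ℝ) (h : ∀ c : ℝ, 0 < c → ∀ p, φ (c • p) = c * φ p)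
    (p : ℝ × ℝ) (hd : DifferentiableAt ℝ (fderiv ℝ φ) p) :
    fderiv ℝ (fderiv ℝ φ) p p = 0 := by
  have h1 : HasFDerivAt (fderiv ℝ φ) (fderiv ℝ (fderiv ℝ φ) p) ((1:ℝ) • p) := by
    simpa using hd.hasFDerivAt
  have h2 := h1.comp_hasDerivAt (1:ℝ) (aux_line p)
  have h3 : HasDerivAt (fun _ : ℝ => fderiv ℝ φ p) 0 1 := hasDerivAt_const _ _
  refine h2.unique (h3.congr_of_eventuallyEq ?_)
  filter_upwards [lt_mem_nhds (zero_lt_one (α := ℝ))] with c hc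
  exact aux_hom φ h c hc p

theorem aux_sq (φ : ℝ × ℝ → ℝ) (p v : ℝ × ℝ) (hd : ∀ᶠ q in 𝓝 p, DifferentiableAt ℝ φ q)
    (hd2 : DifferentiableAt ℝ (fderiv ℝ φ) p) :
    (fderiv ℝ (fun q => fderiv ℝ (fun r => φ r ^ 2) q) p v) v =
      2 * φ p * fderiv ℝ (fderiv ℝ φ) p v v + 2 * (fderiv ℝ φ p v) ^ 2 := by
  have h1 : (fun q => fderiv ℝ (fun r => φ r ^ 2) q) =ᶠ[𝓝 p]
      fun q => (2 * φ q) • fderiv ℝ φ q := by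
    filter_upwards [hd] with q hq
    have := (hq.hasFDerivAt.pow 2).fderiv
    simpa using this
  rw [h1.fderiv_eq]
  have h2 := ((hd.self_of_nhds.hasFDerivAt.const_mul 2).smul hd2.hasFDerivAt).fderiv
  rw [show (fun q => (2 * φ q) • fderiv ℝ φ q) = ((fun y => 2 * φ y) • fderiv ℝ φ) from rfl, h2]
  simp
  ring

theorem aux_pdx (φ : ℝ × ℝ → ℝ) (hd : ∀ p : ℝ × ℝ, p ≠ 0 → DifferentiableAt ℝ φ p)
    (hd2 : ∀ p : ℝ × ℝ, p ≠ 0 → DifferentiableAt ℝ (fderiv ℝ φ) p) (t : ℝ) :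
    pdx (pdx φ) (t, 1) = fderiv ℝ (fderiv ℝ φ) (t, 1) (1, 0) (1, 0) := by
  have hne : ∀ a : ℝ, ((a, 1) : ℝ × ℝ) ≠ 0 := fun a h => by simp at h
  have hl : ∀ a : ℝ, HasDerivAt (fun a : ℝ => ((a, 1) : ℝ × ℝ)) (1, 0) a := fun a =>
    (hasDerivAt_id a).prodMk (hasDerivAt_const a 1)
  have h1 : (fun a : ℝ => pdx φ (a, 1)) = fun a => fderiv ℝ φ (a, 1) (1, 0) := by
    funext a
    exact ((hd _ (hne a)).hasFDerivAt.comp_hasDerivAt a (hl a)).deriv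
  change deriv (fun a : ℝ => pdx φ (a, 1)) t = _
  rw [h1]
  have h2 := (hd2 _ (hne t)).hasFDerivAt.comp_hasDerivAt t (hl t)
  have h3 := h2.clm_apply (hasDerivAt_const t ((1, 0) : ℝ × ℝ))
  simpa using h3.deriv

theorem stmt1 (φ : ℝ × ℝ → ℝ)
    (hnorm : IsNorm2 φ)
    (hreg : ContDiffOn ℝ 2 φ {(0 : ℝ × ℝ)}ᶜ)
    (hconv : UnifConvexSq φ) :
    ∃ c₁ c₂ : ℝ, 0 < c₁ ∧ c₁ ≤ c₂ ∧ ∀ t : ℝ,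
      c₁ / φ (t, 1) ^ 3 ≤ pdx (pdx φ) (t, 1) ∧
      pdx (pdx φ) (t, 1) ≤ c₂ / φ (t, 1) ^ 3 := by
  obtain ⟨-, hh, -, hpos⟩ := hnorm
  obtain ⟨m, hm, hconv⟩ := hconv
  have hop : IsOpen ({(0 : ℝ × ℝ)}ᶜ) := isOpen_compl_singleton
  have hC1 : ContDiffOn ℝ 1 (fderiv ℝ φ) {(0 : ℝ × ℝ)}ᶜ :=
    hreg.fderiv_of_isOpen hop (by norm_num)
  have hC0 : ContinuousOn (fderiv ℝ (fderiv ℝ φ)) {(0 : ℝ × ℝ)}ᶜ :=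
    hC1.continuousOn_fderiv_of_isOpen hop (by norm_num)
  have hd : ∀ p : ℝ × ℝ, p ≠ 0 → DifferentiableAt ℝ φ p := fun p hp =>
    (hreg.differentiableOn (by norm_num)).differentiableAt (hop.mem_nhds hp)
  have hd2 : ∀ p : ℝ × ℝ, p ≠ 0 → DifferentiableAt ℝ (fderiv ℝ φ) p := fun p hp =>
    (hC1.differentiableOn (by norm_num)).differentiableAt (hop.mem_nhds hp)
  have hsymm : ∀ p : ℝ × ℝ, p ≠ 0 → ∀ v w, fderiv ℝ (fderiv ℝ φ) p v w =
      fderiv ℝ (fderiv ℝ φ) p w v := fun p hp v w =>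
    ((hreg.contDiffAt (hop.mem_nhds hp)).isSymmSndFDerivAt (by simp)) v w
  have hker : ∀ p : ℝ × ℝ, p ≠ 0 → ∀ (v : ℝ × ℝ) (a : ℝ),
      fderiv ℝ (fderiv ℝ φ) p (v + a • p) (v + a • p) = fderiv ℝ (fderiv ℝ φ) p v v := by
    intro p hp v a
    have h0 := aux_euler2 φ hh p (hd2 p hp)
    have h1 := hsymm p hp v p
    rw [h0] at h1
    simp only [map_add, map_smul, h0, smul_zero, add_zero, h1]
    simp
  have hBpos : ∀ p : ℝ × ℝ, p ≠ 0 →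
      0 < fderiv ℝ (fderiv ℝ φ) p (p.2, -p.1) (p.2, -p.1) := by
    intro p hp
    have hφ := hpos p hp
    set a : ℝ := - fderiv ℝ φ p (p.2, -p.1) / φ p with ha
    have hk := hker p hp (p.2, -p.1) a
    set v : ℝ × ℝ := (p.2, -p.1) + a • p with hv
    have hLv : fderiv ℝ φ p v = 0 := by
      rw [hv, map_add, map_smul, aux_euler1 φ hh p (hd p hp), ha]
      simp only [smul_eq_mul]
      field_simp
      ring
    have h1 := hconv p hp v
    rw [aux_sq φ p v (by filter_upwards [hop.mem_nhds hp] with q hq using hd q hq)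
      (hd2 p hp), hLv, hk] at h1
    have hp2 : 0 < p.1 ^ 2 + p.2 ^ 2 := by
      by_contra hcon
      apply hp
      have e1 : p.1 = 0 := by nlinarith [sq_nonneg p.1, sq_nonneg p.2]
      have e2 : p.2 = 0 := by nlinarith [sq_nonneg p.1, sq_nonneg p.2]
      exact Prod.ext e1 e2
    have hvv : 0 < v.1 ^ 2 + v.2 ^ 2 := by
      have : v.1 ^ 2 + v.2 ^ 2 = (1 + a ^ 2) * (p.1 ^ 2 + p.2 ^ 2) := by
        simp [hv]; ring
      rw [this]; positivity
    have h2 : 0 < m * (v.1 ^ 2 + v.2 ^ 2) := mul_pos hm hvv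
    by_contra hcon
    push Not at hcon
    nlinarith [mul_nonneg hφ.le (neg_nonneg.2 hcon)]
  have hp2 : ∀ p : ℝ × ℝ, p ≠ 0 → 0 < p.1 ^ 2 + p.2 ^ 2 := by
    intro p hp
    by_contra hcon
    apply hp
    have e1 : p.1 = 0 := by nlinarith [sq_nonneg p.1, sq_nonneg p.2]
    have e2 : p.2 = 0 := by nlinarith [sq_nonneg p.1, sq_nonneg p.2]
    exact Prod.ext e1 e2
  let Q : ℝ × ℝ → ℝ := fun p =>
    φ p ^ 3 * fderiv ℝ (fderiv ℝ φ) p (p.2, -p.1) (p.2, -p.1) / (p.1 ^ 2 + p.2 ^ 2) ^ 2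
  have hQpos : ∀ p : ℝ × ℝ, p ≠ 0 → 0 < Q p := fun p hp =>
    div_pos (mul_pos (pow_pos (hpos p hp) 3) (hBpos p hp)) (pow_pos (hp2 p hp) 2)
  have hQc : ContinuousOn Q {(0 : ℝ × ℝ)}ᶜ := by
    have hJ : ContinuousOn (fun p : ℝ × ℝ => ((p.2, -p.1) : ℝ × ℝ)) {(0 : ℝ × ℝ)}ᶜ := by
      fun_prop
    refine ContinuousOn.div (((hreg.continuousOn).pow 3).mul ((hC0.clm_apply hJ).clm_apply hJ))
      (by fun_prop) ?_
    intro p hp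
    exact (pow_pos (hp2 p hp) 2).ne'
  have hQh : ∀ c : ℝ, 0 < c → ∀ p, p ≠ 0 → Q (c • p) = Q p := by
    intro c hc p hp
    have e : (((c • p).2, -(c • p).1) : ℝ × ℝ) = c • ((p.2, -p.1) : ℝ × ℝ) := by
      ext <;> simp
    have := (hp2 p hp).ne'
    simp only [Q, e, hh c hc, aux_hom2 φ hh c hc, map_smul]
    have e2 : (c • p).1 ^ 2 + (c • p).2 ^ 2 = c ^ 2 * (p.1 ^ 2 + p.2 ^ 2) := by
      simp; ring
    rw [e2]
    simp
    field_simp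
  have hQt : ∀ t : ℝ, pdx (pdx φ) (t, 1) = Q (t, 1) / φ (t, 1) ^ 3 := by
    intro t
    have hne : ((t, 1) : ℝ × ℝ) ≠ 0 := fun h => by simp at h
    have hφ := (hpos _ hne).ne'
    have ht : (t ^ 2 + 1) ≠ 0 := by positivity
    rw [aux_pdx φ hd hd2]
    have e : ((1, 0) : ℝ × ℝ) = (t ^ 2 + 1)⁻¹ • ((1, -t) : ℝ × ℝ)
        + (t / (t ^ 2 + 1)) • ((t, 1) : ℝ × ℝ) := by
      ext
      · simp; field_simp; ring
      · simp; field_simp; ring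
    rw [e, hker _ hne]
    simp only [Q, map_smul]
    simp
    field_simp
  have hK : IsCompact (Metric.sphere (0 : ℝ × ℝ) 1) := isCompact_sphere _ _
  have hKne : (Metric.sphere (0 : ℝ × ℝ) 1).Nonempty := ⟨(1, 0), by simp⟩
  have hKs : Metric.sphere (0 : ℝ × ℝ) 1 ⊆ {(0 : ℝ × ℝ)}ᶜ := by
    intro x hx h
    rw [mem_singleton_iff] at h
    simp [h] at hx
  obtain ⟨x, hx, hxm⟩ := hK.exists_isMinOn hKne (hQc.mono hKs)
  obtain ⟨y, hy, hyM⟩ := hK.exists_isMaxOn hKne (hQc.mono hKs)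
  refine ⟨Q x, Q y, hQpos x (hKs hx), hxm hy, fun t => ?_⟩
  have hne : ((t, 1) : ℝ × ℝ) ≠ 0 := fun h => by simp at h
  have hφ := hpos _ hne
  have hn : 0 < ‖((t, 1) : ℝ × ℝ)‖ := norm_pos_iff.2 hne
  have hs : ‖((t, 1) : ℝ × ℝ)‖⁻¹ • ((t, 1) : ℝ × ℝ) ∈ Metric.sphere (0 : ℝ × ℝ) 1 := by
    rw [mem_sphere_zero_iff_norm, norm_smul, norm_inv, norm_norm, inv_mul_cancel₀ hn.ne']
  have h1 : Q x ≤ Q (‖((t, 1) : ℝ × ℝ)‖⁻¹ • ((t, 1) : ℝ × ℝ)) := hxm hs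
  have h2 : Q (‖((t, 1) : ℝ × ℝ)‖⁻¹ • ((t, 1) : ℝ × ℝ)) ≤ Q y := hyM hs
  rw [hQh _ (inv_pos.2 hn) _ hne] at h1 h2
  rw [hQt]
  constructor <;> gcongr
end

section
/- Let φ be a norm on ℝ² that is C² on ℝ²∖{0} and such that φ² is uniformly convex. Then ∫₀^{+∞} √(1+t²) · φ_xx(−t,1) dt ≤ 2φ(1,0) + 2φ(0,1), and likewise ∫_{−∞}^{0} √(1+t²) · φ_xx(−t,1) dt ≤ 2φ(1,0) + 2φ(0,1). -/
open Set MeasureTheory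

lemma one_dim (G : ℝ → ℝ) (A B : ℝ) (hA : 0 ≤ A) (hB : 0 ≤ B) (hc : ConvexOn ℝ Set.univ G)
    (hs : ContDiff ℝ 2 G) (h0 : G 0 = B) (hlow : ∀ a, A * a - B ≤ G a)
    (hl : ∀ x y, |G x - G y| ≤ A * |x - y|) :
    (∫ t in Ioi (0 : ℝ), Real.sqrt (1 + t ^ 2) * deriv (deriv G) t) ≤ 2 * A + 2 * B := by
  have hd1 : ContDiff ℝ 1 (deriv G) := by
    have h2 : ContDiff ℝ (1 + 1) G := by
      have e : (1 + 1 : WithTop ℕ∞) = 2 := by norm_num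
      rw [e]; exact hs
    exact (contDiff_succ_iff_deriv.1 h2).2.2
  have hdG : Differentiable ℝ G := hs.differentiable (by norm_num)
  have hdd : Differentiable ℝ (deriv G) := hd1.differentiable (by norm_num)
  have hcd : Continuous (deriv (deriv G)) := hd1.continuous_deriv (by norm_num)
  have hmono : Monotone (deriv G) := by
    have := hc.monotoneOn_deriv (fun x _ => hdG x)
    exact monotoneOn_univ.1 this
  have hnn : ∀ t, 0 ≤ deriv (deriv G) t := fun t => hmono.deriv_nonneg
  have hbd : ∀ t, |deriv G t| ≤ A := by
    intro t
    have hL : LipschitzWith ⟨A, hA⟩ G := LipschitzWith.of_dist_le_mul (fun x y => by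
      rw [Real.dist_eq, Real.dist_eq]; exact hl x y)
    have := norm_deriv_le_of_lipschitz (x₀ := t) hL
    rw [Real.norm_eq_abs] at this
    exact this
  by_cases hi : IntegrableOn (fun t => Real.sqrt (1 + t ^ 2) * deriv (deriv G) t) (Ioi 0)
  swap
  · rw [integral_undef hi]; positivity
  have ht := intervalIntegral_tendsto_integral_Ioi 0 hi Filter.tendsto_id
  refine le_of_tendsto ht ?_
  filter_upwards [Filter.eventually_ge_atTop (0:ℝ)] with T hT
  simp only [id]
  have h1 : (∫ t in (0:ℝ)..T, Real.sqrt (1 + t ^ 2) * deriv (deriv G) t) ≤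
      ∫ t in (0:ℝ)..T, (1 + t) * deriv (deriv G) t := by
    apply intervalIntegral.integral_mono_on hT
    · apply Continuous.intervalIntegrable; fun_prop
    · apply Continuous.intervalIntegrable; fun_prop
    · intro t ht
      refine mul_le_mul_of_nonneg_right ?_ (hnn t)
      rw [Real.sqrt_le_left (by linarith [ht.1])]
      nlinarith [ht.1]
  have h2 : (∫ t in (0:ℝ)..T, (1 + t) * deriv (deriv G) t) =
      ((1 + T) * deriv G T - G T) - ((1 + 0) * deriv G 0 - G 0) := by
    refine intervalIntegral.integral_eq_sub_of_hasDerivAt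
      (f := fun t => (1 + t) * deriv G t - G t) ?_ ?_
    · intro t _
      have := (((hasDerivAt_id t).const_add 1).mul (hdd t).hasDerivAt).sub (hdG t).hasDerivAt
      convert this using 1
      · rfl
      · simp only [id]; ring
    · apply Continuous.intervalIntegrable; fun_prop
  have := abs_le.1 (hbd T)
  have := abs_le.1 (hbd 0)
  have := hlow T
  have : T * deriv G T ≤ T * A := mul_le_mul_of_nonneg_left (by linarith) hT
  rw [h2] at h1
  linarith

theorem stmt5 (φ : ℝ × ℝ → ℝ)
    (hnorm : IsNorm2 φ)
    (hreg : ContDiffOn ℝ 2 φ {(0 : ℝ × ℝ)}ᶜ)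
    (hconv : UnifConvexSq φ) :
    (∫ t in Ioi (0 : ℝ), Real.sqrt (1 + t ^ 2) * pdx (pdx φ) (-t, 1)) ≤
      2 * φ (1, 0) + 2 * φ (0, 1) ∧
    (∫ t in Iio (0 : ℝ), Real.sqrt (1 + t ^ 2) * pdx (pdx φ) (-t, 1)) ≤
      2 * φ (1, 0) + 2 * φ (0, 1) := by
  obtain ⟨hc, hh, hsym, hpos⟩ := hnorm
  have hA : 0 < φ (1, 0) := hpos _ (by simp)
  have hB : 0 < φ (0, 1) := hpos _ (by simp)
  have tri : ∀ p q, φ (p + q) ≤ φ p + φ q := by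
    intro p q
    have h := hc.2 (mem_univ p) (mem_univ q) (by norm_num : (0:ℝ) ≤ 1/2)
      (by norm_num : (0:ℝ) ≤ 1/2) (by norm_num)
    rw [← smul_add, hh _ (by norm_num)] at h
    simp only [smul_eq_mul] at h
    linarith
  have hx : ∀ a : ℝ, φ (a, 0) = φ (1, 0) * |a| := by
    intro a
    rcases lt_trichotomy a 0 with h | h | h
    · rw [abs_of_neg h, ← hsym, mul_comm, ← hh _ (by linarith)]; simp
    · have := hh 2 (by norm_num) (0, 0)
      simp at this
      subst h
      simp; linarith
    · rw [abs_of_pos h, mul_comm, ← hh _ h]; simp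
  have hl : ∀ x y : ℝ, φ (x, 1) - φ (y, 1) ≤ φ (1, 0) * |x - y| := by
    intro x y
    have := tri (y, 1) (x - y, 0)
    rw [hx] at this
    simp at this
    linarith
  have hl' : ∀ x y : ℝ, |φ (x, 1) - φ (y, 1)| ≤ φ (1, 0) * |x - y| := by
    intro x y
    rw [abs_le]
    have h1 := hl x y
    have h2 := hl y x
    rw [abs_sub_comm] at h2
    constructor <;> linarith
  have hlow : ∀ a : ℝ, φ (1, 0) * |a| - φ (0, 1) ≤ φ (a, 1) := by
    intro a
    have := tri (a, 1) (-(0, 1))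
    rw [hsym] at this
    simp at this
    rw [hx] at this
    linarith
  have hs : ContDiff ℝ 2 (fun a : ℝ => φ (a, 1)) := by
    rw [← contDiffOn_univ]
    refine hreg.comp (g := φ) (f := fun a : ℝ => (a, (1:ℝ))) (by fun_prop) ?_
    intro a _
    simp
  have hcv : ConvexOn ℝ Set.univ (fun a : ℝ => φ (a, 1)) := by
    refine ⟨convex_univ, fun x _ y _ a b ha hb hab => ?_⟩
    have := hc.2 (mem_univ (x, 1)) (mem_univ (y, 1)) ha hb hab
    simpa [hab] using this
  have hcv' : ConvexOn ℝ Set.univ (fun a : ℝ => φ (-a, 1)) := by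
    refine ⟨convex_univ, fun x _ y _ a b ha hb hab => ?_⟩
    have := hcv.2 (mem_univ (-x)) (mem_univ (-y)) ha hb hab
    have e : -(a • x + b • y) = a • (-x) + b • (-y) := by simp; ring
    simpa only [e] using this
  have key1 := one_dim (fun a => φ (a, 1)) _ _ hA.le hB.le hcv hs rfl
    (fun a => le_trans (by nlinarith [le_abs_self a]) (hlow a)) hl'
  have key2 := one_dim (fun a => φ (-a, 1)) _ _ hA.le hB.le hcv'
    (hs.comp (contDiff_neg)) (by simp)
    (fun a => le_trans (by rw [abs_neg]; nlinarith [le_abs_self a]) (hlow (-a)))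
    (fun x y => by
      have := hl' (-x) (-y)
      rwa [show -x - -y = -(x - y) by ring, abs_neg] at this)
  have hdd : ∀ t, deriv (deriv (fun a => φ (-a, 1))) t = pdx (pdx φ) (-t, 1) := by
    intro t
    have : deriv (fun a => φ (-a, 1)) = fun a => -deriv (fun a => φ (a, 1)) (-a) := by
      funext a
      exact deriv_comp_neg (fun a => φ (a, 1)) a
    rw [this, deriv.fun_neg, deriv_comp_neg (deriv (fun a => φ (a, 1)))]
    simp [pdx]
  constructor
  · simpa only [hdd] using key2
  · have h := integral_comp_neg_Ioi (0:ℝ)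
      (fun t => Real.sqrt (1 + t ^ 2) * pdx (pdx φ) (-t, 1))
    rw [neg_zero, integral_Iic_eq_integral_Iio] at h
    rw [← h]
    simpa [pdx] using key1
end

section
/- Let φ be a norm on ℝ² that is C² on ℝ²∖{0} and such that φ² is uniformly convex, and let ψ : ℝ² → [0,∞) be an anisotropy. Then ∫_{−∞}^{+∞} ψ(t,−1) · φ_xx(−t,1) dt ≤ 4(φ(1,0) + φ(0,1)) · max_{|p|=1} ψ(p). -/
open Set MeasureTheory

/-- An anisotropy: convex, positively 1-homogeneous and positive away from the
origin. -/
def IsAniso2 (ψ : ℝ × ℝ → ℝ) : Prop :=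
  ConvexOn ℝ Set.univ ψ ∧ (∀ c : ℝ, 0 < c → ∀ p, ψ (c • p) = c * ψ p) ∧
    (∀ p : ℝ × ℝ, p ≠ 0 → 0 < ψ p)

theorem aux_sub (φ : ℝ × ℝ → ℝ) (h : IsNorm2 φ) (p q : ℝ × ℝ) : φ (p + q) ≤ φ p + φ q := by
  obtain ⟨hc, hh, -, -⟩ := h
  have h1 := hc.2 (mem_univ p) (mem_univ q) (by norm_num : (0:ℝ) ≤ 1/2)
    (by norm_num : (0:ℝ) ≤ 1/2) (by norm_num)
  rw [← smul_add, hh _ (by norm_num)] at h1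
  simp only [smul_eq_mul] at h1
  linarith

theorem stmt6 (φ ψ : ℝ × ℝ → ℝ)
    (hnorm : IsNorm2 φ)
    (hreg : ContDiffOn ℝ 2 φ {(0 : ℝ × ℝ)}ᶜ)
    (hconv : UnifConvexSq φ)
    (hψ : IsAniso2 ψ)
    (M : ℝ) (hM : IsGreatest (ψ '' {p : ℝ × ℝ | p.1 ^ 2 + p.2 ^ 2 = 1}) M) :
    (∫ t : ℝ, ψ (t, -1) * pdx (pdx φ) (-t, 1)) ≤
      4 * (φ (1, 0) + φ (0, 1)) * M := by
  have hsub := aux_sub φ hnorm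
  obtain ⟨hc, hh, hs, hp⟩ := hnorm
  obtain ⟨-, hψh, hψp⟩ := hψ
  have hM0 : 0 < M :=
    lt_of_lt_of_le (hψp (1, 0) (by simp)) (hM.2 ⟨(1, 0), by simp, rfl⟩)
  have h10 : 0 < φ (1, 0) := hp _ (by simp)
  have h01 : 0 < φ (0, 1) := hp _ (by simp)
  by_cases hint : Integrable (fun t : ℝ => ψ (t, -1) * pdx (pdx φ) (-t, 1))
  swap
  · rw [integral_undef hint]; positivity
  set g : ℝ → ℝ := fun s => φ (s, 1) with hg
  have hpd : ∀ t, pdx (pdx φ) (t, 1) = deriv (deriv g) t := fun t => rfl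
  have hgC : ContDiff ℝ 2 g := by
    rw [← contDiffOn_univ]
    refine hreg.comp (t := {(0 : ℝ × ℝ)}ᶜ) (f := fun s : ℝ => (s, (1:ℝ))) ?_ ?_
    · exact (contDiff_id.prodMk contDiff_const).contDiffOn
    · intro s _; simp
  have hgconv : ConvexOn ℝ univ g := by
    refine ⟨convex_univ, fun x _ y _ a b ha hb hab => ?_⟩
    have := hc.2 (mem_univ (x, (1:ℝ))) (mem_univ (y, (1:ℝ))) ha hb hab
    simpa [hg, hab] using this
  have hgd : Differentiable ℝ g := hgC.differentiable (by norm_num)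
  have hg1 : ContDiff ℝ 1 (deriv g) := by
    have : ContDiff ℝ (1 + 1) g := by simpa [one_add_one_eq_two] using hgC
    exact (contDiff_succ_iff_deriv.1 this).2.2
  have hg1d : Differentiable ℝ (deriv g) := hg1.differentiable (by norm_num)
  have hg2c : Continuous (deriv (deriv g)) := hg1.continuous_deriv (by norm_num)
  have hmono : Monotone (deriv g) := by
    have := hgconv.monotoneOn_deriv (fun x _ => hgd x)
    exact monotoneOn_univ.1 (by simpa using this)
  have hg2 : ∀ t, 0 ≤ deriv (deriv g) t := fun t => hmono.deriv_nonneg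
  have htan : ∀ x y, g x + deriv g x * (y - x) ≤ g y := by
    intro x y
    rcases lt_trichotomy x y with h | h | h
    · have := hgconv.deriv_le_slope (mem_univ x) (mem_univ y) h (hgd x)
      rw [slope_def_field, le_div_iff₀ (by linarith)] at this
      linarith
    · simp [h]
    · have := hgconv.slope_le_deriv (mem_univ y) (mem_univ x) h (hgd x)
      rw [slope_def_field, div_le_iff₀ (by linarith)] at this
      linarith
  have hm10 : φ (-1, 0) = φ (1, 0) := by simpa using hs (1, 0)
  have hm01 : φ (0, -1) = φ (0, 1) := by simpa using hs (0, 1)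
  have hU : ∀ x, deriv g x ≤ φ (1, 0) := by
    intro x
    have h1 := htan x (x + 1)
    have h2 := hsub (x, 1) (1, 0)
    simp only [Prod.mk_add_mk, add_zero] at h2
    simp only [hg] at h1 ⊢
    linarith
  have hL : ∀ x, -φ (1, 0) ≤ deriv g x := by
    intro x
    have h1 := htan x (x - 1)
    have h2 := hsub (x, 1) (-1, 0)
    simp only [Prod.mk_add_mk, add_zero, ← sub_eq_add_neg] at h2
    simp only [hg] at h1 ⊢
    linarith
  have hE : ∀ x, x * deriv g x - g x ≤ φ (0, 1) := by
    intro x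
    have h1 := htan x (2 * x)
    have h2 := hsub (2 * x, 2) (0, -1)
    have h3 := hh 2 (by norm_num) (x, 1)
    simp only [Prod.smul_mk, smul_eq_mul, mul_one] at h3
    norm_num at h2
    simp only [hg] at h1 ⊢
    linarith
  have hψb : ∀ t : ℝ, ψ (t, -1) ≤ M * (1 + |t|) := by
    intro t
    have hr : 0 < Real.sqrt (1 + t ^ 2) := Real.sqrt_pos.2 (by positivity)
    have hr2 : Real.sqrt (1 + t ^ 2) ^ 2 = 1 + t ^ 2 := Real.sq_sqrt (by positivity)
    set r := Real.sqrt (1 + t ^ 2)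
    have h1 := hψh r hr (t / r, -1 / r)
    have h2 : ψ (t / r, -1 / r) ≤ M := by
      refine hM.2 ⟨_, ?_, rfl⟩
      simp only [mem_setOf_eq]
      field_simp
      linarith
    have h3 : r • ((t / r, -1 / r) : ℝ × ℝ) = (t, -1) := by
      simp only [Prod.smul_mk, smul_eq_mul]
      congr 1 <;> field_simp
    rw [h3] at h1
    have h4 : r ≤ 1 + |t| := by
      refine abs_le_of_sq_le_sq' ?_ (by positivity) |>.2
      rw [hr2]
      nlinarith [sq_abs t, abs_nonneg t]
    rw [h1]
    nlinarith
  refine le_of_tendsto (intervalIntegral_tendsto_integral hint Filter.tendsto_neg_atTop_atBot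
    Filter.tendsto_id) ?_
  filter_upwards [Filter.eventually_ge_atTop (0:ℝ)] with R hR
  simp only [id]
  have hcont : Continuous fun s : ℝ => M * (1 + |s|) * deriv (deriv g) s := by fun_prop
  have step1 : (∫ t in (-R)..R, ψ (t, -1) * pdx (pdx φ) (-t, 1)) ≤
      ∫ t in (-R)..R, M * (1 + |-t|) * deriv (deriv g) (-t) := by
    refine intervalIntegral.integral_mono_on (by linarith) hint.intervalIntegrable
      ((hcont.comp continuous_neg).intervalIntegrable _ _) ?_
    intro t _
    rw [hpd, abs_neg]
    exact mul_le_mul_of_nonneg_right (hψb t) (hg2 _)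
  refine step1.trans ?_
  rw [intervalIntegral.integral_comp_neg (fun s => M * (1 + |s|) * deriv (deriv g) s), neg_neg,
    ← intervalIntegral.integral_add_adjacent_intervals (b := 0)
      (hcont.intervalIntegrable _ _) (hcont.intervalIntegrable _ _)]
  have e1 : (∫ s in (-R)..0, M * (1 + |s|) * deriv (deriv g) s) =
      M * ((1 - 0) * deriv g 0 + g 0) - M * ((1 - (-R)) * deriv g (-R) + g (-R)) := by
    refine intervalIntegral.integral_eq_sub_of_hasDerivAt
      (f := fun s => M * ((1 - s) * deriv g s + g s)) ?_ (hcont.intervalIntegrable _ _)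
    intro s hs'
    rw [uIcc_of_le (by linarith)] at hs'
    rw [abs_of_nonpos hs'.2]
    have := (((((hasDerivAt_id s).const_sub 1).mul (hg1d s).hasDerivAt).add
      (hgd s).hasDerivAt).const_mul M)
    refine this.congr_deriv ?_
    simp only [id]; ring
  have e2 : (∫ s in (0)..R, M * (1 + |s|) * deriv (deriv g) s) =
      M * ((1 + R) * deriv g R - g R) - M * ((1 + 0) * deriv g 0 - g 0) := by
    refine intervalIntegral.integral_eq_sub_of_hasDerivAt
      (f := fun s => M * ((1 + s) * deriv g s - g s)) ?_ (hcont.intervalIntegrable _ _)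
    intro s hs'
    rw [uIcc_of_le (by linarith)] at hs'
    rw [abs_of_nonneg hs'.1]
    have := (((((hasDerivAt_id s).const_add 1).mul (hg1d s).hasDerivAt).sub
      (hgd s).hasDerivAt).const_mul M)
    refine this.congr_deriv ?_
    simp only [id]; ring
  rw [e1, e2]
  have a1 := hU R
  have a2 := hL (-R)
  have a3 := hE R
  have a4 := hE (-R)
  have a5 : g 0 = φ (0, 1) := rfl
  have key : ((1 - 0) * deriv g 0 + g 0) - ((1 - (-R)) * deriv g (-R) + g (-R)) +
      (((1 + R) * deriv g R - g R) - ((1 + 0) * deriv g 0 - g 0)) ≤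
      4 * (φ (1, 0) + φ (0, 1)) := by
    rw [a5]; linarith
  have := mul_le_mul_of_nonneg_left key hM0.le
  linarith
end

section
/- Let f : ℝ → ℝ be continuous with 0 < c₁ ≤ f(s) ≤ c₂ for all s ∈ ℝ, and let v be the solution of the initial value problem f(v(x)) v'(x) = 1 + v(x)², v(0) = 0, defined on its maximal interval of existence I. Then v is strictly increasing on I, the maximal interval satisfies (−c₁π/2, c₁π/2) ⊆ I ⊆ [−c₂π/2, c₂π/2], and tan(x/c₂) ≤ v(x) ≤ tan(x/c₁) for every x ∈ I with 0 ≤ x < c₁π/2 (with the symmetric bounds tan(x/c₁) ≤ v(x) ≤ tan(x/c₂) for x ∈ I with −c₁π/2 < x ≤ 0). -/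
open Set Real

theorem stmt9 (f : ℝ → ℝ) (hf : Continuous f)
    (c₁ c₂ : ℝ) (hc₁ : 0 < c₁) (hc₁₂ : c₁ ≤ c₂)
    (hbd : ∀ s : ℝ, c₁ ≤ f s ∧ f s ≤ c₂)
    (a b : ℝ) (ha : a < 0) (hb : 0 < b)
    (v : ℝ → ℝ) (hv0 : v 0 = 0)
    (hode : ∀ x ∈ Ioo a b, HasDerivAt v ((1 + v x ^ 2) / f (v x)) x)
    (hmax : ∀ (a' b' : ℝ) (w : ℝ → ℝ), a' ≤ a → b ≤ b' →
      Ioo a b ⊂ Ioo a' b' → w 0 = 0 →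
      (∀ x ∈ Ioo a' b', HasDerivAt w ((1 + w x ^ 2) / f (w x)) x) → False) :
    StrictMonoOn v (Ioo a b) ∧
    Ioo (-(c₁ * π / 2)) (c₁ * π / 2) ⊆ Ioo a b ∧
    Ioo a b ⊆ Icc (-(c₂ * π / 2)) (c₂ * π / 2) ∧
    (∀ x ∈ Ioo a b, 0 ≤ x → x < c₁ * π / 2 →
      Real.tan (x / c₂) ≤ v x ∧ v x ≤ Real.tan (x / c₁)) ∧
    (∀ x ∈ Ioo a b, -(c₁ * π / 2) < x → x ≤ 0 →
      Real.tan (x / c₁) ≤ v x ∧ v x ≤ Real.tan (x / c₂)) := by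
  have hfpos : ∀ s, 0 < f s := fun s => hc₁.trans_le (hbd s).1
  have hc₂ : 0 < c₂ := hc₁.trans_le hc₁₂
  have hp : ∀ s : ℝ, 0 < 1 + s ^ 2 := fun s => by positivity
  have hgc : Continuous (fun s => f s / (1 + s ^ 2)) :=
    hf.div (by fun_prop) (fun s => (hp s).ne')
  obtain ⟨F, hF0, hFs⟩ : ∃ F : ℝ → ℝ, F 0 = 0 ∧
      ∀ s, HasStrictDerivAt F (f s / (1 + s ^ 2)) s :=
    ⟨fun s => ∫ t in (0 : ℝ)..s, f t / (1 + t ^ 2), by simp,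
      fun s => hgc.integral_hasStrictDerivAt 0 s⟩
  have hFd : ∀ s, HasDerivAt F (f s / (1 + s ^ 2)) s := fun s => (hFs s).hasDerivAt
  have hFm : StrictMono F := strictMono_of_deriv_pos (fun s => by
    rw [(hFd s).deriv]; exact div_pos (hfpos s) (hp s))
  have hFc : Continuous F := continuous_iff_continuousAt.2 fun s => (hFd s).continuousAt
  have hm1 : Monotone (fun s => F s - c₁ * arctan s) := by
    have hd : ∀ s, HasDerivAt (fun s => F s - c₁ * arctan s)
        (f s / (1 + s ^ 2) - c₁ * (1 / (1 + s ^ 2))) s := fun s =>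
      (hFd s).sub ((hasDerivAt_arctan s).const_mul c₁)
    refine monotone_of_deriv_nonneg (fun s => (hd s).differentiableAt) fun s => ?_
    rw [(hd s).deriv, mul_one_div, ← sub_div]
    exact div_nonneg (sub_nonneg.2 (hbd s).1) (hp s).le
  have hm2 : Monotone (fun s => c₂ * arctan s - F s) := by
    have hd : ∀ s, HasDerivAt (fun s => c₂ * arctan s - F s)
        (c₂ * (1 / (1 + s ^ 2)) - f s / (1 + s ^ 2)) s := fun s =>
      ((hasDerivAt_arctan s).const_mul c₂).sub (hFd s)
    refine monotone_of_deriv_nonneg (fun s => (hd s).differentiableAt) fun s => ?_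
    rw [(hd s).deriv, mul_one_div, ← sub_div]
    exact div_nonneg (sub_nonneg.2 (hbd s).2) (hp s).le
  have hpos : ∀ s, 0 ≤ s → c₁ * arctan s ≤ F s ∧ F s ≤ c₂ * arctan s := fun s hs => by
    have h1 := hm1 hs
    have h2 := hm2 hs
    simp only [hF0, arctan_zero] at h1 h2
    constructor <;> linarith
  have hneg : ∀ s, s ≤ 0 → c₂ * arctan s ≤ F s ∧ F s ≤ c₁ * arctan s := fun s hs => by
    have h1 := hm1 hs
    have h2 := hm2 hs
    simp only [hF0, arctan_zero] at h1 h2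
    constructor <;> linarith
  have h0 : (0 : ℝ) ∈ Ioo a b := ⟨ha, hb⟩
  have hFv : ∀ x ∈ Ioo a b, F (v x) = x := by
    have hd : ∀ x ∈ Ioo a b, HasDerivAt (fun x => F (v x) - x) 0 x := fun x hx => by
      have h := ((hFd (v x)).comp x (hode x hx)).sub (hasDerivAt_id x)
      have e : f (v x) / (1 + v x ^ 2) * ((1 + v x ^ 2) / f (v x)) - 1 = 0 := by
        have := (hfpos (v x)).ne'
        have := (hp (v x)).ne'
        field_simp
        ring
      rw [e] at h
      exact h
    intro x hx
    have := isOpen_Ioo.is_const_of_deriv_eq_zero isPreconnected_Ioo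
      (fun y hy => (hd y hy).differentiableAt.differentiableWithinAt)
      (fun y hy => (hd y hy).deriv) hx h0
    simp only [hv0, hF0] at this
    linarith
  have hrange : ∀ x, -(c₁ * π / 2) < x → x < c₁ * π / 2 → ∃ s, F s = x := by
    intro x hx1 hx2
    have e1 : -(π / 2) < x / c₁ := by rw [lt_div_iff₀ hc₁]; linarith
    have e2 : x / c₁ < π / 2 := by rw [div_lt_iff₀ hc₁]; linarith
    have e3 : c₁ * arctan (tan (x / c₁)) = x := by
      rw [arctan_tan e1 e2]; field_simp
    have hr : ∀ y, (∃ s, F s ≤ y) → (∃ s, y ≤ F s) → ∃ s, F s = y := fun y h1 h2 =>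
      mem_range_of_exists_le_of_exists_ge hFc h1 h2
    rcases le_total 0 x with h | h
    · refine hr x ⟨0, by rw [hF0]; exact h⟩ ⟨tan (x / c₁), ?_⟩
      have : 0 ≤ tan (x / c₁) := tan_nonneg_of_nonneg_of_le_pi_div_two (by positivity) e2.le
      linarith [(hpos _ this).1]
    · refine hr x ⟨tan (x / c₁), ?_⟩ ⟨0, by rw [hF0]; exact h⟩
      have : tan (x / c₁) ≤ 0 := tan_nonpos_of_nonpos_of_neg_pi_div_two_le
        (div_nonpos_of_nonpos_of_nonneg h hc₁.le) e1.le
      linarith [(hneg _ this).2]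
  have hinv : ∀ s, Function.invFun F (F s) = s := Function.leftInverse_invFun hFm.injective
  have hw : ∀ s, HasDerivAt (Function.invFun F)
      ((1 + (Function.invFun F (F s)) ^ 2) / f (Function.invFun F (F s))) (F s) := fun s => by
    have h := ((hFs s).to_local_left_inverse (div_pos (hfpos s) (hp s)).ne'
      (Filter.Eventually.of_forall hinv)).hasDerivAt
    rw [inv_div] at h
    rw [hinv]
    exact h
  have hw0 : Function.invFun F 0 = 0 := by
    have := hinv 0
    rwa [hF0] at this
  have hnomax : ∀ a' b', a' ≤ a → b ≤ b' → Ioo a b ⊂ Ioo a' b' →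
      (∀ x ∈ Ioo a' b', ∃ s, F s = x) → False := fun a' b' h1 h2 h3 h4 =>
    hmax a' b' _ h1 h2 h3 hw0 (fun x hx => by
      obtain ⟨s, rfl⟩ := h4 x hx
      exact hw s)
  have hcp : 0 < c₁ * π / 2 := by positivity
  have hB : c₁ * π / 2 ≤ b := by
    by_contra! h
    refine hnomax a (c₁ * π / 2) le_rfl h.le ⟨Ioo_subset_Ioo le_rfl h.le, fun hs => ?_⟩ ?_
    · exact lt_irrefl b (hs (⟨by linarith, h⟩ : b ∈ Ioo a (c₁ * π / 2))).2
    · intro x hx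
      by_cases hxb : x < b
      · exact ⟨_, hFv x ⟨hx.1, hxb⟩⟩
      · exact hrange x (by linarith) hx.2
  have hA : a ≤ -(c₁ * π / 2) := by
    by_contra! h
    refine hnomax (-(c₁ * π / 2)) b h.le le_rfl ⟨Ioo_subset_Ioo h.le le_rfl, fun hs => ?_⟩ ?_
    · exact lt_irrefl a (hs (⟨h, by linarith⟩ : a ∈ Ioo (-(c₁ * π / 2)) b)).1
    · intro x hx
      by_cases hxb : a < x
      · exact ⟨_, hFv x ⟨hxb, hx.2⟩⟩
      · exact hrange x hx.1 (by linarith)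
  have htan : ∀ y z, -(π / 2) < y → z < π / 2 → y ≤ z → tan y ≤ tan z := fun y z h1 h2 h =>
    strictMonoOn_tan.monotoneOn ⟨h1, h.trans_lt h2⟩ ⟨h1.trans_le h, h2⟩ h
  have hvp : ∀ x ∈ Ioo a b, 0 ≤ x → 0 ≤ v x := fun x hx h => by
    rw [← hFm.le_iff_le, hF0, hFv x hx]; exact h
  have hvn : ∀ x ∈ Ioo a b, x ≤ 0 → v x ≤ 0 := fun x hx h => by
    rw [← hFm.le_iff_le, hF0, hFv x hx]; exact h
  refine ⟨?_, Ioo_subset_Ioo hA hB, ?_, ?_, ?_⟩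
  · intro x hx y hy hxy
    rw [← hFm.lt_iff_lt, hFv x hx, hFv y hy]
    exact hxy
  · intro x hx
    have l1 := mul_lt_mul_of_pos_left (neg_pi_div_two_lt_arctan (v x)) hc₂
    have l2 := mul_lt_mul_of_pos_left (arctan_lt_pi_div_two (v x)) hc₂
    have : 0 < c₂ * π / 2 := by positivity
    rcases le_total 0 x with h | h
    · have := hpos _ (hvp x hx h)
      rw [hFv x hx] at this
      constructor <;> linarith
    · have := hneg _ (hvn x hx h)
      rw [hFv x hx] at this
      constructor <;> linarith
  · intro x hx h hx2
    have hb' := hpos _ (hvp x hx h)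
    rw [hFv x hx] at hb'
    have q1 : x / c₂ ≤ arctan (v x) := by rw [div_le_iff₀ hc₂]; linarith
    have q2 : arctan (v x) ≤ x / c₁ := by rw [le_div_iff₀ hc₁]; linarith
    have q3 : x / c₁ < π / 2 := by rw [div_lt_iff₀ hc₁]; linarith
    have q4 : 0 ≤ x / c₂ := by positivity
    have t1 := htan _ _ (by linarith [pi_pos]) (arctan_lt_pi_div_two _) q1
    have t2 := htan _ _ (neg_pi_div_two_lt_arctan _) q3 q2
    rw [tan_arctan] at t1 t2
    exact ⟨t1, t2⟩
  · intro x hx hx2 h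
    have hb' := hneg _ (hvn x hx h)
    rw [hFv x hx] at hb'
    have q1 : arctan (v x) ≤ x / c₂ := by rw [le_div_iff₀ hc₂]; linarith
    have q2 : x / c₁ ≤ arctan (v x) := by rw [div_le_iff₀ hc₁]; linarith
    have q3 : -(π / 2) < x / c₁ := by rw [lt_div_iff₀ hc₁]; linarith
    have q4 : x / c₂ ≤ 0 := div_nonpos_of_nonpos_of_nonneg h hc₂.le
    have t1 := htan _ _ (neg_pi_div_two_lt_arctan _) (by linarith [pi_pos]) q1
    have t2 := htan _ _ q3 (arctan_lt_pi_div_two _) q2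
    rw [tan_arctan] at t1 t2
    exact ⟨t2, t1⟩
end

section
/- Let φ be a norm on ℝ² that is C² on ℝ²∖{0} with φ² uniformly convex, and let ψ : ℝ² → [0,∞) be a continuous anisotropy. Then there exists an open interval I containing 0 and a convex C² function u : I → ℝ with u(0) = u'(0) = 0 satisfying ψ(−u'(x), 1) · φ_xx(−u'(x), 1) · u''(x) = 1 for all x ∈ I, where I is the maximal interval of existence; this solution is unique, u' is strictly increasing on I, and the length of I satisfies |I| ≤ 4(φ(1,0) + φ(0,1)) · max_{|p|=1} ψ(p). -/
open Set

open Set Filter Topology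

lemma aux_ode (G H : ℝ → ℝ) (C : ℝ) (hG : Continuous G) (hpos : ∀ s, 0 < G s)
    (hH : ∀ s, HasDerivAt H (G s) s) (H0 : H 0 = 0) (hb : ∀ s t, H s - H t ≤ C) :
    ∃ a b : ℝ, a < 0 ∧ 0 < b ∧ ∃ u : ℝ → ℝ,
      ConvexOn ℝ (Ioo a b) u ∧ ContDiffOn ℝ 2 u (Ioo a b) ∧
      u 0 = 0 ∧ deriv u 0 = 0 ∧
      (∀ x ∈ Ioo a b, G (deriv u x) * deriv (deriv u) x = 1) ∧
      (∀ (a' b' : ℝ) (u₂ : ℝ → ℝ), a' ≤ a → b ≤ b' → Ioo a b ⊂ Ioo a' b' →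
        ContDiffOn ℝ 2 u₂ (Ioo a' b') → u₂ 0 = 0 → deriv u₂ 0 = 0 →
        (∀ x ∈ Ioo a' b', G (deriv u₂ x) * deriv (deriv u₂) x = 1) →
        False) ∧
      (∀ u₂ : ℝ → ℝ, ContDiffOn ℝ 2 u₂ (Ioo a b) → u₂ 0 = 0 → deriv u₂ 0 = 0 →
        (∀ x ∈ Ioo a b, G (deriv u₂ x) * deriv (deriv u₂) x = 1) →
        EqOn u u₂ (Ioo a b)) ∧
      StrictMonoOn (deriv u) (Ioo a b) ∧
      b - a ≤ C := by
  have hHc : Continuous H := continuous_iff_continuousAt.2 fun s => (hH s).continuousAt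
  have hmono : StrictMono H := strictMono_of_deriv_pos fun s => by
    rw [(hH s).deriv]; exact hpos s
  have hba : BddAbove (range H) := ⟨C, by rintro _ ⟨s, rfl⟩; have := hb s 0; linarith⟩
  have hbb : BddBelow (range H) := ⟨-C, by rintro _ ⟨s, rfl⟩; have := hb 0 s; linarith⟩
  have hne : (range H).Nonempty := range_nonempty H
  set a := sInf (range H) with ha
  set b := sSup (range H) with hbdef
  have hmem : ∀ s, H s ∈ Ioo a b := fun s =>
    ⟨(csInf_le hbb ⟨s - 1, rfl⟩).trans_lt (hmono (by linarith)),
      (hmono (by linarith : s < s + 1)).trans_le (le_csSup hba ⟨s + 1, rfl⟩)⟩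
  have hsurj : ∀ x ∈ Ioo a b, ∃ s, H s = x := by
    intro x hx
    obtain ⟨_, ⟨s, rfl⟩, hs⟩ := exists_lt_of_csInf_lt hne hx.1
    obtain ⟨_, ⟨t, rfl⟩, ht⟩ := exists_lt_of_lt_csSup hne hx.2
    exact mem_range_of_exists_le_of_exists_ge hHc ⟨s, hs.le⟩ ⟨t, ht.le⟩
  have h0 : (0 : ℝ) ∈ Ioo a b := H0 ▸ hmem 0
  set w : ℝ → ℝ := Function.invFun H with hw
  have hwH : ∀ s, w (H s) = s := Function.leftInverse_invFun hmono.injective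
  have hHw : ∀ x ∈ Ioo a b, H (w x) = x := fun x hx => Function.invFun_eq (hsurj x hx)
  have hw0 : w 0 = 0 := by have := hwH 0; rwa [H0] at this
  have hwmono : StrictMonoOn w (Ioo a b) := by
    intro x hx y hy hxy
    rw [← hmono.lt_iff_lt, hHw x hx, hHw y hy]; exact hxy
  have hwim : w '' Ioo a b = univ := by
    ext s; simp only [mem_univ, iff_true]; exact ⟨H s, hmem s, hwH s⟩
  have hnh : ∀ x ∈ Ioo a b, Ioo a b ∈ 𝓝 x := fun x hx => isOpen_Ioo.mem_nhds hx
  have hwc : ∀ x ∈ Ioo a b, ContinuousAt w x := fun x hx =>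
    hwmono.continuousAt_of_image_mem_nhds (hnh x hx) (by rw [hwim]; exact univ_mem)
  have hwd : ∀ x ∈ Ioo a b, HasDerivAt w (G (w x))⁻¹ x := fun x hx =>
    HasDerivAt.of_local_left_inverse (hwc x hx) (hH (w x)) (hpos _).ne'
      (by filter_upwards [hnh x hx] with y hy using hHw y hy)
  set K : ℝ → ℝ := fun s => ∫ t in (0:ℝ)..s, H t with hK
  have hKd : ∀ s, HasDerivAt K (H s) s := fun s =>
    intervalIntegral.integral_hasDerivAt_right (hHc.intervalIntegrable _ _)
      (hHc.stronglyMeasurableAtFilter _ _) hHc.continuousAt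
  set u : ℝ → ℝ := fun x => x * w x - K (w x) with hu
  have hud : ∀ x ∈ Ioo a b, HasDerivAt u (w x) x := by
    intro x hx
    have h1 := ((hasDerivAt_id x).mul (hwd x hx)).sub ((hKd (w x)).comp x (hwd x hx))
    refine h1.congr_deriv ?_
    rw [hHw x hx]; simp
  have hdu : EqOn (deriv u) w (Ioo a b) := fun x hx => (hud x hx).deriv
  have hddu : ∀ x ∈ Ioo a b, HasDerivAt (deriv u) (G (w x))⁻¹ x := fun x hx =>
    (hwd x hx).congr_of_eventuallyEq (by filter_upwards [hnh x hx] with y hy using hdu hy)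
  have huC : ContDiffOn ℝ 2 u (Ioo a b) := by
    rw [show (2 : WithTop ℕ∞) = 1 + 1 by norm_num, contDiffOn_succ_iff_deriv_of_isOpen isOpen_Ioo]
    refine ⟨fun x hx => (hud x hx).differentiableAt.differentiableWithinAt, by simp, ?_⟩
    rw [show (1 : WithTop ℕ∞) = 0 + 1 by norm_num, contDiffOn_succ_iff_deriv_of_isOpen isOpen_Ioo]
    refine ⟨fun x hx => (hddu x hx).differentiableAt.differentiableWithinAt, by simp, ?_⟩
    rw [contDiffOn_zero]
    have : ContinuousOn (fun x => (G (w x))⁻¹) (Ioo a b) := fun x hx =>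
      ((hG.continuousAt.comp (hwc x hx)).inv₀ (hpos _).ne').continuousWithinAt
    exact this.congr fun x hx => (hddu x hx).deriv
  have hsm : StrictMonoOn (deriv u) (Ioo a b) := fun x hx y hy hxy => by
    rw [hdu hx, hdu hy]; exact hwmono hx hy hxy
  -- key: any solution satisfies H (u₂' x) = x
  have key : ∀ (a' b' : ℝ) (u₂ : ℝ → ℝ), (0:ℝ) ∈ Ioo a' b' →
      ContDiffOn ℝ 2 u₂ (Ioo a' b') → deriv u₂ 0 = 0 →
      (∀ x ∈ Ioo a' b', G (deriv u₂ x) * deriv (deriv u₂) x = 1) →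
      ∀ x ∈ Ioo a' b', H (deriv u₂ x) = x := by
    intro a' b' u₂ h0' hC hd0 hode x hx
    have hC1 : ContDiffOn ℝ 1 (deriv u₂) (Ioo a' b') := by
      rw [show (2 : WithTop ℕ∞) = 1 + 1 by norm_num,
        contDiffOn_succ_iff_deriv_of_isOpen isOpen_Ioo] at hC
      exact hC.2.2
    have hd : ∀ y ∈ Ioo a' b', HasDerivAt (fun z => H (deriv u₂ z) - z) 0 y := by
      intro y hy
      have h1 := ((hC1.differentiableOn (by norm_num)).differentiableAt
        (isOpen_Ioo.mem_nhds hy)).hasDerivAt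
      have h2 := ((hH (deriv u₂ y)).comp y h1).sub (hasDerivAt_id y)
      refine h2.congr_deriv ?_
      rw [hode y hy]; simp
    have := isOpen_Ioo.is_const_of_deriv_eq_zero isPreconnected_Ioo
      (fun y hy => (hd y hy).differentiableAt.differentiableWithinAt)
      (fun y hy => (hd y hy).deriv) hx h0'
    simp only [hd0, H0] at this
    linarith
  refine ⟨a, b, h0.1, h0.2, u, ?_, huC, ?_, ?_, ?_, ?_, ?_, hsm, ?_⟩
  · refine MonotoneOn.convexOn_of_deriv (convex_Ioo a b) huC.continuousOn ?_ ?_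
    · rw [interior_Ioo]; exact huC.differentiableOn (by norm_num)
    · rw [interior_Ioo]; exact hsm.monotoneOn
  · simp [hu, hw0, hK]
  · rw [hdu h0, hw0]
  · intro x hx
    rw [(hddu x hx).deriv, hdu hx, mul_inv_cancel₀ (hpos _).ne']
  · intro a' b' u₂ ha' hb' hss hC _ hd0 hode
    obtain ⟨y, hy, hy'⟩ := exists_of_ssubset hss
    have := key a' b' u₂ (hss.1 h0) hC hd0 hode y hy
    exact hy' (this ▸ hmem _)
  · intro u₂ hC hz hd0 hode x hx
    have h1 := key a b u₂ h0 hC hd0 hode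
    have hd : ∀ y ∈ Ioo a b, HasDerivAt (fun z => u z - u₂ z) 0 y := by
      intro y hy
      have h3 := ((hC.differentiableOn (by norm_num)).differentiableAt
        (hnh y hy)).hasDerivAt
      refine ((hud y hy).sub h3).congr_deriv ?_
      have : w y = deriv u₂ y := hmono.injective (by rw [hHw y hy, h1 y hy])
      rw [this, sub_self]
    have := isOpen_Ioo.is_const_of_deriv_eq_zero isPreconnected_Ioo
      (fun y hy => (hd y hy).differentiableAt.differentiableWithinAt)
      (fun y hy => (hd y hy).deriv) hx h0
    have hu0 : u 0 = 0 := by simp [hu, hw0, hK]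
    simp only [hu0, hz] at this
    linarith
  · by_contra hcon
    push Not at hcon
    obtain ⟨_, ⟨s, rfl⟩, hs⟩ := exists_lt_of_lt_csSup hne (show a + C < b by linarith)
    obtain ⟨_, ⟨t, rfl⟩, ht⟩ := exists_lt_of_csInf_lt hne (show a < H s - C by linarith)
    have := hb s t
    linarith

lemma aux_bound (g ψ₁ H : ℝ → ℝ) (A B M : ℝ) (hg : ContDiff ℝ 2 g)
    (hH : ∀ s, HasDerivAt H (ψ₁ s * deriv (deriv g) s) s) (H0 : H 0 = 0)
    (hg2 : ∀ s, 0 ≤ deriv (deriv g) s) (hψ : ∀ s, ψ₁ s ≤ M * (1 + |s|)) (hM : 0 ≤ M)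
    (hA : 0 ≤ A) (hψ0 : ∀ s, 0 ≤ ψ₁ s)
    (h1 : ∀ s, deriv g s ≤ A) (h2 : ∀ s, -A ≤ deriv g s)
    (h3 : ∀ s, s * deriv g s - g s ≤ B) (h0 : g 0 = B) (s t : ℝ) :
    H s - H t ≤ 4 * (A + B) * M := by
  have hgd : ∀ s, HasDerivAt g (deriv g s) s := fun s =>
    ((hg.differentiable (by norm_num)) s).hasDerivAt
  have hg' : ContDiff ℝ 1 (deriv g) := by
    rw [show (2 : WithTop ℕ∞) = 1 + 1 by norm_num, contDiff_succ_iff_deriv] at hg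
    exact hg.2.2
  have hgdd : ∀ s, HasDerivAt (deriv g) (deriv (deriv g) s) s := fun s =>
    ((hg'.differentiable (by norm_num)) s).hasDerivAt
  have hB : 0 ≤ A + B := by
    have := h3 0; rw [h0] at this; linarith
  have hmono : Monotone H := monotone_of_deriv_nonneg (fun s => (hH s).differentiableAt)
    fun s => by rw [(hH s).deriv]; exact mul_nonneg (hψ0 s) (hg2 s)
  have up : ∀ s, 0 ≤ s → H s ≤ M * (A - deriv g 0 + 2 * B) := by
    intro s hs
    have hd : ∀ y, HasDerivAt (fun y => M * (deriv g y + (y * deriv g y - g y)) - H y)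
        (M * (deriv (deriv g) y + (1 * deriv g y + y * deriv (deriv g) y - deriv g y))
          - ψ₁ y * deriv (deriv g) y) y := fun y =>
      (((hgdd y).add (((hasDerivAt_id y).mul (hgdd y)).sub (hgd y))).const_mul M).sub (hH y)
    have hm : MonotoneOn (fun y => M * (deriv g y + (y * deriv g y - g y)) - H y) (Ici 0) := by
      refine monotoneOn_of_deriv_nonneg (convex_Ici 0)
        (fun y _ => (hd y).continuousAt.continuousWithinAt)
        (fun y _ => (hd y).differentiableAt.differentiableWithinAt) ?_
      intro y hy
      rw [interior_Ici] at hy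
      rw [(hd y).deriv]
      have := hψ y
      rw [abs_of_pos hy] at this
      nlinarith [mul_le_mul_of_nonneg_right this (hg2 y)]
    have := hm (mem_Ici.2 le_rfl) (mem_Ici.2 hs) hs
    simp only [H0, h0] at this
    have e : M * (deriv g s + (s * deriv g s - g s)) ≤ M * (A + B) :=
      mul_le_mul_of_nonneg_left (by linarith [h1 s, h3 s]) hM
    nlinarith
  have lo : ∀ s, s ≤ 0 → M * (-A - deriv g 0 - 2 * B) ≤ H s := by
    intro s hs
    have hd : ∀ y, HasDerivAt (fun y => M * (deriv g y - (y * deriv g y - g y)) - H y)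
        (M * (deriv (deriv g) y - (1 * deriv g y + y * deriv (deriv g) y - deriv g y))
          - ψ₁ y * deriv (deriv g) y) y := fun y =>
      (((hgdd y).sub (((hasDerivAt_id y).mul (hgdd y)).sub (hgd y))).const_mul M).sub (hH y)
    have hm : MonotoneOn (fun y => M * (deriv g y - (y * deriv g y - g y)) - H y) (Iic 0) := by
      refine monotoneOn_of_deriv_nonneg (convex_Iic 0)
        (fun y _ => (hd y).continuousAt.continuousWithinAt)
        (fun y _ => (hd y).differentiableAt.differentiableWithinAt) ?_
      intro y hy
      rw [interior_Iic] at hy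
      rw [(hd y).deriv]
      have := hψ y
      rw [abs_of_neg hy] at this
      nlinarith [mul_le_mul_of_nonneg_right this (hg2 y)]
    have := hm (mem_Iic.2 hs) (mem_Iic.2 le_rfl) hs
    simp only [H0, h0] at this
    have e : M * (-A - B) ≤ M * (deriv g s - (s * deriv g s - g s)) :=
      mul_le_mul_of_nonneg_left (by linarith [h2 s, h3 s]) hM
    nlinarith
  have e1 := up (max s 0) (le_max_right _ _)
  have e2 := lo (min t 0) (min_le_right _ _)
  have e3 := hmono (le_max_left s 0)
  have e4 := hmono (min_le_left t 0)
  nlinarith [mul_nonneg hM hA]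

lemma aux_smooth (φ : ℝ × ℝ → ℝ) (hreg : ContDiffOn ℝ 2 φ {(0 : ℝ × ℝ)}ᶜ) :
    ContDiff ℝ 2 (fun s => φ (s, 1)) := by
  rw [← contDiffOn_univ]
  refine hreg.comp (g := φ) (f := fun s : ℝ => (s, (1:ℝ))) (by fun_prop) ?_
  intro s _
  simp [Prod.ext_iff]

lemma aux_pos (φ : ℝ × ℝ → ℝ) (hnorm : IsNorm2 φ)
    (hreg : ContDiffOn ℝ 2 φ {(0 : ℝ × ℝ)}ᶜ) (hconv : UnifConvexSq φ) (s : ℝ) :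
    0 < deriv (deriv (fun s => φ (s, 1))) s := by
  obtain ⟨-, hhom, -, hp⟩ := hnorm
  obtain ⟨m, hm, hconv⟩ := hconv
  have hg := aux_smooth φ hreg
  set g : ℝ → ℝ := fun s => φ (s, 1) with hgdef
  have hgd : ∀ s, HasDerivAt g (deriv g s) s := fun s =>
    ((hg.differentiable (by norm_num)) s).hasDerivAt
  have hg' : ContDiff ℝ 1 (deriv g) := by
    rw [show (2 : WithTop ℕ∞) = 1 + 1 by norm_num, contDiff_succ_iff_deriv] at hg
    exact hg.2.2
  have hgdd : ∀ s, HasDerivAt (deriv g) (deriv (deriv g) s) s := fun s =>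
    ((hg'.differentiable (by norm_num)) s).hasDerivAt
  have hp0 : ((s, 1) : ℝ × ℝ) ≠ 0 := by simp [Prod.ext_iff]
  have hgs : 0 < g s := hp _ hp0
  set t : ℝ := -(deriv g s) / g s with ht
  set v : ℝ × ℝ := (1 + t * s, t) with hv
  set Φ : ℝ × ℝ → ℝ := fun r => φ r ^ 2 with hΦ
  have hopen : IsOpen ({(0 : ℝ × ℝ)}ᶜ) := isOpen_compl_singleton
  have hΦC : ContDiffOn ℝ 2 Φ {(0 : ℝ × ℝ)}ᶜ := hreg.pow 2
  have hΦd : ∀ q : ℝ × ℝ, q ≠ 0 → HasFDerivAt Φ (fderiv ℝ Φ q) q := fun q hq =>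
    ((hΦC.contDiffAt (hopen.mem_nhds hq)).differentiableAt (by norm_num)).hasFDerivAt
  have hΦ2 : HasFDerivAt (fun q => fderiv ℝ Φ q) (fderiv ℝ (fun q => fderiv ℝ Φ q) (s, 1)) (s, 1) :=
    (((hΦC.contDiffAt (hopen.mem_nhds hp0)).fderiv_right (m := 1) (by norm_num)).differentiableAt
      (by norm_num)).hasFDerivAt
  -- the line
  set ℓ : ℝ → ℝ × ℝ := fun τ => (s, 1) + τ • v with hℓ
  have hℓd : ∀ τ, HasDerivAt ℓ v τ := fun τ => by
    have := ((hasDerivAt_id τ).smul_const v).const_add ((s, 1) : ℝ × ℝ)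
    exact this.congr_deriv (by simp)
  have hℓ0 : ℓ 0 = (s, 1) := by simp [hℓ]
  have hev : ∀ᶠ τ : ℝ in 𝓝 0, 0 < 1 + τ * t := by
    have : ContinuousAt (fun τ : ℝ => 1 + τ * t) 0 := by fun_prop
    exact this.eventually (lt_mem_nhds (by simp))
  set k : ℝ → ℝ := fun τ => s + τ / (1 + τ * t) with hk
  have hk0 : k 0 = s := by simp [hk]
  have hkd : ∀ τ, 0 < 1 + τ * t → HasDerivAt k (1 / (1 + τ * t) ^ 2) τ := by
    intro τ hτ
    have h1 : HasDerivAt (fun τ : ℝ => 1 + τ * t) t τ := by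
      simpa using ((hasDerivAt_id τ).mul_const t).const_add 1
    have := ((hasDerivAt_id τ).div h1 hτ.ne').const_add s
    refine this.congr_deriv ?_
    simp only [id]
    congr 1
    ring
  have hΦℓ : ∀ τ, 0 < 1 + τ * t → Φ (ℓ τ) = ((1 + τ * t) * g (k τ)) ^ 2 := by
    intro τ hτ
    have : ℓ τ = (1 + τ * t) • (k τ, (1:ℝ)) := by
      ext
      · simp only [hℓ, hv, hk, Prod.fst_add, Prod.smul_fst, smul_eq_mul]
        field_simp
        ring
      · simp [hℓ, hv]
    simp only [hΦ, this, hhom _ hτ, hgdef]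
  have hhd : ∀ τ, 0 < 1 + τ * t → HasDerivAt (fun τ => (1 + τ * t) * g (k τ))
      (t * g (k τ) + deriv g (k τ) / (1 + τ * t)) τ := by
    intro τ hτ
    have h1 : HasDerivAt (fun τ : ℝ => 1 + τ * t) t τ := by
      simpa using ((hasDerivAt_id τ).mul_const t).const_add 1
    refine (h1.mul ((hgd (k τ)).comp τ (hkd τ hτ))).congr_deriv ?_
    simp only [Function.comp]
    field_simp
  have hℓne : ∀ τ, 0 < 1 + τ * t → ℓ τ ≠ 0 := by
    intro τ hτ h
    have := congrArg Prod.snd h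
    simp [hℓ, hv] at this
    linarith
  have hfirst : ∀ τ, 0 < 1 + τ * t → fderiv ℝ Φ (ℓ τ) v =
      2 * ((1 + τ * t) * g (k τ)) * (t * g (k τ) + deriv g (k τ) / (1 + τ * t)) := by
    intro τ hτ
    have h1 : HasDerivAt (fun τ => Φ (ℓ τ)) (fderiv ℝ Φ (ℓ τ) v) τ :=
      (hΦd _ (hℓne τ hτ)).comp_hasDerivAt τ (hℓd τ)
    have h2 : HasDerivAt (fun τ => Φ (ℓ τ)) _ τ := ((hhd τ hτ).pow 2).congr_of_eventuallyEq (by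
      have : ContinuousAt (fun τ : ℝ => 1 + τ * t) τ := by fun_prop
      filter_upwards [this.eventually (lt_mem_nhds hτ)] with y hy
      simpa using hΦℓ y hy)
    rw [h1.unique h2]
    simp
  have hsec1 : HasDerivAt (fun τ => fderiv ℝ Φ (ℓ τ) v)
      ((fderiv ℝ (fun q => fderiv ℝ Φ q) (s, 1) v) v) 0 := by
    rw [← hℓ0] at hΦ2
    have h1 := hΦ2.comp_hasDerivAt 0 (hℓd 0)
    have h2 := h1.clm_apply (hasDerivAt_const (0:ℝ) v)
    rw [hℓ0] at h2
    simpa using h2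
  have z0 : 0 < 1 + (0:ℝ) * t := by simp
  have hsec2 : HasDerivAt (fun τ => 2 * ((1 + τ * t) * g (k τ)) *
      (t * g (k τ) + deriv g (k τ) / (1 + τ * t))) (2 * g s * deriv (deriv g) s) 0 := by
    have h1 : HasDerivAt (fun τ : ℝ => 1 + τ * t) t 0 := by
      simpa using ((hasDerivAt_id (0:ℝ)).mul_const t).const_add 1
    have hA := ((hgd (k 0)).comp 0 (hkd 0 z0)).const_mul t
    have hB := ((hgdd (k 0)).comp 0 (hkd 0 z0)).div h1 z0.ne'
    have := ((hhd 0 z0).const_mul 2).mul (hA.add hB)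
    refine this.congr_deriv ?_
    have hz : t * g s + deriv g s = 0 := by rw [ht]; field_simp; ring
    simp [hk0]
    linear_combination (2 * (t * g s + deriv g s)) * hz
  have heq : (fderiv ℝ (fun q => fderiv ℝ Φ q) (s, 1) v) v = 2 * g s * deriv (deriv g) s :=
    hsec1.unique (hsec2.congr_of_eventuallyEq (by
      filter_upwards [hev] with y hy using hfirst y hy))
  have hfin := hconv (s, 1) hp0 v
  rw [heq] at hfin
  have hvpos : 0 < v.1 ^ 2 + v.2 ^ 2 := by
    by_cases h : t = 0
    · simp [hv, h]
    · have : 0 < t ^ 2 := by positivity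
      simp only [hv]; positivity
  have : 0 < 2 * g s * deriv (deriv g) s := lt_of_lt_of_le (mul_pos hm hvpos) hfin
  exact pos_of_mul_pos_right this (by positivity)

theorem stmt10 (φ ψ : ℝ × ℝ → ℝ)
    (hnorm : IsNorm2 φ)
    (hreg : ContDiffOn ℝ 2 φ {(0 : ℝ × ℝ)}ᶜ)
    (hconv : UnifConvexSq φ)
    (hψ : IsAniso2 ψ) (hψcont : Continuous ψ)
    (M : ℝ) (hM : IsGreatest (ψ '' {p : ℝ × ℝ | p.1 ^ 2 + p.2 ^ 2 = 1}) M) :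
    ∃ a b : ℝ, a < 0 ∧ 0 < b ∧ ∃ u : ℝ → ℝ,
      ConvexOn ℝ (Ioo a b) u ∧ ContDiffOn ℝ 2 u (Ioo a b) ∧
      u 0 = 0 ∧ deriv u 0 = 0 ∧
      (∀ x ∈ Ioo a b,
        ψ (-deriv u x, 1) * pdx (pdx φ) (-deriv u x, 1) * deriv (deriv u) x = 1) ∧
      -- `Ioo a b` is the maximal interval of existence
      (∀ (a' b' : ℝ) (u₂ : ℝ → ℝ), a' ≤ a → b ≤ b' → Ioo a b ⊂ Ioo a' b' →
        ContDiffOn ℝ 2 u₂ (Ioo a' b') → u₂ 0 = 0 → deriv u₂ 0 = 0 →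
        (∀ x ∈ Ioo a' b',
          ψ (-deriv u₂ x, 1) * pdx (pdx φ) (-deriv u₂ x, 1) * deriv (deriv u₂) x = 1) →
        False) ∧
      -- the solution is unique
      (∀ u₂ : ℝ → ℝ, ContDiffOn ℝ 2 u₂ (Ioo a b) → u₂ 0 = 0 → deriv u₂ 0 = 0 →
        (∀ x ∈ Ioo a b,
          ψ (-deriv u₂ x, 1) * pdx (pdx φ) (-deriv u₂ x, 1) * deriv (deriv u₂) x = 1) →
        EqOn u u₂ (Ioo a b)) ∧
      StrictMonoOn (deriv u) (Ioo a b) ∧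
      b - a ≤ 4 * (φ (1, 0) + φ (0, 1)) * M := by
  have hφC := aux_smooth φ hreg
  have hφpos := aux_pos φ hnorm hreg hconv
  obtain ⟨hcvx, hhom, hsym, hp⟩ := hnorm
  obtain ⟨-, hψhom, hψp⟩ := hψ
  have htri : ∀ p q, φ (p + q) ≤ φ p + φ q := by
    intro p q
    have h1 := hcvx.2 (mem_univ p) (mem_univ q) (show (0:ℝ) ≤ 1/2 by norm_num)
      (show (0:ℝ) ≤ 1/2 by norm_num) (by norm_num)
    rw [← smul_add, hhom _ (by norm_num)] at h1
    simp only [smul_eq_mul] at h1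
    linarith
  set g₀ : ℝ → ℝ := fun s => φ (s, 1) with hg₀
  set g : ℝ → ℝ := fun s => g₀ (-s) with hgdef
  have hgC : ContDiff ℝ 2 g := hφC.comp contDiff_neg
  have hdg : deriv g = fun s => -deriv g₀ (-s) := by
    funext s; exact deriv_comp_neg g₀ s
  have hddg : ∀ s, deriv (deriv g) s = deriv (deriv g₀) (-s) := by
    intro s
    rw [hdg, deriv.fun_neg, deriv_comp_neg, neg_neg]
  have hpdx : ∀ s, pdx (pdx φ) (-s, 1) = deriv (deriv g) s := by
    intro s; rw [hddg]; rfl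
  have hg2 : ∀ s, 0 < deriv (deriv g) s := fun s => by rw [hddg]; exact hφpos _
  have hgd : ∀ s, HasDerivAt g (deriv g s) s := fun s =>
    ((hgC.differentiable (by norm_num)) s).hasDerivAt
  have hg'C : ContDiff ℝ 1 (deriv g) := by
    rw [show (2 : WithTop ℕ∞) = 1 + 1 by norm_num, contDiff_succ_iff_deriv] at hgC
    exact hgC.2.2
  have hg''c : Continuous (deriv (deriv g)) := hg'C.continuous_deriv (by norm_num)
  have hg'mono : StrictMono (deriv g) := strictMono_of_deriv_pos hg2
  have hgcv : ConvexOn ℝ univ g := hg'mono.monotone.convexOn_univ_of_deriv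
    (hgC.differentiable (by norm_num))
  have htan : ∀ x y, g x + deriv g x * (y - x) ≤ g y := by
    intro x y
    rcases lt_trichotomy x y with h | h | h
    · have := hgcv.le_slope_of_hasDerivAt (mem_univ x) (mem_univ y) h (hgd x)
      rw [slope_def_field, le_div_iff₀ (by linarith)] at this
      linarith
    · simp [h]
    · have := hgcv.slope_le_of_hasDerivAt (mem_univ y) (mem_univ x) h (hgd x)
      rw [slope_def_field, div_le_iff₀ (by linarith)] at this
      linarith
  have hA : 0 < φ (1, 0) := hp _ (by simp [Prod.ext_iff])
  have h1 : ∀ s, deriv g s ≤ φ (1, 0) := by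
    intro s
    have e := htan s (s + 1)
    have e2 := htri (-s, 1) (-(1, 0))
    rw [hsym] at e2
    have e3 : ((-s, 1) + -(1, 0) : ℝ × ℝ) = (-(s + 1), 1) := by ext <;> simp; ring
    rw [e3] at e2
    simp only [hgdef, hg₀] at e e2 ⊢
    linarith
  have h2 : ∀ s, -φ (1, 0) ≤ deriv g s := by
    intro s
    have e := htan s (s - 1)
    have e2 := htri (-s, 1) (1, 0)
    have e3 : ((-s, 1) + (1, 0) : ℝ × ℝ) = (-(s - 1), 1) := by ext <;> simp; ring
    rw [e3] at e2
    simp only [hgdef, hg₀] at e e2 ⊢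
    linarith
  have h3 : ∀ s, s * deriv g s - g s ≤ φ (0, 1) := by
    intro s
    have e := htan s (2 * s)
    have e2 := htri ((2:ℝ) • (-s, 1)) (-(0, 1))
    rw [hsym, hhom _ (by norm_num)] at e2
    have e3 : ((2:ℝ) • (-s, 1) + -(0, 1) : ℝ × ℝ) = (-(2 * s), 1) := by
      ext
      · simp
      · simp; norm_num
    rw [e3] at e2
    simp only [hgdef, hg₀] at e e2 ⊢
    linarith
  have hM0 : 0 ≤ M := (hψp (1, 0) (by simp [Prod.ext_iff])).le.trans
    (hM.2 ⟨(1, 0), by simp, rfl⟩)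
  have hψb : ∀ s : ℝ, ψ (-s, 1) ≤ M * (1 + |s|) := by
    intro s
    set r := Real.sqrt (1 + s ^ 2) with hr
    have hr2 : r ^ 2 = 1 + s ^ 2 := Real.sq_sqrt (by positivity)
    have hrp : 0 < r := Real.sqrt_pos.2 (by positivity)
    have e : ((-s, 1) : ℝ × ℝ) = r • (-s / r, 1 / r) := by
      ext
      · simp; field_simp
      · simp; field_simp
    have e2 : ψ (-s / r, 1 / r) ≤ M := hM.2 ⟨_, by
      simp only [mem_ofPred_eq]; field_simp; rw [hr2]; ring, rfl⟩
    have e3 : r ≤ 1 + |s| := abs_le_of_sq_le_sq' (by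
      rw [hr2]; nlinarith [sq_abs s, abs_nonneg s]) (by positivity) |>.2
    rw [e, hψhom _ hrp]
    nlinarith
  set G : ℝ → ℝ := fun s => ψ (-s, 1) * deriv (deriv g) s with hG
  have hψ1c : Continuous fun s : ℝ => ψ (-s, 1) := hψcont.comp (by fun_prop)
  have hψ1p : ∀ s : ℝ, 0 < ψ (-s, 1) := fun s => hψp _ (by simp [Prod.ext_iff])
  have hGc : Continuous G := hψ1c.mul hg''c
  have hGp : ∀ s, 0 < G s := fun s => mul_pos (hψ1p s) (hg2 s)
  set H : ℝ → ℝ := fun s => ∫ t in (0:ℝ)..s, G t with hHdef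
  have hH : ∀ s, HasDerivAt H (G s) s := fun s =>
    intervalIntegral.integral_hasDerivAt_right (hGc.intervalIntegrable _ _)
      (hGc.stronglyMeasurableAtFilter _ _) hGc.continuousAt
  have H0 : H 0 = 0 := by simp [hHdef]
  have hb := aux_bound g (fun s => ψ (-s, 1)) H (φ (1, 0)) (φ (0, 1)) M hgC hH H0
    (fun s => (hg2 s).le) hψb hM0 hA.le (fun s => (hψ1p s).le) h1 h2 h3 (by simp [hgdef, hg₀])
  have := aux_ode G H _ hGc hGp hH H0 hb
  simp only [hpdx]
  exact this
end

section
/- Let N ≥ 1 and let φ be a norm on ℝ^{N+1} that is C² on ℝ^{N+1}∖{0} with φ² uniformly convex. If u₀ : ℝ^N → ℝ is a smooth, globally Lipschitz function satisfying div(∇_x φ(−∇u₀(x), 1)) = 0 for every x ∈ ℝ^N, then u₀ is an affine function. -/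
open Set RealInnerProductSpace

/-- Divergence of a vector field on `ℝ^N`. -/
noncomputable def diverg {N : ℕ}
    (V : EuclideanSpace ℝ (Fin N) → EuclideanSpace ℝ (Fin N))
    (x : EuclideanSpace ℝ (Fin N)) : ℝ :=
  ∑ i : Fin N, ⟪fderiv ℝ V x (EuclideanSpace.single i 1), EuclideanSpace.single i (1 : ℝ)⟫

/-- A norm on `ℝ^{N+1} = ℝ^N × ℝ`: convex, positively 1-homogeneous, symmetric and
positive away from the origin. -/
def IsNormP {N : ℕ} (φ : EuclideanSpace ℝ (Fin N) × ℝ → ℝ) : Prop :=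
  ConvexOn ℝ Set.univ φ ∧ (∀ c : ℝ, 0 < c → ∀ p, φ (c • p) = c * φ p) ∧
    (∀ p, φ (-p) = φ p) ∧ (∀ p, p ≠ 0 → 0 < φ p)

/-- `φ²` is uniformly convex. -/
def UnifConvexSqP {N : ℕ} (φ : EuclideanSpace ℝ (Fin N) × ℝ → ℝ) : Prop :=
  ∃ m : ℝ, 0 < m ∧ ∀ p, p ≠ 0 → ∀ v : EuclideanSpace ℝ (Fin N) × ℝ,
    m * (‖v.1‖ ^ 2 + v.2 ^ 2) ≤
      (fderiv ℝ (fun q => fderiv ℝ (fun r => φ r ^ 2) q) p v) v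

section AuxLemmas
open MeasureTheory

abbrev Eu (N : ℕ) := EuclideanSpace ℝ (Fin N)

lemma smoothTransition_deriv_bound :
    ∃ C : ℝ, 0 < C ∧ (∀ t, |deriv Real.smoothTransition t| ≤ C) ∧
      ∀ t ≤ 0, deriv Real.smoothTransition t = 0 := by
  have h0 : ∀ t ≤ 0, deriv Real.smoothTransition t = 0 := by
    intro t ht
    apply IsLocalMin.deriv_eq_zero
    refine Filter.Eventually.of_forall fun s => ?_
    rw [Real.smoothTransition.zero_of_nonpos ht]
    exact Real.smoothTransition.nonneg s
  have h1 : ∀ t, 1 ≤ t → deriv Real.smoothTransition t = 0 := by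
    intro t ht
    apply IsLocalMax.deriv_eq_zero
    refine Filter.Eventually.of_forall fun s => ?_
    rw [Real.smoothTransition.one_of_one_le ht]
    exact Real.smoothTransition.le_one s
  have hc : Continuous (deriv Real.smoothTransition) :=
    (Real.smoothTransition.contDiff (n := 1)).continuous_deriv le_rfl
  obtain ⟨C, hC⟩ := (isCompact_Icc (a := (0 : ℝ)) (b := 1)).exists_bound_of_continuousOn
    hc.continuousOn
  refine ⟨max C 1, by positivity, fun t => ?_, h0⟩
  rcases le_total t 0 with ht | ht
  · rw [h0 t ht]; simp
  rcases le_total 1 t with ht' | ht'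
  · rw [h1 t ht']; simp
  exact (hC t ⟨ht, ht'⟩).trans (le_max_left _ _)

lemma cutoff_exists : ∃ C : ℝ, 0 < C ∧ ∀ (N : ℕ) (r ρ : ℝ), 0 < r → r < ρ →
    ∃ η : Eu N → ℝ, ContDiff ℝ 1 η ∧ HasCompactSupport η ∧ (∀ x, 0 ≤ η x) ∧ (∀ x, η x ≤ 1) ∧
      (∀ x, ‖x‖ ≤ r → η x = 1) ∧ (∀ x, ρ ≤ ‖x‖ → η x = 0) ∧
      (∀ x, ρ ≤ ‖x‖ → fderiv ℝ η x = 0) ∧ ∀ x, ‖fderiv ℝ η x‖ ≤ C / (ρ - r) := by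
  obtain ⟨C, hC, hb, h0⟩ := smoothTransition_deriv_bound
  refine ⟨2 * C, by positivity, fun N r ρ hr hrρ => ?_⟩
  have hd : 0 < ρ ^ 2 - r ^ 2 := by nlinarith
  let q : Eu N → ℝ := fun x => (ρ ^ 2 - ‖x‖ ^ 2) / (ρ ^ 2 - r ^ 2)
  have hq : ∀ x, HasFDerivAt q ((-(2 / (ρ ^ 2 - r ^ 2))) • innerSL ℝ x) x := by
    intro x
    have := ((hasStrictFDerivAt_norm_sq x).hasFDerivAt.const_sub (ρ ^ 2)).mul_const
      ((ρ ^ 2 - r ^ 2)⁻¹)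
    refine (this.congr_fderiv ?_)
    ext y; simp; ring
  have hη : ∀ x, HasFDerivAt (fun x => Real.smoothTransition (q x))
      (deriv Real.smoothTransition (q x) • ((-(2 / (ρ ^ 2 - r ^ 2))) • innerSL ℝ x)) x := by
    intro x
    have : HasDerivAt Real.smoothTransition (deriv Real.smoothTransition (q x)) (q x) :=
      ((Real.smoothTransition.contDiff (n := 1)).differentiable (by simp) _).hasDerivAt
    exact this.comp_hasFDerivAt x (hq x)
  have hqneg : ∀ x, ρ ≤ ‖x‖ → q x ≤ 0 := by
    intro x hx
    apply div_nonpos_of_nonpos_of_nonneg _ hd.le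
    nlinarith [norm_nonneg x]
  have hz : ∀ x, ρ ≤ ‖x‖ → fderiv ℝ (fun x => Real.smoothTransition (q x)) x = 0 := by
    intro x hx
    rw [(hη x).fderiv, h0 _ (hqneg x hx), zero_smul]
  refine ⟨fun x => Real.smoothTransition (q x), ?_, ?_, fun x => Real.smoothTransition.nonneg _,
    fun x => Real.smoothTransition.le_one _, ?_, ?_, hz, ?_⟩
  · apply (Real.smoothTransition.contDiff (n := 1)).comp
    exact ((contDiff_const.sub (contDiff_norm_sq ℝ)).div_const _)
  · apply HasCompactSupport.of_support_subset_isCompact (isCompact_closedBall (0 : Eu N) ρ)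
    intro x hx
    by_contra h
    apply hx
    simp only [Metric.mem_closedBall, dist_zero_right, not_le] at h
    exact Real.smoothTransition.zero_of_nonpos (hqneg x h.le)
  · intro x hx
    apply Real.smoothTransition.one_of_one_le
    rw [le_div_iff₀ hd]
    nlinarith [norm_nonneg x]
  · intro x hx
    exact Real.smoothTransition.zero_of_nonpos (hqneg x hx)
  · intro x
    rcases le_total ρ ‖x‖ with hx | hx
    · rw [hz x hx, norm_zero]
      have : 0 < ρ - r := by linarith
      positivity
    · rw [(hη x).fderiv, norm_smul, norm_smul, innerSL_apply_norm, norm_neg, Real.norm_eq_abs,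
        Real.norm_eq_abs, abs_of_pos (by positivity : 0 < 2 / (ρ ^ 2 - r ^ 2))]
      have h1 : 2 / (ρ ^ 2 - r ^ 2) * ‖x‖ ≤ 2 / (ρ - r) := by
        rw [div_mul_eq_mul_div, div_le_div_iff₀ hd (by linarith)]
        nlinarith [mul_nonneg (sub_nonneg.2 hx) (sub_nonneg.2 hrρ.le), mul_pos hr (sub_pos.2 hrρ)]
      calc _ ≤ C * (2 / (ρ - r)) := mul_le_mul (hb _) h1 (by positivity) hC.le
        _ = _ := by ring

/-- data of a logarithmic subsolution -/
structure SubSol {N : ℕ} (lam Lam : ℝ) (W : Eu N → ℝ) (Y : Eu N → Eu N) : Prop where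
  cd : ContDiff ℝ 1 W
  one_le : ∀ x, 1 ≤ W x
  cY : Continuous Y
  weak : ∀ ζ : Eu N → ℝ, ContDiff ℝ 1 ζ → HasCompactSupport ζ →
    ∫ x, fderiv ℝ ζ x (Y x) = - ∫ x, ζ x * fderiv ℝ W x (Y x)
  ell : ∀ x, lam * ‖fderiv ℝ W x‖ ^ 2 ≤ fderiv ℝ W x (Y x)
  bdd : ∀ x, ‖Y x‖ ≤ Lam * ‖fderiv ℝ W x‖

lemma absorb {N : ℕ} {lam Lam : ℝ} (hl : 0 < lam) (A B : Eu N → ℝ)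
    (hA : Continuous A) (hB : Continuous B) (hA' : HasCompactSupport A) (hB' : HasCompactSupport B)
    (h : lam * ∫ x, A x ^ 2 ≤ 2 * Lam * ∫ x, A x * B x) :
    ∫ x, A x ^ 2 ≤ 4 * (Lam / lam) ^ 2 * ∫ x, B x ^ 2 := by
  have iA : Integrable (fun x => A x ^ 2) := by
    apply (hA.pow 2).integrable_of_hasCompactSupport
    simpa only [pow_two] using hA'.mul_left (f := A)
  have iB : Integrable (fun x => B x ^ 2) := by
    apply (hB.pow 2).integrable_of_hasCompactSupport
    simpa only [pow_two] using hB'.mul_left (f := B)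
  have iAB : Integrable (fun x => A x * B x) := by
    apply (hA.mul hB).integrable_of_hasCompactSupport
    exact hB'.mul_left (f := A)
  have key : 2 * (Lam / lam) * ∫ x, A x * B x
      ≤ (1/2) * (∫ x, A x ^ 2) + 2 * (Lam / lam) ^ 2 * ∫ x, B x ^ 2 := by
    rw [← integral_const_mul, ← integral_const_mul, ← integral_const_mul, ← integral_add]
    · apply integral_mono (iAB.const_mul _) ((iA.const_mul _).add (iB.const_mul _))
      intro x
      simp only [Pi.add_apply]
      nlinarith [sq_nonneg (A x - 2 * (Lam / lam) * B x)]
    · exact iA.const_mul _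
    · exact iB.const_mul _
  have h2 : ∫ x, A x ^ 2 ≤ 2 * (Lam / lam) * ∫ x, A x * B x := by
    rw [mul_comm] at h
    have := (le_div_iff₀ hl).2 h
    calc _ ≤ _ := this
      _ = _ := by ring
  linarith

lemma energy_gen {N : ℕ} {lam Lam : ℝ} (hl : 0 < lam) (hL : 0 < Lam) {W : Eu N → ℝ}
    {Y : Eu N → Eu N} (h : SubSol lam Lam W Y) (η : Eu N → ℝ) (hη : ContDiff ℝ 1 η)
    (hηc : HasCompactSupport η) (q c : ℝ) (A B : Eu N → ℝ)
    (hA : Continuous A) (hB : Continuous B) (hA' : HasCompactSupport A) (hB' : HasCompactSupport B)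
    (h1 : ∀ x, lam * A x ^ 2 ≤
      c * (η x ^ 2 * (q * W x ^ (q - 1) + W x ^ q) * fderiv ℝ W x (Y x)))
    (h2 : ∀ x, c * (-2 * η x * W x ^ q * fderiv ℝ η x (Y x)) ≤ 2 * Lam * (A x * B x)) :
    ∫ x, A x ^ 2 ≤ 4 * (Lam / lam) ^ 2 * ∫ x, B x ^ 2 := by
  have cDW : Continuous (fderiv ℝ W) := h.cd.continuous_fderiv (by simp)
  have cDη : Continuous (fderiv ℝ η) := hη.continuous_fderiv (by simp)
  have hWpos : ∀ x, 0 < W x := fun x => lt_of_lt_of_le one_pos (h.one_le x)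
  have hWne : ∀ x, W x ≠ 0 := fun x => (hWpos x).ne'
  have cWr : ∀ r : ℝ, Continuous fun x => W x ^ r := fun r =>
    h.cd.continuous.rpow_const (fun x => Or.inl (hWne x))
  have hcs : HasCompactSupport (fun x => η x ^ 2 * W x ^ q) :=
    hηc.mono (fun x hx => by
      simp only [Function.mem_support] at hx ⊢
      intro h0; apply hx; simp [h0])
  have hw := h.weak (fun x => η x ^ 2 * W x ^ q)
    ((hη.pow 2).mul (h.cd.rpow_const_of_ne hWne)) hcs
  have hder : ∀ x, fderiv ℝ (fun x => η x ^ 2 * W x ^ q) x (Y x) =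
      2 * η x * W x ^ q * fderiv ℝ η x (Y x) +
        η x ^ 2 * (q * W x ^ (q - 1)) * fderiv ℝ W x (Y x) := by
    intro x
    have e1 : HasFDerivAt η (fderiv ℝ η x) x := (hη.differentiable (by simp) x).hasFDerivAt
    have e2 : HasFDerivAt W (fderiv ℝ W x) x := (h.cd.differentiable (by simp) x).hasFDerivAt
    have e3 := (e1.pow 2).mul (e2.rpow_const (p := q) (Or.inl (hWne x)))
    have e4 : fderiv ℝ (fun x => η x ^ 2 * W x ^ q) x = _ := e3.fderiv
    rw [e4]
    simp
    ring
  have cη := hη.continuous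
  have i1 : Integrable (fun x => 2 * η x * W x ^ q * fderiv ℝ η x (Y x)) := by
    apply Continuous.integrable_of_hasCompactSupport
    · exact ((continuous_const.mul cη).mul (cWr q)).mul (cDη.clm_apply h.cY)
    · refine hηc.mono (fun x hx => ?_)
      simp only [Function.mem_support] at hx ⊢
      intro h0; apply hx; simp [h0]
  have i2 : Integrable (fun x => η x ^ 2 * (q * W x ^ (q - 1)) * fderiv ℝ W x (Y x)) := by
    apply Continuous.integrable_of_hasCompactSupport
    · exact ((cη.pow 2).mul (continuous_const.mul (cWr _))).mul (cDW.clm_apply h.cY)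
    · refine hηc.mono (fun x hx => ?_)
      simp only [Function.mem_support] at hx ⊢
      intro h0; apply hx; simp [h0]
  have i3 : Integrable (fun x => η x ^ 2 * W x ^ q * fderiv ℝ W x (Y x)) := by
    apply Continuous.integrable_of_hasCompactSupport
    · exact ((cη.pow 2).mul (cWr _)).mul (cDW.clm_apply h.cY)
    · refine hηc.mono (fun x hx => ?_)
      simp only [Function.mem_support] at hx ⊢
      intro h0; apply hx; simp [h0]
  simp only [hder] at hw
  rw [integral_add i1 i2] at hw
  have iA : Integrable (fun x => A x ^ 2) := by
    apply (hA.pow 2).integrable_of_hasCompactSupport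
    simpa only [pow_two] using hA'.mul_left (f := A)
  have iAB : Integrable (fun x => A x * B x) := by
    apply (hA.mul hB).integrable_of_hasCompactSupport
    exact hB'.mul_left (f := A)
  apply absorb hl A B hA hB hA' hB'
  calc lam * ∫ x, A x ^ 2 = ∫ x, lam * A x ^ 2 := (integral_const_mul _ _).symm
    _ ≤ ∫ x, c * (η x ^ 2 * (q * W x ^ (q - 1)) * fderiv ℝ W x (Y x) +
          η x ^ 2 * W x ^ q * fderiv ℝ W x (Y x)) := by
        apply integral_mono (iA.const_mul _) ((i2.add i3).const_mul _)
        intro x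
        refine (h1 x).trans (le_of_eq ?_)
        simp only [Pi.add_apply]
        ring
    _ = c * (- ∫ x, 2 * η x * W x ^ q * fderiv ℝ η x (Y x)) := by
        rw [integral_const_mul, integral_add i2 i3]
        congr 1
        linarith
    _ = ∫ x, c * (-(2 * η x * W x ^ q * fderiv ℝ η x (Y x))) := by
        rw [integral_const_mul, integral_neg]
    _ ≤ ∫ x, 2 * Lam * (A x * B x) := by
        apply integral_mono (i1.neg.const_mul _) (iAB.const_mul _)
        intro x
        refine le_trans (le_of_eq ?_) (h2 x)
        simp only [Pi.neg_apply]
        ring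
    _ = _ := integral_const_mul _ _

lemma energy_log {N : ℕ} {lam Lam : ℝ} (hl : 0 < lam) (hL : 0 < Lam) {W : Eu N → ℝ}
    {Y : Eu N → Eu N} (h : SubSol lam Lam W Y) (η : Eu N → ℝ) (hη : ContDiff ℝ 1 η)
    (hηc : HasCompactSupport η) (hη0 : ∀ x, 0 ≤ η x) :
    ∫ x, (η x * ‖fderiv ℝ W x‖) ^ 2 ≤ 4 * (Lam / lam) ^ 2 * ∫ x, ‖fderiv ℝ η x‖ ^ 2 := by
  have cDW : Continuous (fderiv ℝ W) := h.cd.continuous_fderiv (by simp)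
  have cDη : Continuous (fderiv ℝ η) := hη.continuous_fderiv (by simp)
  refine energy_gen hl hL h η hη hηc 0 1 (fun x => η x * ‖fderiv ℝ W x‖) (fun x => ‖fderiv ℝ η x‖)
    (hη.continuous.mul cDW.norm) cDη.norm hηc.mul_right (hηc.fderiv ℝ).norm ?_ ?_
  · intro x
    have := mul_le_mul_of_nonneg_left (h.ell x) (sq_nonneg (η x))
    simp
    linarith
  · intro x
    have e1 : -(fderiv ℝ η x (Y x)) ≤ ‖fderiv ℝ η x‖ * (Lam * ‖fderiv ℝ W x‖) :=
      (neg_le_abs _).trans (((fderiv ℝ η x).le_opNorm (Y x)).trans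
        (mul_le_mul_of_nonneg_left (h.bdd x) (norm_nonneg _)))
    have := mul_le_mul_of_nonneg_left e1 (hη0 x)
    simp
    linarith

lemma energy_pow {N : ℕ} {lam Lam : ℝ} (hl : 0 < lam) (hL : 0 < Lam) {W : Eu N → ℝ}
    {Y : Eu N → Eu N} (h : SubSol lam Lam W Y) (η : Eu N → ℝ) (hη : ContDiff ℝ 1 η)
    (hηc : HasCompactSupport η) (hη0 : ∀ x, 0 ≤ η x) (p : ℝ) (hp : 1 ≤ p) :
    ∫ x, (η x * (p * W x ^ (p - 1) * ‖fderiv ℝ W x‖)) ^ 2 ≤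
      4 * (Lam / lam) ^ 2 * ∫ x, (W x ^ p * ‖fderiv ℝ η x‖) ^ 2 := by
  have cDW : Continuous (fderiv ℝ W) := h.cd.continuous_fderiv (by simp)
  have cDη : Continuous (fderiv ℝ η) := hη.continuous_fderiv (by simp)
  have hWpos : ∀ x, 0 < W x := fun x => lt_of_lt_of_le one_pos (h.one_le x)
  have hWne : ∀ x, W x ≠ 0 := fun x => (hWpos x).ne'
  have cWr : ∀ r : ℝ, Continuous fun x => W x ^ r := fun r =>
    h.cd.continuous.rpow_const (fun x => Or.inl (hWne x))
  refine energy_gen hl hL h η hη hηc (2 * p - 1) p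
    (fun x => η x * (p * W x ^ (p - 1) * ‖fderiv ℝ W x‖)) (fun x => W x ^ p * ‖fderiv ℝ η x‖)
    (hη.continuous.mul ((continuous_const.mul (cWr _)).mul cDW.norm)) ((cWr _).mul cDη.norm)
    hηc.mul_right (hηc.fderiv ℝ).norm.mul_left ?_ ?_
  · intro x
    have e0 : 0 ≤ fderiv ℝ W x (Y x) := le_trans (by positivity) (h.ell x)
    have e1 : W x ^ (2 * p - 1 - 1) = (W x ^ (p - 1)) ^ 2 := by
      rw [pow_two, ← Real.rpow_add (hWpos x)]; congr 1; ring
    have e2 : 0 ≤ W x ^ (2 * p - 1) := Real.rpow_nonneg (hWpos x).le _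
    rw [e1]
    set a := W x ^ (p - 1)
    calc lam * (η x * (p * a * ‖fderiv ℝ W x‖)) ^ 2
        = (η x ^ 2 * a ^ 2 * p ^ 2) * (lam * ‖fderiv ℝ W x‖ ^ 2) := by ring
      _ ≤ (η x ^ 2 * a ^ 2 * p ^ 2) * (fderiv ℝ W x (Y x)) :=
          mul_le_mul_of_nonneg_left (h.ell x) (by positivity)
      _ ≤ (p * (η x ^ 2 * ((2 * p - 1) * a ^ 2 + W x ^ (2 * p - 1)))) * fderiv ℝ W x (Y x) := by
          apply mul_le_mul_of_nonneg_right _ e0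
          have : p * a ^ 2 ≤ (2 * p - 1) * a ^ 2 + W x ^ (2 * p - 1) := by
            nlinarith [sq_nonneg a]
          have := mul_le_mul_of_nonneg_left this (by positivity : 0 ≤ p * η x ^ 2)
          linarith
      _ = _ := by ring
  · intro x
    have e1 : -(fderiv ℝ η x (Y x)) ≤ ‖fderiv ℝ η x‖ * (Lam * ‖fderiv ℝ W x‖) :=
      (neg_le_abs _).trans (((fderiv ℝ η x).le_opNorm (Y x)).trans
        (mul_le_mul_of_nonneg_left (h.bdd x) (norm_nonneg _)))
    have e3 : W x ^ (2 * p - 1) = W x ^ (p - 1) * W x ^ p := by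
      rw [← Real.rpow_add (hWpos x)]; congr 1; ring
    rw [e3]
    have e4 : 0 ≤ W x ^ (p - 1) * W x ^ p := by
      have := hWpos x
      positivity
    have := mul_le_mul_of_nonneg_left e1 (by have := hη0 x; positivity :
      0 ≤ p * 2 * η x * (W x ^ (p - 1) * W x ^ p))
    linarith

lemma poinc_pt {N : ℕ} (f : Eu N → ℝ) (hf : ContDiff ℝ 1 f) (x y : Eu N) (hxy : ‖x - y‖ ≤ 2) :
    ENNReal.ofReal ((f x - f y) ^ 2) ≤
      4 * ∫⁻ t in Icc (0 : ℝ) 1, ENNReal.ofReal (‖fderiv ℝ f (y + t • (x - y))‖ ^ 2) := by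
  have cD : Continuous (fderiv ℝ f) := hf.continuous_fderiv (by simp)
  have cl : Continuous fun t : ℝ => y + t • (x - y) := by fun_prop
  have cg : Continuous fun t : ℝ => fderiv ℝ f (y + t • (x - y)) (x - y) :=
    (cD.comp cl).clm_apply continuous_const
  have cn : Continuous fun t : ℝ => ‖fderiv ℝ f (y + t • (x - y))‖ ^ 2 := (cD.comp cl).norm.pow 2
  have h1 : ∫ t in (0 : ℝ)..1, fderiv ℝ f (y + t • (x - y)) (x - y) = f x - f y := by
    have := intervalIntegral.integral_eq_sub_of_hasDerivAt
      (f := fun t : ℝ => f (y + t • (x - y))) (f' := fun t => fderiv ℝ f (y + t • (x - y)) (x - y))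
      (a := 0) (b := 1) ?_ (cg.intervalIntegrable _ _)
    · simpa using this
    · intro t _
      have e1 : HasFDerivAt f (fderiv ℝ f (y + t • (x - y))) (y + t • (x - y)) :=
        (hf.differentiable (by simp) _).hasFDerivAt
      have e2 : HasDerivAt (fun t : ℝ => y + t • (x - y)) (x - y) t := by
        simpa using ((hasDerivAt_id t).smul_const (x - y)).const_add y
      exact e1.comp_hasDerivAt t e2
  have cg2 : Continuous fun t : ℝ => (fderiv ℝ f (y + t • (x - y)) (x - y)) ^ 2 := cg.pow 2
  have cn4 : Continuous fun t : ℝ => 4 * ‖fderiv ℝ f (y + t • (x - y))‖ ^ 2 :=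
    continuous_const.mul cn
  set c := f x - f y
  have h2 : c ^ 2 ≤ ∫ t in (0 : ℝ)..1, (fderiv ℝ f (y + t • (x - y)) (x - y)) ^ 2 := by
    have e : 0 ≤ ∫ t in (0 : ℝ)..1, (fderiv ℝ f (y + t • (x - y)) (x - y) - c) ^ 2 :=
      intervalIntegral.integral_nonneg (by norm_num) (fun t _ => sq_nonneg _)
    have e2 : ∀ t : ℝ, (fderiv ℝ f (y + t • (x - y)) (x - y) - c) ^ 2 =
      (fderiv ℝ f (y + t • (x - y)) (x - y)) ^ 2 -
        ((2 * c) * fderiv ℝ f (y + t • (x - y)) (x - y) - c ^ 2) := fun t => by ring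
    simp only [e2] at e
    have c2 : Continuous fun t : ℝ => 2 * c * fderiv ℝ f (y + t • (x - y)) (x - y) :=
      continuous_const.mul cg
    have c3 : Continuous fun t : ℝ => 2 * c * fderiv ℝ f (y + t • (x - y)) (x - y) - c ^ 2 :=
      c2.sub continuous_const
    rw [intervalIntegral.integral_sub (cg2.intervalIntegrable _ _)
      (c3.intervalIntegrable _ _),
      intervalIntegral.integral_sub (c2.intervalIntegrable _ _)
        (continuous_const.intervalIntegrable _ _), intervalIntegral.integral_const_mul, h1] at e
    rw [intervalIntegral.integral_const] at e
    simp only [sub_zero, one_smul] at e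
    nlinarith
  have h3 : c ^ 2 ≤ 4 * ∫ t in (0 : ℝ)..1, ‖fderiv ℝ f (y + t • (x - y))‖ ^ 2 := by
    refine h2.trans ?_
    rw [← intervalIntegral.integral_const_mul]
    apply intervalIntegral.integral_mono_on (by norm_num) (cg2.intervalIntegrable _ _)
      (cn4.intervalIntegrable _ _)
    intro t _
    have e := (fderiv ℝ f (y + t • (x - y))).le_opNorm (x - y)
    have e' : ‖fderiv ℝ f (y + t • (x - y)) (x - y)‖ ≤ ‖fderiv ℝ f (y + t • (x - y))‖ * 2 :=
      e.trans (mul_le_mul_of_nonneg_left hxy (norm_nonneg _))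
    have := pow_le_pow_left₀ (norm_nonneg _) e' 2
    rw [Real.norm_eq_abs, sq_abs] at this
    linarith
  refine (ENNReal.ofReal_le_ofReal h3).trans ?_
  rw [ENNReal.ofReal_mul (by norm_num), intervalIntegral.integral_of_le (by norm_num),
    ← integral_Icc_eq_integral_Ioc, ofReal_integral_eq_lintegral_ofReal]
  · simp
  · exact cn.continuousOn.integrableOn_Icc
  · exact Filter.Eventually.of_forall fun t => by positivity

lemma lintegral_affine {N : ℕ} (H : Eu N → ENNReal) (hH : Measurable H) (t : ℝ) (ht : 1/2 ≤ t)
    (c : Eu N) : ∫⁻ x, H (c + t • x) ≤ 2 ^ N * ∫⁻ x, H x := by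
  have ht0 : t ≠ 0 := by linarith
  have h1 : ∫⁻ x, H (c + t • x) = ∫⁻ z, H (c + z) ∂(Measure.map (fun x : Eu N => t • x) volume) := by
    have m : Measurable fun z => H (c + z) := hH.comp (measurable_const_add c)
    rw [lintegral_map m (measurable_const_smul t)]
  rw [h1, Measure.map_addHaar_smul volume ht0, lintegral_smul_measure,
    lintegral_add_left_eq_self, smul_eq_mul, finrank_euclideanSpace_fin]
  gcongr
  rw [abs_of_pos (by positivity)]
  calc ENNReal.ofReal ((t ^ N)⁻¹) ≤ ENNReal.ofReal (2 ^ N) := by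
        apply ENNReal.ofReal_le_ofReal
        rw [← inv_pow]
        apply pow_le_pow_left₀ (by positivity)
        rw [inv_le_comm₀ (by linarith) (by norm_num)]
        linarith
    _ = 2 ^ N := by rw [ENNReal.ofReal_pow (by norm_num)]; simp

lemma poinc_key {N : ℕ} (G : Eu N → ENNReal) (cG : Continuous G) (B : Set (Eu N))
    (mB : MeasurableSet B) (cB : Convex ℝ B) (t : ℝ) (ht : 1/2 ≤ t) (ht1 : t ≤ 1) :
      ∫⁻ y in B, ∫⁻ x in B, G (y + t • (x - y)) ≤ 2 ^ N * volume B * ∫⁻ x in B, G x := by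
  calc ∫⁻ y in B, ∫⁻ x in B, G (y + t • (x - y))
        ≤ ∫⁻ y in B, (2 ^ N * ∫⁻ x in B, G x) := by
          apply setLIntegral_mono' mB
          intro y hy
          calc ∫⁻ x in B, G (y + t • (x - y))
              ≤ ∫⁻ x, (B.indicator G) ((1 - t) • y + t • x) := by
                rw [← lintegral_indicator mB]
                apply lintegral_mono
                intro x
                beta_reduce
                by_cases hx : x ∈ B
                · have : (1 - t) • y + t • x ∈ B :=
                    cB hy hx (by linarith) (by linarith) (by ring)
                  rw [indicator_of_mem hx, indicator_of_mem this]
                  apply le_of_eq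
                  congr 1
                  module
                · rw [indicator_of_notMem hx]; exact zero_le
            _ ≤ 2 ^ N * ∫⁻ x, B.indicator G x :=
                lintegral_affine _ (cG.measurable.indicator mB) t ht _
            _ = _ := by rw [lintegral_indicator mB]
      _ = _ := by rw [setLIntegral_const]; ring

lemma poinc_key2 {N : ℕ} (G : Eu N → ENNReal) (cG : Continuous G) (B : Set (Eu N))
    (mB : MeasurableSet B) (cB : Convex ℝ B) (t : ℝ) (ht : t ∈ Icc (0 : ℝ) 1) :
      ∫⁻ y in B, ∫⁻ x in B, G (y + t • (x - y)) ≤ 2 ^ N * volume B * ∫⁻ x in B, G x := by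
  rcases le_total (1/2) t with h | h
  · exact poinc_key G cG B mB cB t h ht.2
  · rw [lintegral_lintegral_swap]
    · refine le_trans (le_of_eq ?_) (poinc_key G cG B mB cB (1 - t) (by linarith) (by linarith [ht.1]))
      congr 1; ext x; congr 1; ext y; congr 1
      module
    · apply Continuous.aemeasurable
      exact cG.comp (by fun_prop)

lemma poinc_fub {N : ℕ} (G : Eu N → ENNReal) (cG : Continuous G) (B : Set (Eu N)) :
    ∫⁻ x in B, ∫⁻ y in B, 4 * ∫⁻ t in Icc (0 : ℝ) 1, G (y + t • (x - y)) =
     4 * ∫⁻ t in Icc (0 : ℝ) 1, ∫⁻ y in B, ∫⁻ x in B, G (y + t • (x - y)) := by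
  have m1 : Measurable fun z : (Eu N × Eu N) × ℝ => G (z.1.2 + z.2 • (z.1.1 - z.1.2)) :=
    (cG.comp (by fun_prop)).measurable
  have m2 : Measurable fun z : (Eu N × Eu N) =>
      ∫⁻ t in Icc (0 : ℝ) 1, G (z.2 + t • (z.1 - z.2)) := m1.lintegral_prod_right'
  have m2' : ∀ x : Eu N, Measurable fun y : Eu N =>
      ∫⁻ t in Icc (0 : ℝ) 1, G (y + t • (x - y)) := fun x => m2.comp measurable_prodMk_left
  have m4 : Measurable fun x : Eu N => ∫⁻ y in B,
      ∫⁻ t in Icc (0 : ℝ) 1, G (y + t • (x - y)) := m2.lintegral_prod_right'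
  simp_rw [lintegral_const_mul _ (m2' _)]
  rw [lintegral_const_mul _ m4]
  congr 1
  calc ∫⁻ x in B, ∫⁻ y in B, ∫⁻ t in Icc (0 : ℝ) 1, G (y + t • (x - y))
      = ∫⁻ x in B, ∫⁻ t in Icc (0 : ℝ) 1, ∫⁻ y in B, G (y + t • (x - y)) := by
        congr 1; ext x
        rw [lintegral_lintegral_swap]
        apply Continuous.aemeasurable
        exact cG.comp (by fun_prop)
    _ = ∫⁻ t in Icc (0 : ℝ) 1, ∫⁻ x in B, ∫⁻ y in B, G (y + t • (x - y)) := by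
        rw [lintegral_lintegral_swap]
        apply Measurable.aemeasurable
        have m3 : Measurable fun z : (Eu N × ℝ) × Eu N => G (z.2 + z.1.2 • (z.1.1 - z.2)) :=
          (cG.comp (by fun_prop)).measurable
        exact m3.lintegral_prod_right'
    _ = _ := by
        congr 1; ext t
        rw [lintegral_lintegral_swap]
        apply Continuous.aemeasurable
        exact cG.comp (by fun_prop)

lemma poincare {N : ℕ} (f : Eu N → ℝ) (hf : ContDiff ℝ 1 f) :
    ∫⁻ x in Metric.ball (0 : Eu N) 1, ∫⁻ y in Metric.ball (0 : Eu N) 1,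
      ENNReal.ofReal ((f x - f y) ^ 2) ≤ 4 * (2 ^ N * volume (Metric.ball (0 : Eu N) 1) *
        ∫⁻ x in Metric.ball (0 : Eu N) 1, ENNReal.ofReal (‖fderiv ℝ f x‖ ^ 2)) := by
  have cD : Continuous (fderiv ℝ f) := hf.continuous_fderiv (by simp)
  have cG : Continuous (fun z : Eu N => ENNReal.ofReal (‖fderiv ℝ f z‖ ^ 2)) :=
    ENNReal.continuous_ofReal.comp (cD.norm.pow 2)
  have mB : MeasurableSet (Metric.ball (0 : Eu N) 1) := Metric.isOpen_ball.measurableSet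
  have h1 := poinc_fub _ cG (Metric.ball (0 : Eu N) 1)
  have h2 := poinc_key2 _ cG _ mB (convex_ball (0 : Eu N) 1)
  have h3 := setLIntegral_mono' (μ := volume) measurableSet_Icc h2
  rw [setLIntegral_const, Real.volume_Icc, sub_zero, ENNReal.ofReal_one, mul_one] at h3
  refine le_trans ?_ (h1.le.trans (mul_le_mul_right h3 4))
  apply setLIntegral_mono' mB
  intro x hx
  apply setLIntegral_mono' mB
  intro y hy
  apply poinc_pt f hf
  rw [Metric.mem_ball, dist_zero_right] at hx hy
  exact (norm_sub_le _ _).trans (by linarith)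

lemma cont_intOn_ball {N : ℕ} (F : Eu N → ℝ) (hF : Continuous F) (r : ℝ) :
    IntegrableOn F (Metric.ball (0 : Eu N) r) :=
  (hF.continuousOn.integrableOn_compact (isCompact_closedBall (0 : Eu N) r)).mono_set
    Metric.ball_subset_closedBall

lemma int_le_ball {N : ℕ} (F G : Eu N → ℝ) (hF : Continuous F) (hG : Continuous G) (ρ M : ℝ)
    (h0 : ∀ x, ρ ≤ ‖x‖ → F x = 0) (h1 : ∀ x, F x ≤ M * G x) :
    ∫ x, F x ≤ M * ∫ x in Metric.ball (0 : Eu N) ρ, G x := by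
  rw [← setIntegral_eq_integral_of_forall_compl_eq_zero (s := Metric.ball (0 : Eu N) ρ),
    ← integral_const_mul]
  · apply setIntegral_mono (cont_intOn_ball F hF ρ) ((cont_intOn_ball G hG ρ).const_mul M)
    exact h1
  · intro x hx
    apply h0
    simpa using hx

lemma ball_le_int {N : ℕ} (F G : Eu N → ℝ) (hG : Continuous G)
    (hGc : HasCompactSupport G) (r : ℝ) (h0 : ∀ x, 0 ≤ G x)
    (h1 : ∀ x, ‖x‖ ≤ r → F x = G x) :
    ∫ x in Metric.ball (0 : Eu N) r, F x ≤ ∫ x, G x := by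
  have iG : Integrable G := hG.integrable_of_hasCompactSupport hGc
  calc ∫ x in Metric.ball (0 : Eu N) r, F x = ∫ x in Metric.ball (0 : Eu N) r, G x := by
        apply setIntegral_congr_fun Metric.isOpen_ball.measurableSet
        intro x hx
        apply h1
        rw [Metric.mem_ball, dist_zero_right] at hx
        exact hx.le
    _ ≤ _ := setIntegral_le_integral iG (Filter.Eventually.of_forall h0)

lemma grad_bound (N : ℕ) {lam Lam : ℝ} (hl : 0 < lam) (hL : 0 < Lam) :
    ∃ C : ℝ, 0 < C ∧ ∀ (W : Eu N → ℝ) (Y : Eu N → Eu N), SubSol lam Lam W Y →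
      ∫ x in Metric.ball (0 : Eu N) 1, ‖fderiv ℝ W x‖ ^ 2 ≤ C := by
  obtain ⟨C, hC, hcut⟩ := cutoff_exists
  obtain ⟨η, hη, hηc, hη0, hη1, hr, hρ, hDρ, hD⟩ := hcut N 1 2 one_pos one_lt_two
  refine ⟨4 * (Lam / lam) ^ 2 * (∫ x, ‖fderiv ℝ η x‖ ^ 2) + 1, ?_, fun W Y h => ?_⟩
  · have : 0 ≤ ∫ x, ‖fderiv ℝ η x‖ ^ 2 := integral_nonneg fun x => by positivity
    positivity
  have cDW : Continuous (fderiv ℝ W) := h.cd.continuous_fderiv (by simp)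
  have c2 : Continuous fun x => (η x * ‖fderiv ℝ W x‖) ^ 2 := (hη.continuous.mul cDW.norm).pow 2
  have := energy_log hl hL h η hη hηc hη0
  have h2 : ∫ x in Metric.ball (0 : Eu N) 1, ‖fderiv ℝ W x‖ ^ 2 ≤
      ∫ x, (η x * ‖fderiv ℝ W x‖) ^ 2 := by
    apply ball_le_int _ _ c2
    · refine hηc.mono (fun x hx => ?_)
      simp only [Function.mem_support] at hx ⊢
      intro h0; apply hx; simp [h0]
    · intro x; positivity
    · intro x hx
      simp [hr x hx]
  linarith

lemma L2_bound (N : ℕ) {lam Lam : ℝ} (hl : 0 < lam) (hL : 0 < Lam) (c₀ : ℝ) :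
    ∃ C : ℝ, ∀ (W : Eu N → ℝ) (Y : Eu N → Eu N), SubSol lam Lam W Y →
      volume (Metric.ball (0 : Eu N) 1) ≤ 2 * volume (Metric.ball (0 : Eu N) 1 ∩ {x | W x ≤ c₀}) →
      ∫ x in Metric.ball (0 : Eu N) 1, W x ^ 2 ≤ C := by
  obtain ⟨C, hC, hgrad⟩ := grad_bound N hl hL
  set B := Metric.ball (0 : Eu N) 1 with hB
  have mB : MeasurableSet B := Metric.isOpen_ball.measurableSet
  set b := (volume B).toReal with hb
  have hbfin : volume B ≠ ⊤ := measure_ball_lt_top.ne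
  have hvb : volume B = ENNReal.ofReal b := (ENNReal.ofReal_toReal hbfin).symm
  have hb0 : 0 < b := ENNReal.toReal_pos (Metric.measure_ball_pos _ _ one_pos).ne' hbfin
  refine ⟨(2 * (2 * (4 * (2 ^ N * b * C)) + 2 * c₀ ^ 2 * b * b)) / b, fun W Y h hZ => ?_⟩
  rw [le_div_iff₀ hb0]
  have cDW : Continuous (fderiv ℝ W) := h.cd.continuous_fderiv (by simp)
  have cW := h.cd.continuous
  have mZ : MeasurableSet (B ∩ {x | W x ≤ c₀}) :=
    mB.inter (measurableSet_le cW.measurable measurable_const)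
  set Z := B ∩ {x | W x ≤ c₀}
  have hP := poincare W h.cd
  rw [← hB] at hP
  have hD : ∫⁻ x in B, ENNReal.ofReal (‖fderiv ℝ W x‖ ^ 2) ≤ ENNReal.ofReal C := by
    rw [← ofReal_integral_eq_lintegral_ofReal]
    · exact ENNReal.ofReal_le_ofReal (hgrad W Y h)
    · exact cont_intOn_ball _ (cDW.norm.pow 2) 1
    · exact Filter.Eventually.of_forall fun t => by positivity
  have m0 : Measurable fun z : Eu N × Eu N => ENNReal.ofReal ((W z.1 - W z.2) ^ 2) := by
    apply Continuous.measurable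
    exact ENNReal.continuous_ofReal.comp (by fun_prop)
  have m1 : ∀ x, Measurable fun y => ENNReal.ofReal ((W x - W y) ^ 2) := fun x =>
    m0.comp measurable_prodMk_left
  have m2 : Measurable fun x => ∫⁻ y in B, ENNReal.ofReal ((W x - W y) ^ 2) :=
    m0.lintegral_prod_right'
  have hpt : ∀ x, volume Z * ENNReal.ofReal (W x ^ 2) ≤
      2 * (∫⁻ y in B, ENNReal.ofReal ((W x - W y) ^ 2)) + ENNReal.ofReal (2 * c₀ ^ 2) * volume B := by
    intro x
    calc volume Z * ENNReal.ofReal (W x ^ 2) = ∫⁻ y in Z, ENNReal.ofReal (W x ^ 2) := by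
          rw [setLIntegral_const, mul_comm]
      _ ≤ ∫⁻ y in Z, (2 * ENNReal.ofReal ((W x - W y) ^ 2) + ENNReal.ofReal (2 * c₀ ^ 2)) := by
          apply setLIntegral_mono' mZ
          intro y hy
          have e1 : (2 : ENNReal) = ENNReal.ofReal 2 := by simp
          rw [e1, ← ENNReal.ofReal_mul (by norm_num), ← ENNReal.ofReal_add (by positivity)
            (by positivity)]
          apply ENNReal.ofReal_le_ofReal
          have hy2 : W y ≤ c₀ := hy.2
          have := h.one_le y
          nlinarith [sq_nonneg (W x - W y - W y)]
      _ ≤ ∫⁻ y in B, (2 * ENNReal.ofReal ((W x - W y) ^ 2) + ENNReal.ofReal (2 * c₀ ^ 2)) :=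
          lintegral_mono_set inter_subset_left
      _ = _ := by
          rw [lintegral_add_right _ measurable_const, setLIntegral_const,
            lintegral_const_mul _ (m1 x)]
  have hint : volume Z * ∫⁻ x in B, ENNReal.ofReal (W x ^ 2) ≤
      ENNReal.ofReal (2 * (4 * (2 ^ N * b * C)) + 2 * c₀ ^ 2 * b * b) := by
    have mW : Measurable fun x => ENNReal.ofReal (W x ^ 2) :=
      (ENNReal.continuous_ofReal.comp (cW.pow 2)).measurable
    rw [← lintegral_const_mul _ mW]
    calc _ ≤ ∫⁻ x in B, (2 * (∫⁻ y in B, ENNReal.ofReal ((W x - W y) ^ 2)) +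
              ENNReal.ofReal (2 * c₀ ^ 2) * volume B) := lintegral_mono hpt
      _ = 2 * (∫⁻ x in B, ∫⁻ y in B, ENNReal.ofReal ((W x - W y) ^ 2)) +
            ENNReal.ofReal (2 * c₀ ^ 2) * volume B * volume B := by
          rw [lintegral_add_right _ measurable_const, setLIntegral_const,
            lintegral_const_mul _ m2]
      _ ≤ 2 * (4 * (2 ^ N * volume B * ENNReal.ofReal C)) +
            ENNReal.ofReal (2 * c₀ ^ 2) * volume B * volume B := by
          gcongr
          refine hP.trans ?_
          gcongr
      _ = _ := by
          have e1 : ENNReal.ofReal (2 * (4 * (2 ^ N * b * C))) =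
              2 * (4 * (2 ^ N * ENNReal.ofReal b * ENNReal.ofReal C)) := by
            rw [ENNReal.ofReal_mul (by positivity), ENNReal.ofReal_mul (by positivity),
              ENNReal.ofReal_mul (by positivity), ENNReal.ofReal_mul (by positivity),
              ENNReal.ofReal_pow (by norm_num)]
            simp
          have e2 : ENNReal.ofReal (2 * c₀ ^ 2 * b * b) =
              ENNReal.ofReal (2 * c₀ ^ 2) * ENNReal.ofReal b * ENNReal.ofReal b := by
            rw [ENNReal.ofReal_mul (by positivity), ENNReal.ofReal_mul (by positivity)]
          rw [hvb, ENNReal.ofReal_add (by positivity) (by positivity), e1, e2]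
  have iW : IntegrableOn (fun x => W x ^ 2) B := cont_intOn_ball _ (cW.pow 2) 1
  rw [← ofReal_integral_eq_lintegral_ofReal iW
    (Filter.Eventually.of_forall fun t => by positivity)] at hint
  have hfin : ENNReal.ofReal (b * ∫ x in B, W x ^ 2) ≤
      ENNReal.ofReal (2 * (2 * (4 * (2 ^ N * b * C)) + 2 * c₀ ^ 2 * b * b)) := by
    rw [ENNReal.ofReal_mul hb0.le, ← hvb, ENNReal.ofReal_mul (by norm_num : (0:ℝ) ≤ 2)]
    calc _ ≤ 2 * volume Z * ENNReal.ofReal (∫ x in B, W x ^ 2) := by gcongr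
      _ ≤ _ := by
        rw [mul_assoc, ENNReal.ofReal_ofNat]
        gcongr
  rw [ENNReal.ofReal_le_ofReal_iff (by positivity)] at hfin
  linarith

lemma gns_real (N : ℕ) (hN : 2 ≤ N) : ∃ C : ℝ, 0 < C ∧ ∀ f : Eu N → ℝ, ContDiff ℝ 1 f →
    HasCompactSupport f → (∀ x, 0 ≤ f x) →
    ∫ x, f x ^ ((N : ℝ) / (N - 1)) ≤ C * (∫ x, ‖fderiv ℝ f x‖) ^ ((N : ℝ) / (N - 1)) := by
  set χ : ℝ := (N : ℝ) / (N - 1) with hχ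
  have hN' : (2 : ℝ) ≤ N := by exact_mod_cast hN
  have hχ0 : 0 < χ := div_pos (by linarith) (by linarith)
  have hconj : Real.HolderConjugate (Module.finrank ℝ (Eu N)) χ := by
    rw [finrank_euclideanSpace_fin]
    exact Real.HolderConjugate.conjExponent (by linarith)
  set C := lintegralPowLePowLIntegralFDerivConst (volume : Measure (Eu N)) χ
  refine ⟨C + 1, by positivity, fun f hf hfc hf0 => ?_⟩
  have h := lintegral_pow_le_pow_lintegral_fderiv volume hf hfc hconj
  have cD : Continuous (fderiv ℝ f) := hf.continuous_fderiv (by simp)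
  have c1 : Continuous fun x => f x ^ χ := hf.continuous.rpow_const (fun x => Or.inr hχ0.le)
  have i1 : Integrable fun x => f x ^ χ := by
    apply c1.integrable_of_hasCompactSupport
    refine hfc.mono (fun x hx => ?_)
    simp only [Function.mem_support] at hx ⊢
    intro h0; apply hx; simp [h0, hχ0.ne']
  have i2 : Integrable fun x => ‖fderiv ℝ f x‖ :=
    cD.norm.integrable_of_hasCompactSupport (hfc.fderiv ℝ).norm
  have e1 : ∫⁻ x, ‖f x‖ₑ ^ χ = ENNReal.ofReal (∫ x, f x ^ χ) := by
    rw [ofReal_integral_eq_lintegral_ofReal i1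
      (Filter.Eventually.of_forall fun t => Real.rpow_nonneg (hf0 t) _)]
    congr 1; ext x
    rw [Real.enorm_eq_ofReal (hf0 x), ENNReal.ofReal_rpow_of_nonneg (hf0 x) hχ0.le]
  have e2 : ∫⁻ x, ‖fderiv ℝ f x‖ₑ = ENNReal.ofReal (∫ x, ‖fderiv ℝ f x‖) := by
    rw [ofReal_integral_eq_lintegral_ofReal i2
      (Filter.Eventually.of_forall fun t => norm_nonneg _)]
    congr 1; ext x
    rw [ofReal_norm]
  have hn : 0 ≤ ∫ x, ‖fderiv ℝ f x‖ := integral_nonneg fun x => norm_nonneg _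
  rw [e1, e2, ENNReal.ofReal_rpow_of_nonneg hn hχ0.le] at h
  have h3 : ENNReal.ofReal (∫ x, f x ^ χ) ≤
      ENNReal.ofReal (C * (∫ x, ‖fderiv ℝ f x‖) ^ χ) := by
    rw [ENNReal.ofReal_mul (by positivity), ENNReal.ofReal_coe_nnreal]
    exact h
  rw [ENNReal.ofReal_le_ofReal_iff (by positivity)] at h3
  refine h3.trans ?_
  gcongr
  linarith

lemma moser_step (N : ℕ) (hN : 2 ≤ N) {lam Lam : ℝ} (hl : 0 < lam) (hL : 0 < Lam) :
    ∃ K : ℝ, 1 ≤ K ∧ ∀ (W : Eu N → ℝ) (Y : Eu N → Eu N), SubSol lam Lam W Y →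
      ∀ (p r ρ : ℝ), 1 ≤ p → 0 < r → r < ρ → ρ ≤ 1 →
      ∫ x in Metric.ball (0 : Eu N) r, W x ^ (2 * (p * ((N : ℝ) / (N - 1)))) ≤
        (K / (ρ - r) ^ 2 * ∫ x in Metric.ball (0 : Eu N) ρ, W x ^ (2 * p)) ^ ((N : ℝ) / (N - 1)) := by
  obtain ⟨Cs, hCs, hgns⟩ := gns_real N hN
  obtain ⟨C, hC, hcut⟩ := cutoff_exists
  set χ : ℝ := (N : ℝ) / (N - 1) with hχ
  have hN' : (2 : ℝ) ≤ N := by exact_mod_cast hN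
  have hχ0 : 0 < χ := div_pos (by linarith) (by linarith)
  set K₀ : ℝ := 2 + (1 + 4 * (Lam / lam) ^ 2) * C ^ 2 with hK₀
  have hK₀1 : 2 ≤ K₀ := by
    have : 0 ≤ (1 + 4 * (Lam / lam) ^ 2) * C ^ 2 := by positivity
    linarith
  set Cr : ℝ := max 1 (Cs ^ (χ⁻¹)) with hCr
  have hCr1 : 1 ≤ Cr := le_max_left _ _
  refine ⟨Cr * K₀, by nlinarith, fun W Y h p r ρ hp hr hrρ hρ1 => ?_⟩
  obtain ⟨η, hη, hηc, hη0, hη1, hηr, hηρ, hDρ, hD⟩ := hcut N r ρ hr hrρ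
  have cη := hη.continuous
  have cDW : Continuous (fderiv ℝ W) := h.cd.continuous_fderiv (by simp)
  have cDη : Continuous (fderiv ℝ η) := hη.continuous_fderiv (by simp)
  have hWpos : ∀ x, 0 < W x := fun x => lt_of_lt_of_le one_pos (h.one_le x)
  have hWne : ∀ x, W x ≠ 0 := fun x => (hWpos x).ne'
  have cWr : ∀ r : ℝ, Continuous fun x => W x ^ r := fun r =>
    h.cd.continuous.rpow_const (fun x => Or.inl (hWne x))
  have hsq : ∀ x, W x ^ (2 * p) = (W x ^ p) ^ 2 := by
    intro x
    rw [pow_two, ← Real.rpow_add (hWpos x)]; congr 1; ring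
  set I := ∫ x in Metric.ball (0 : Eu N) ρ, W x ^ (2 * p) with hI
  have hI0 : 0 ≤ I := integral_nonneg fun x => Real.rpow_nonneg (hWpos x).le _
  have hd0 : 0 < ρ - r := by linarith
  -- the test function
  have hf : ContDiff ℝ 1 (fun x => η x ^ 2 * W x ^ (2 * p)) :=
    (hη.pow 2).mul (h.cd.rpow_const_of_ne hWne)
  have hfc : HasCompactSupport (fun x => η x ^ 2 * W x ^ (2 * p)) :=
    hηc.mono (fun x hx => by
      simp only [Function.mem_support] at hx ⊢
      intro h0; apply hx; simp [h0])
  have hf0 : ∀ x, 0 ≤ η x ^ 2 * W x ^ (2 * p) := fun x =>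
    mul_nonneg (sq_nonneg _) (Real.rpow_nonneg (hWpos x).le _)
  have hg := hgns _ hf hfc hf0
  have hA := energy_pow hl hL h η hη hηc hη0 p hp
  have cA : Continuous fun x => (η x * (p * W x ^ (p - 1) * ‖fderiv ℝ W x‖)) ^ 2 :=
    (cη.mul ((continuous_const.mul (cWr _)).mul cDW.norm)).pow 2
  have cB : Continuous fun x => (W x ^ p * ‖fderiv ℝ η x‖) ^ 2 := ((cWr _).mul cDη.norm).pow 2
  have cE : Continuous fun x => (η x * W x ^ p) ^ 2 := (cη.mul (cWr _)).pow 2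
  have iA : Integrable fun x => (η x * (p * W x ^ (p - 1) * ‖fderiv ℝ W x‖)) ^ 2 := by
    apply cA.integrable_of_hasCompactSupport
    refine hηc.mono (fun x hx => ?_)
    simp only [Function.mem_support] at hx ⊢
    intro h0; apply hx; simp [h0]
  have iE : Integrable fun x => (η x * W x ^ p) ^ 2 := by
    apply cE.integrable_of_hasCompactSupport
    refine hηc.mono (fun x hx => ?_)
    simp only [Function.mem_support] at hx ⊢
    intro h0; apply hx; simp [h0]
  have iB : Integrable fun x => (W x ^ p * ‖fderiv ℝ η x‖) ^ 2 := by
    apply cB.integrable_of_hasCompactSupport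
    refine (hηc.fderiv ℝ).mono (fun x hx => ?_)
    simp only [Function.mem_support] at hx ⊢
    intro h0; apply hx; simp [h0]
  have bB : ∫ x, (W x ^ p * ‖fderiv ℝ η x‖) ^ 2 ≤ (C / (ρ - r)) ^ 2 * I := by
    apply int_le_ball _ _ cB (cWr _)
    · intro x hx; simp [hDρ x hx]
    · intro x
      rw [hsq, mul_pow, mul_comm]
      gcongr
      exact hD x
  have bE : ∫ x, (η x * W x ^ p) ^ 2 ≤ 1 * I := by
    apply int_le_ball _ _ cE (cWr _)
    · intro x hx; simp [hηρ x hx]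
    · intro x
      rw [hsq, mul_pow]
      gcongr
      exact pow_le_one₀ (hη0 x) (hη1 x)
  have hDf : ∀ x, ‖fderiv ℝ (fun x => η x ^ 2 * W x ^ (2 * p)) x‖ ≤
      2 * (η x * W x ^ p) ^ 2 + (W x ^ p * ‖fderiv ℝ η x‖) ^ 2 +
        (η x * (p * W x ^ (p - 1) * ‖fderiv ℝ W x‖)) ^ 2 := by
    intro x
    have e1 : HasFDerivAt η (fderiv ℝ η x) x := (hη.differentiable (by simp) x).hasFDerivAt
    have e2 : HasFDerivAt W (fderiv ℝ W x) x := (h.cd.differentiable (by simp) x).hasFDerivAt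
    have e3 := (e1.pow 2).mul (e2.rpow_const (p := 2 * p) (Or.inl (hWne x)))
    have e4 : fderiv ℝ (fun x => η x ^ 2 * W x ^ (2 * p)) x = _ := e3.fderiv
    rw [e4]
    have e5 : W x ^ (2 * p - 1) = W x ^ (p - 1) * W x ^ p := by
      rw [← Real.rpow_add (hWpos x)]; congr 1; ring
    have a0 : 0 ≤ W x ^ p := Real.rpow_nonneg (hWpos x).le _
    have a1 : 0 ≤ W x ^ (p - 1) := Real.rpow_nonneg (hWpos x).le _
    have a2 := hη0 x
    refine (norm_add_le _ _).trans ?_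
    rw [norm_smul, norm_smul, norm_smul, norm_smul, e5, hsq]
    rw [Real.norm_of_nonneg (by positivity), Real.norm_of_nonneg (by positivity),
      Real.norm_of_nonneg (by positivity), Real.norm_of_nonneg (by simp; positivity)]
    simp only [Nat.add_one_sub_one, pow_one, nsmul_eq_mul, Nat.cast_ofNat]
    nlinarith [sq_nonneg (η x * W x ^ p - W x ^ p * ‖fderiv ℝ η x‖),
      sq_nonneg (η x * W x ^ p - η x * (p * W x ^ (p - 1) * ‖fderiv ℝ W x‖))]
  have hDI : ∫ x, ‖fderiv ℝ (fun x => η x ^ 2 * W x ^ (2 * p)) x‖ ≤ K₀ / (ρ - r) ^ 2 * I := by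
    have s1 : ∫ x, ‖fderiv ℝ (fun x => η x ^ 2 * W x ^ (2 * p)) x‖ ≤
        2 * (∫ x, (η x * W x ^ p) ^ 2) + (∫ x, (W x ^ p * ‖fderiv ℝ η x‖) ^ 2) +
        ∫ x, (η x * (p * W x ^ (p - 1) * ‖fderiv ℝ W x‖)) ^ 2 := by
      rw [← integral_const_mul, ← integral_add (iE.const_mul _) iB, ← integral_add _ iA]
      · apply integral_mono _ _ hDf
        · exact (hf.continuous_fderiv (by simp)).norm.integrable_of_hasCompactSupport
            (hfc.fderiv ℝ).norm
        · exact ((iE.const_mul _).add iB).add iA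
      · exact (iE.const_mul _).add iB
    have s2 : I ≤ 1 / (ρ - r) ^ 2 * I := by
      apply le_mul_of_one_le_left hI0
      rw [le_div_iff₀ (by positivity)]
      nlinarith
    have s3 := mul_le_mul_of_nonneg_left bB (by positivity : 0 ≤ 1 + 4 * (Lam / lam) ^ 2)
    calc _ ≤ 2 * I + (1 + 4 * (Lam / lam) ^ 2) * ((C / (ρ - r)) ^ 2 * I) := by linarith
      _ ≤ 2 * (1 / (ρ - r) ^ 2 * I) + (1 + 4 * (Lam / lam) ^ 2) * ((C / (ρ - r)) ^ 2 * I) := by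
          linarith
      _ = _ := by rw [hK₀, div_pow C (ρ - r)]; ring
  have cf : Continuous fun x => (η x ^ 2 * W x ^ (2 * p)) ^ χ :=
    hf.continuous.rpow_const (fun x => Or.inr hχ0.le)
  calc ∫ x in Metric.ball (0 : Eu N) r, W x ^ (2 * (p * χ))
      ≤ ∫ x, (η x ^ 2 * W x ^ (2 * p)) ^ χ := by
        apply ball_le_int _ _ cf
        · refine hηc.mono (fun x hx => ?_)
          simp only [Function.mem_support] at hx ⊢
          intro h0; apply hx; simp [h0, hχ0.ne']
        · intro x; exact Real.rpow_nonneg (hf0 x) _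
        · intro x hx
          rw [hηr x hx, one_pow, one_mul, ← Real.rpow_mul (hWpos x).le]
          congr 1; ring
    _ ≤ Cs * (K₀ / (ρ - r) ^ 2 * I) ^ χ := by
        refine hg.trans ?_
        gcongr
    _ ≤ Cr ^ χ * (K₀ / (ρ - r) ^ 2 * I) ^ χ := by
        gcongr
        calc Cs = (Cs ^ χ⁻¹) ^ χ := by rw [← Real.rpow_mul hCs.le, inv_mul_cancel₀ hχ0.ne',
              Real.rpow_one]
          _ ≤ Cr ^ χ := by
            gcongr
            exact le_max_right _ _
    _ = (Cr * K₀ / (ρ - r) ^ 2 * I) ^ χ := by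
        rw [← Real.mul_rpow (by positivity) (by positivity)]
        congr 1; ring

/-- numerical iteration -/
lemma iter_num (χ a b : ℝ) (hχ : 1 < χ) (ha : 0 ≤ a) (hb : 0 ≤ b) :
    ∃ S : ℝ, 0 ≤ S ∧ ∀ l : ℕ → ℝ, (∀ k, l (k + 1) ≤ l k + (a + b * k) / χ ^ k) →
      ∀ k, l k ≤ l 0 + S := by
  have hr : ‖χ⁻¹‖ < 1 := by
    rw [norm_inv, Real.norm_of_nonneg (by linarith)]
    exact inv_lt_one_of_one_lt₀ hχ
  have s1 : Summable fun k : ℕ => (a + b * k) / χ ^ k := by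
    have e1 := (summable_pow_mul_geometric_of_norm_lt_one 0 hr).mul_left a
    have e2 := (summable_pow_mul_geometric_of_norm_lt_one 1 hr).mul_left b
    refine (e1.add e2).congr fun k => ?_
    simp only [pow_zero, pow_one, inv_pow]
    ring
  have hn : ∀ k : ℕ, 0 ≤ (a + b * k) / χ ^ k := fun k => by positivity
  refine ⟨∑' k : ℕ, (a + b * k) / χ ^ k, tsum_nonneg hn, fun l hl k => ?_⟩
  have : l k ≤ l 0 + ∑ j ∈ Finset.range k, (a + b * j) / χ ^ j := by
    induction k with
    | zero => simp
    | succ k ih =>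
      rw [Finset.sum_range_succ]
      linarith [hl k]
  have h2 := s1.sum_le_tsum (Finset.range k) (fun j _ => hn j)
  linarith

lemma sup_bound (N : ℕ) (hN : 2 ≤ N) {lam Lam : ℝ} (hl : 0 < lam) (hL : 0 < Lam) (c₀ : ℝ) :
    ∃ C : ℝ, ∀ (W : Eu N → ℝ) (Y : Eu N → Eu N), SubSol lam Lam W Y →
      volume (Metric.ball (0 : Eu N) 1) ≤ 2 * volume (Metric.ball (0 : Eu N) 1 ∩ {x | W x ≤ c₀}) →
      ∀ x ∈ Metric.ball (0 : Eu N) (1/2), W x ≤ C := by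
  obtain ⟨K, hK, hstep⟩ := moser_step N hN hl hL
  obtain ⟨C₀, hL2⟩ := L2_bound N hl hL c₀
  set χ : ℝ := (N : ℝ) / (N - 1) with hχ
  have hN' : (2 : ℝ) ≤ N := by exact_mod_cast hN
  have hχ1 : 1 < χ := by rw [hχ, lt_div_iff₀ (by linarith)]; linarith
  have hχ0 : 0 < χ := by linarith
  obtain ⟨S, hS, hiter⟩ := iter_num χ (Real.log (K * 16)) (Real.log 4) hχ1
    (Real.log_nonneg (by linarith)) (Real.log_nonneg (by norm_num))
  refine ⟨Real.exp |Real.log C₀ + S|, fun W Y h hZ => ?_⟩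
  have hWpos : ∀ x, 0 < W x := fun x => lt_of_lt_of_le one_pos (h.one_le x)
  have cWr : ∀ r : ℝ, Continuous fun x => W x ^ r := fun r =>
    h.cd.continuous.rpow_const (fun x => Or.inl (hWpos x).ne')
  set r : ℕ → ℝ := fun k => 1/2 + (1/2) ^ (k + 1) with hr
  have hrpos : ∀ k, 0 < r k := fun k => by simp only [hr]; positivity
  have hrhalf : ∀ k, 1/2 ≤ r k := fun k => by
    have : (0 : ℝ) ≤ (1/2) ^ (k + 1) := by positivity
    simp only [hr]; linarith
  set I : ℕ → ℝ := fun k => ∫ x in Metric.ball (0 : Eu N) (r k), W x ^ (2 * χ ^ k) with hI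
  have hlow : ∀ (k : ℕ) (s : Set (Eu N)) (c : ℝ), MeasurableSet s →
      s ⊆ Metric.ball (0 : Eu N) (1/2) → 0 ≤ c →
      (∀ x ∈ s, c ≤ W x) → c ^ (2 * χ ^ k) * (volume s).toReal ≤ I k := by
    intro k s c ms hs hc0 hc
    have hs' : s ⊆ Metric.ball (0 : Eu N) (r k) := hs.trans (Metric.ball_subset_ball (hrhalf k))
    have i1 : IntegrableOn (fun x => W x ^ (2 * χ ^ k)) (Metric.ball (0 : Eu N) (r k)) :=
      cont_intOn_ball _ (cWr _) _
    have hsfin : volume s ≠ ⊤ := (measure_mono hs |>.trans_lt measure_ball_lt_top).ne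
    calc c ^ (2 * χ ^ k) * (volume s).toReal = ∫ x in s, c ^ (2 * χ ^ k) := by
          rw [setIntegral_const, smul_eq_mul, mul_comm]; rfl
      _ ≤ ∫ x in s, W x ^ (2 * χ ^ k) := by
          apply setIntegral_mono_on _ (i1.mono_set hs') ms
          · intro x hx
            exact Real.rpow_le_rpow hc0 (hc x hx) (by positivity)
          · exact integrableOn_const hsfin
      _ ≤ I k := by
          apply setIntegral_mono_set i1
          · exact Filter.Eventually.of_forall fun x => Real.rpow_nonneg (hWpos x).le _
          · exact Filter.Eventually.of_forall hs'
  have hIpos : ∀ k, 0 < I k := by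
    intro k
    refine lt_of_lt_of_le ?_ (hlow k (Metric.ball 0 (1/2)) 1 Metric.isOpen_ball.measurableSet
      le_rfl zero_le_one (fun x _ => h.one_le x))
    rw [Real.one_rpow, one_mul]
    exact ENNReal.toReal_pos (Metric.measure_ball_pos _ _ (by norm_num)).ne' measure_ball_lt_top.ne
  have hrec : ∀ k, I (k + 1) ≤ (K * 16 * 4 ^ k * I k) ^ χ := by
    intro k
    have hlt : r (k + 1) < r k := by
      simp only [hr]
      have : (0 : ℝ) < (1/2) ^ (k + 1) := by positivity
      rw [pow_succ _ (k + 1)]; linarith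
    have hle : r k ≤ 1 := by
      simp only [hr]
      have : ((1 : ℝ)/2) ^ (k + 1) ≤ 1/2 := by
        rw [pow_succ]
        have : ((1 : ℝ)/2) ^ k ≤ 1 := pow_le_one₀ (by norm_num) (by norm_num)
        linarith
      linarith
    have := hstep W Y h (χ ^ k) (r (k + 1)) (r k) (one_le_pow₀ hχ1.le) (hrpos _) hlt hle
    have e1 : K / (r k - r (k + 1)) ^ 2 = K * 16 * 4 ^ k := by
      have : r k - r (k + 1) = (1/2) ^ k / 4 := by simp only [hr]; ring
      rw [this, div_pow, ← pow_mul, mul_comm k 2, pow_mul]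
      norm_num
      rw [div_div_eq_mul_div, div_eq_iff (by positivity)]
      rw [mul_assoc, ← mul_pow]
      norm_num
    rw [e1] at this
    rw [pow_succ] at *
    exact this
  have hlog : ∀ k, Real.log (I (k + 1)) / χ ^ (k + 1) ≤
      Real.log (I k) / χ ^ k + (Real.log (K * 16) + Real.log 4 * k) / χ ^ k := by
    intro k
    have e := Real.log_le_log (hIpos (k + 1)) (hrec k)
    have hIk := hIpos k
    rw [Real.log_rpow (by positivity), Real.log_mul (by positivity) hIk.ne',
      Real.log_mul (by positivity) (by positivity), Real.log_pow] at e
    rw [← add_div, div_le_div_iff₀ (by positivity) (by positivity), pow_succ]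
    have := mul_le_mul_of_nonneg_right e (by positivity : 0 ≤ χ ^ k)
    linarith
  have hbound := hiter (fun k => Real.log (I k) / χ ^ k) hlog
  have hI0 : Real.log (I 0) ≤ Real.log C₀ := by
    apply Real.log_le_log (hIpos 0)
    have := hL2 W Y h hZ
    simp only [hI, hr]
    norm_num
    exact this
  intro x₀ hx₀
  by_contra hcon
  push Not at hcon
  set S' := Real.log C₀ + S with hS'
  obtain ⟨c, hc1, hc2⟩ := exists_between hcon
  have hopen : IsOpen (Metric.ball (0 : Eu N) (1/2) ∩ {x | c < W x}) :=
    Metric.isOpen_ball.inter (isOpen_lt continuous_const h.cd.continuous)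
  set s := Metric.ball (0 : Eu N) (1/2) ∩ {x | c < W x} with hs
  have hvpos : 0 < (volume s).toReal := by
    apply ENNReal.toReal_pos (hopen.measure_pos volume ⟨x₀, hx₀, hc2⟩).ne'
    exact (measure_mono inter_subset_left |>.trans_lt measure_ball_lt_top).ne
  have hc0 : 0 < c := (Real.exp_pos _).trans hc1
  have hk : ∀ k : ℕ, 2 * Real.log c + Real.log (volume s).toReal / χ ^ k ≤ S' := by
    intro k
    have e1 := hlow k s c hopen.measurableSet inter_subset_left hc0.le (fun x hx => hx.2.le)
    have e2 := Real.log_le_log (by positivity) e1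
    rw [Real.log_mul (by positivity) hvpos.ne', Real.log_rpow hc0] at e2
    have e3 : (2 * χ ^ k * Real.log c + Real.log (volume s).toReal) / χ ^ k ≤
      Real.log (I k) / χ ^ k := by gcongr
    have e4 := hbound k
    simp only [pow_zero, div_one] at e4
    have e5 : (2 * χ ^ k * Real.log c + Real.log (volume s).toReal) / χ ^ k =
      2 * Real.log c + Real.log (volume s).toReal / χ ^ k := by
      field_simp
    linarith
  have hlim : Filter.Tendsto (fun k : ℕ => 2 * Real.log c + Real.log (volume s).toReal / χ ^ k)
      Filter.atTop (nhds (2 * Real.log c + 0)) :=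
    tendsto_const_nhds.add (tendsto_const_nhds.div_atTop (tendsto_pow_atTop_atTop_of_one_lt hχ1))
  have hfinal := le_of_tendsto' hlim hk
  have hlogc : |S'| < Real.log c := (Real.lt_log_iff_exp_lt hc0).2 hc1
  have := le_abs_self S'
  have := abs_nonneg S'
  linarith

structure Sol {N : ℕ} (lam Lam : ℝ) (v : Eu N → ℝ) (X : Eu N → Eu N) : Prop where
  cd : ContDiff ℝ 1 v
  cX : Continuous X
  weak : ∀ ζ : Eu N → ℝ, ContDiff ℝ 1 ζ → HasCompactSupport ζ → ∫ x, fderiv ℝ ζ x (X x) = 0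
  ell : ∀ x, lam * ‖fderiv ℝ v x‖ ^ 2 ≤ fderiv ℝ v x (X x)
  bdd : ∀ x, ‖X x‖ ≤ Lam * ‖fderiv ℝ v x‖

lemma Sol.affine {N : ℕ} {lam Lam : ℝ} {v : Eu N → ℝ} {X : Eu N → Eu N}
    (h : Sol lam Lam v X) (c d : ℝ) : Sol lam Lam (fun x => c * v x + d) (fun x => c • X x) := by
  have hf : ∀ x, fderiv ℝ (fun x => c * v x + d) x = c • fderiv ℝ v x := by
    intro x
    have := (((h.cd.differentiable (by simp) x).hasFDerivAt).const_mul c).add_const d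
    exact this.fderiv
  refine ⟨(contDiff_const.mul h.cd).add contDiff_const, h.cX.const_smul c, ?_, ?_, ?_⟩
  · intro ζ h1 h2
    simp only [map_smul, smul_eq_mul]
    rw [integral_const_mul, h.weak ζ h1 h2, mul_zero]
  · intro x
    rw [hf]
    simp only [norm_smul, map_smul, ContinuousLinearMap.smul_apply, smul_eq_mul, mul_pow,
      Real.norm_eq_abs, sq_abs]
    nlinarith [h.ell x, mul_le_mul_of_nonneg_left (h.ell x) (sq_nonneg c)]
  · intro x
    rw [hf]
    simp only [norm_smul]
    nlinarith [mul_le_mul_of_nonneg_left (h.bdd x) (norm_nonneg c)]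

lemma Sol.dilate {N : ℕ} {lam Lam : ℝ} {v : Eu N → ℝ} {X : Eu N → Eu N}
    (h : Sol lam Lam v X) {R : ℝ} (hR : 0 < R) :
    Sol lam Lam (fun x => v (R • x)) (fun x => R • X (R • x)) := by
  have hf : ∀ (f : Eu N → ℝ), ContDiff ℝ 1 f → ∀ (c : ℝ) x,
      fderiv ℝ (fun x => f (c • x)) x = c • fderiv ℝ f (c • x) := by
    intro f hf c x
    have h1 : HasFDerivAt (fun x : Eu N => c • x) (c • ContinuousLinearMap.id ℝ (Eu N)) x :=
      (hasFDerivAt_id x).const_smul c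
    have h2 := ((hf.differentiable (by simp) (c • x)).hasFDerivAt).comp x h1
    have h3 : fderiv ℝ (fun x => f (c • x)) x = _ := h2.fderiv
    rw [h3]; ext y; simp
  refine ⟨h.cd.comp (contDiff_const_smul R),
    (h.cX.comp (continuous_const_smul R)).const_smul R, ?_, ?_, ?_⟩
  · intro ζ h1 h2
    have hz : ContDiff ℝ 1 (fun x => ζ (R⁻¹ • x)) := h1.comp (contDiff_const_smul R⁻¹)
    have hzc : HasCompactSupport (fun x => ζ (R⁻¹ • x)) :=
      h2.comp_smul (inv_ne_zero hR.ne')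
    have h3 := h.weak _ hz hzc
    have h4 := Measure.integral_comp_smul (volume : Measure (Eu N))
      (fun z => fderiv ℝ (fun x => ζ (R⁻¹ • x)) z (X z)) R
    rw [h3, smul_zero] at h4
    have h5 : ∀ x, fderiv ℝ ζ x (R • X (R • x))
        = R ^ 2 * (fderiv ℝ (fun x => ζ (R⁻¹ • x)) (R • x) (X (R • x))) := by
      intro x
      rw [hf ζ h1, smul_smul, inv_mul_cancel₀ hR.ne', one_smul]
      simp only [map_smul, ContinuousLinearMap.smul_apply, smul_eq_mul]
      field_simp
    simp_rw [h5]
    rw [integral_const_mul, h4, mul_zero]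
  · intro x
    rw [hf v h.cd]
    simp only [norm_smul, map_smul, ContinuousLinearMap.smul_apply, smul_eq_mul, mul_pow,
      Real.norm_eq_abs, sq_abs]
    nlinarith [mul_le_mul_of_nonneg_left (h.ell (R • x)) (sq_nonneg R)]
  · intro x
    rw [hf v h.cd]
    simp only [norm_smul]
    nlinarith [mul_le_mul_of_nonneg_left (h.bdd (R • x)) (norm_nonneg R)]

lemma Sol.sub {N : ℕ} {lam Lam : ℝ} {v : Eu N → ℝ} {X : Eu N → Eu N}
    (h : Sol lam Lam v X) (hv : ∀ x, |v x| ≤ 1) {ε : ℝ} (h0 : 0 < ε) (h1 : ε < 1) :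
    SubSol lam Lam (fun x => 1 + Real.log 3 - Real.log (1 + ε - v x))
      (fun x => (1 + ε - v x)⁻¹ • X x) := by
  have hy : ∀ x, 0 < 1 + ε - v x := fun x => by linarith [(abs_le.1 (hv x)).2]
  have hyne : ∀ x, 1 + ε - v x ≠ 0 := fun x => (hy x).ne'
  have hyc : ContDiff ℝ 1 (fun x => 1 + ε - v x) := contDiff_const.sub h.cd
  have dv : ∀ x, HasFDerivAt v (fderiv ℝ v x) x :=
    fun x => (h.cd.differentiable (by simp) x).hasFDerivAt
  have hW : ∀ x, fderiv ℝ (fun x => 1 + Real.log 3 - Real.log (1 + ε - v x)) x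
      = (1 + ε - v x)⁻¹ • fderiv ℝ v x := by
    intro x
    have := (((dv x).const_sub (1 + ε)).log (hyne x)).const_sub (1 + Real.log 3)
    rw [this.fderiv]; simp
  refine ⟨contDiff_const.sub (hyc.log hyne), ?_,
    (hyc.continuous.inv₀ hyne).smul h.cX, ?_, ?_, ?_⟩
  · intro x
    have : Real.log (1 + ε - v x) ≤ Real.log 3 :=
      Real.log_le_log (hy x) (by linarith [(abs_le.1 (hv x)).1])
    linarith
  · intro ζ hz hzc
    have hi : ContDiff ℝ 1 (fun x => (1 + ε - v x)⁻¹) := hyc.inv hyne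
    have di : ∀ x, HasFDerivAt (fun x => (1 + ε - v x)⁻¹)
        (((1 + ε - v x) ^ 2)⁻¹ • fderiv ℝ v x) x := by
      intro x
      have := (hasDerivAt_inv (hyne x)).comp_hasFDerivAt x ((dv x).const_sub (1 + ε))
      refine this.congr_fderiv ?_
      ext y; simp
    have hzi : ContDiff ℝ 1 (fun x => ζ x * (1 + ε - v x)⁻¹) := hz.mul hi
    have hzic : HasCompactSupport (fun x => ζ x * (1 + ε - v x)⁻¹) := hzc.mul_right
    have key := h.weak _ hzi hzic
    have hp : ∀ x, fderiv ℝ (fun x => ζ x * (1 + ε - v x)⁻¹) x (X x)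
        = fderiv ℝ ζ x ((1 + ε - v x)⁻¹ • X x)
          + ζ x * ((1 + ε - v x)⁻¹ • fderiv ℝ v x) ((1 + ε - v x)⁻¹ • X x) := by
      intro x
      have e3 := ((hz.differentiable (by simp) x).hasFDerivAt).mul (di x)
      have e4 : fderiv ℝ (fun x => ζ x * (1 + ε - v x)⁻¹) x = _ := e3.fderiv
      rw [e4]
      simp [← inv_pow]
      ring
    simp_rw [hp] at key
    rw [integral_add] at key
    · simp_rw [hW]
      linarith
    · have c1 : Continuous fun x => fderiv ℝ ζ x ((1 + ε - v x)⁻¹ • X x) :=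
        (hz.continuous_fderiv (by simp)).clm_apply (hi.continuous.smul h.cX)
      refine c1.integrable_of_hasCompactSupport ((hzc.fderiv ℝ).mono (fun x hx => ?_))
      simp only [Function.mem_support] at hx ⊢
      intro h0; apply hx; simp [h0]
    · have c1 : Continuous fun x =>
          ζ x * ((1 + ε - v x)⁻¹ • fderiv ℝ v x) ((1 + ε - v x)⁻¹ • X x) :=
        hz.continuous.mul ((hi.continuous.smul (h.cd.continuous_fderiv (by simp))).clm_apply
          (hi.continuous.smul h.cX))
      refine c1.integrable_of_hasCompactSupport (hzc.mono (fun x hx => ?_))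
      simp only [Function.mem_support] at hx ⊢
      intro h0; apply hx; simp [h0]
  · intro x
    rw [hW]
    simp only [norm_smul, map_smul, ContinuousLinearMap.smul_apply, smul_eq_mul, mul_pow,
      Real.norm_eq_abs, sq_abs]
    nlinarith [mul_le_mul_of_nonneg_left (h.ell x) (sq_nonneg (1 + ε - v x)⁻¹)]
  · intro x
    rw [hW]
    simp only [norm_smul]
    nlinarith [mul_le_mul_of_nonneg_left (h.bdd x) (norm_nonneg (1 + ε - v x)⁻¹)]

lemma sol_decay (N : ℕ) (hN : 2 ≤ N) {lam Lam : ℝ} (hl : 0 < lam) (hL : 0 < Lam) :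
    ∃ θ : ℝ, 0 < θ ∧ ∀ (v : Eu N → ℝ) (X : Eu N → Eu N), Sol lam Lam v X →
      (∀ x, |v x| ≤ 1) →
      volume (Metric.ball (0 : Eu N) 1) ≤
        2 * volume (Metric.ball (0 : Eu N) 1 ∩ {x | v x ≤ 0}) →
      ∀ x ∈ Metric.ball (0 : Eu N) (1 / 2), v x ≤ 1 - θ := by
  obtain ⟨C, hC⟩ := sup_bound N hN hl hL (1 + Real.log 3)
  refine ⟨Real.exp (1 + Real.log 3 - C), Real.exp_pos _, fun v X h hv hvol x hx => ?_⟩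
  apply le_of_forall_pos_lt_add
  intro ε hε
  obtain ⟨δ, hδ0, hδ1, hδ⟩ : ∃ δ, 0 < δ ∧ δ < 1 ∧ δ < ε :=
    ⟨min (1/2) (ε/2), by positivity, (min_le_left _ _).trans_lt (by norm_num),
      (min_le_right _ _).trans_lt (by linarith)⟩
  have hy : ∀ x, 0 < 1 + δ - v x := fun x => by linarith [(abs_le.1 (hv x)).2]
  have := hC _ _ (h.sub hv hδ0 hδ1) (hvol.trans (by
    gcongr 2 * volume (_ ∩ ?_)
    intro z hz
    simp only [mem_setOf_eq] at hz ⊢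
    have : 0 ≤ Real.log (1 + δ - v z) := Real.log_nonneg (by linarith)
    linarith)) x hx
  have h2 : Real.exp (1 + Real.log 3 - C) ≤ 1 + δ - v x := by
    rw [← Real.le_log_iff_exp_le (hy x)]; linarith
  linarith

theorem liouville (N : ℕ) (hN : 2 ≤ N) {lam Lam : ℝ} (hl : 0 < lam) (hL : 0 < Lam)
    (v : Eu N → ℝ) (X : Eu N → Eu N) (h : Sol lam Lam v X) (B : ℝ) (hB : ∀ x, |v x| ≤ B) :
    ∀ x y, v x = v y := by
  obtain ⟨θ, hθ, hdec⟩ := sol_decay N hN hl hL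
  have ba : BddAbove (range v) := ⟨B, by rintro _ ⟨x, rfl⟩; exact (abs_le.1 (hB x)).2⟩
  have bb : BddBelow (range v) := ⟨-B, by rintro _ ⟨x, rfl⟩; exact (abs_le.1 (hB x)).1⟩
  have hne : (range v).Nonempty := range_nonempty v
  set M := sSup (range v) with hM
  set m := sInf (range v) with hm
  have le1 : ∀ x, v x ≤ M := fun x => le_csSup ba ⟨x, rfl⟩
  have ge1 : ∀ x, m ≤ v x := fun x => csInf_le bb ⟨x, rfl⟩
  by_contra hcon
  push Not at hcon
  obtain ⟨a, b, hab⟩ := hcon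
  have hmM : m < M := by
    rcases lt_or_gt_of_ne hab with h | h
    · linarith [ge1 a, le1 b]
    · linarith [ge1 b, le1 a]
  have hd : 0 < M - m := by linarith
  set c : ℝ := 2 / (M - m) with hc
  have hc0 : 0 < c := by positivity
  set d : ℝ := - (M + m) / (M - m) with hdd
  have ctop : c * M + d = 1 := by rw [hc, hdd]; field_simp; ring
  have cbot : c * m + d = -1 := by rw [hc, hdd]; field_simp; ring
  have hs := h.affine c d
  set w : Eu N → ℝ := fun x => c * v x + d with hw
  have hwb : ∀ x, |w x| ≤ 1 := by
    intro x
    rw [abs_le]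
    constructor
    · have := mul_le_mul_of_nonneg_left (ge1 x) hc0.le
      simp only [hw]; linarith
    · have := mul_le_mul_of_nonneg_left (le1 x) hc0.le
      simp only [hw]; linarith
  obtain ⟨x1, hx1⟩ : ∃ x, 1 - θ < w x := by
    obtain ⟨_, ⟨x, rfl⟩, hx⟩ := exists_lt_of_lt_csSup hne (show M - θ / c < M by
      have : 0 < θ / c := by positivity
      linarith)
    refine ⟨x, ?_⟩
    have := mul_lt_mul_of_pos_left hx hc0
    have e : c * (M - θ / c) = c * M - θ := by field_simp
    simp only [hw]; linarith
  obtain ⟨x2, hx2⟩ : ∃ x, w x < -1 + θ := by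
    obtain ⟨_, ⟨x, rfl⟩, hx⟩ := exists_lt_of_csInf_lt hne (show m < m + θ / c by
      have : 0 < θ / c := by positivity
      linarith)
    refine ⟨x, ?_⟩
    have := mul_lt_mul_of_pos_left hx hc0
    have e : c * (m + θ / c) = c * m + θ := by field_simp
    simp only [hw]; linarith
  set R : ℝ := 2 * (‖x1‖ + ‖x2‖) + 2 with hR
  have hR0 : 0 < R := by positivity
  have inb : ∀ x : Eu N, ‖x‖ ≤ ‖x1‖ + ‖x2‖ → R⁻¹ • x ∈ Metric.ball (0 : Eu N) (1 / 2) := by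
    intro x hx
    rw [mem_ball_zero_iff, norm_smul, norm_inv, Real.norm_of_nonneg hR0.le,
      inv_mul_lt_iff₀ hR0]
    linarith
  have hback : ∀ x : Eu N, R • R⁻¹ • x = x := fun x => by
    rw [smul_smul, mul_inv_cancel₀ hR0.ne', one_smul]
  have hsR := hs.dilate hR0
  have hsN := hsR.affine (-1) 0
  have hsub : volume (Metric.ball (0 : Eu N) 1) ≤
      volume (Metric.ball (0 : Eu N) 1 ∩ {x | w (R • x) ≤ 0})
      + volume (Metric.ball (0 : Eu N) 1 ∩ {x | -1 * w (R • x) + 0 ≤ 0}) := by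
    refine (measure_mono ?_).trans (measure_union_le _ _)
    intro x hx
    rcases le_total (w (R • x)) 0 with h | h
    · exact Or.inl ⟨hx, h⟩
    · exact Or.inr ⟨hx, by simp only [mem_setOf_eq]; linarith⟩
  rcases le_total (volume (Metric.ball (0 : Eu N) 1 ∩ {x | -1 * w (R • x) + 0 ≤ 0}))
    (volume (Metric.ball (0 : Eu N) 1 ∩ {x | w (R • x) ≤ 0})) with hc' | hc'
  · have := hdec _ _ hsR (fun x => hwb _) (hsub.trans (by rw [two_mul]; gcongr))
      _ (inb x1 (by linarith [norm_nonneg x2]))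
    rw [hback] at this
    linarith
  · have := hdec _ _ hsN (fun x => by simpa using hwb _)
      (hsub.trans (by rw [two_mul]; gcongr))
      _ (inb x2 (by linarith [norm_nonneg x1]))
    rw [hback] at this
    linarith

lemma grad_coord {N : ℕ} (f : Eu N → ℝ) (x : Eu N) (i : Fin N) :
    (gradient f x) i = fderiv ℝ f x (EuclideanSpace.single i 1) := by
  rw [← inner_gradient_left, EuclideanSpace.inner_single_right]
  simp

lemma grad_contDiff {N : ℕ} {f : Eu N → ℝ} (hf : ContDiff ℝ 2 f) :
    ContDiff ℝ 1 (gradient f) := by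
  rw [contDiff_euclidean]
  intro i
  simp_rw [grad_coord]
  exact (hf.fderiv_right (m := 1) (by norm_num)).clm_apply contDiff_const

lemma div_weak {N : ℕ} {V : Eu N → Eu N} (hV : ContDiff ℝ 1 V) (hd : ∀ x, diverg V x = 0)
    (ζ : Eu N → ℝ) (hz : ContDiff ℝ 1 ζ) (hzc : HasCompactSupport ζ) :
    ∫ x, fderiv ℝ ζ x (V x) = 0 := by
  have hVi : ∀ i, ContDiff ℝ 1 (fun x => V x i) := fun i => (contDiff_euclidean.1 hV) i
  have hfd : ∀ i x w, fderiv ℝ (fun x => V x i) x w = (fderiv ℝ V x w) i := by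
    intro i x w
    have h1 := (EuclideanSpace.proj i : Eu N →L[ℝ] ℝ).hasFDerivAt.comp x
      (hV.differentiable (by simp) x).hasFDerivAt
    have h2 : fderiv ℝ (fun x => V x i) x = _ := h1.fderiv
    rw [h2]; simp
  have e1 : ∀ x, fderiv ℝ ζ x (V x)
      = ∑ i, V x i * fderiv ℝ ζ x (EuclideanSpace.single i 1) := by
    intro x
    conv_lhs => rw [← (EuclideanSpace.basisFun (Fin N) ℝ).sum_repr (V x)]
    rw [map_sum]
    simp
  have i1 : ∀ i, Integrable fun x => V x i * fderiv ℝ ζ x (EuclideanSpace.single i 1) := by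
    intro i
    have c : Continuous fun x => V x i * fderiv ℝ ζ x (EuclideanSpace.single i 1) :=
      (hVi i).continuous.mul ((hz.continuous_fderiv (by simp)).clm_apply continuous_const)
    refine c.integrable_of_hasCompactSupport ((hzc.fderiv ℝ).mono (fun x hx => ?_))
    simp only [Function.mem_support] at hx ⊢
    intro h0; apply hx; simp [h0]
  have i2 : ∀ i, Integrable fun x =>
      fderiv ℝ (fun x => V x i) x (EuclideanSpace.single i 1) * ζ x := by
    intro i
    have c : Continuous fun x =>
        fderiv ℝ (fun x => V x i) x (EuclideanSpace.single i 1) * ζ x :=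
      (((hVi i).continuous_fderiv (by simp)).clm_apply continuous_const).mul hz.continuous
    refine c.integrable_of_hasCompactSupport (hzc.mono (fun x hx => ?_))
    simp only [Function.mem_support] at hx ⊢
    intro h0; apply hx; simp [h0]
  have i3 : ∀ i, Integrable fun x => V x i * ζ x := by
    intro i
    have c : Continuous fun x => V x i * ζ x := (hVi i).continuous.mul hz.continuous
    refine c.integrable_of_hasCompactSupport (hzc.mono (fun x hx => ?_))
    simp only [Function.mem_support] at hx ⊢
    intro h0; apply hx; simp [h0]
  simp_rw [e1]
  rw [integral_finset_sum _ (fun i _ => i1 i)]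
  have e2 : ∀ i, ∫ x, V x i * fderiv ℝ ζ x (EuclideanSpace.single i 1)
      = - ∫ x, fderiv ℝ (fun x => V x i) x (EuclideanSpace.single i 1) * ζ x := fun i =>
    integral_mul_fderiv_eq_neg_fderiv_mul_of_integrable (i2 i) (i1 i) (i3 i)
      (fun x _ => (hVi i).differentiable (by simp) x) (fun x _ => hz.differentiable (by simp) x)
  rw [Finset.sum_congr rfl (fun i _ => e2 i), Finset.sum_neg_distrib,
    ← integral_finset_sum _ (fun i _ => i2 i), neg_eq_zero]
  rw [show (fun x => ∑ i, fderiv ℝ (fun x => V x i) x (EuclideanSpace.single i 1) * ζ x)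
    = fun _ => (0 : ℝ) from ?_]
  · simp
  funext x
  rw [← Finset.sum_mul]
  have := hd x
  simp only [diverg, EuclideanSpace.inner_single_right] at this
  simp only [hfd]
  simp at this
  rw [this, zero_mul]

lemma hess_lb {N : ℕ} {φ : Eu N × ℝ → ℝ}
    (hom : ∀ c : ℝ, 0 < c → ∀ p, φ (c • p) = c * φ p)
    (pos : ∀ p, p ≠ 0 → 0 < φ p)
    (hreg : ContDiffOn ℝ 2 φ {(0 : Eu N × ℝ)}ᶜ) {m : ℝ} (hm : 0 < m)
    (hconv : ∀ p, p ≠ 0 → ∀ v : Eu N × ℝ,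
      m * (‖v.1‖ ^ 2 + v.2 ^ 2) ≤ (fderiv ℝ (fun q => fderiv ℝ (fun r => φ r ^ 2) q) p v) v)
    {K : ℝ} (p w : Eu N) (hp : ‖p‖ ≤ K) :
    m * ‖w‖ ^ 2 ≤ 2 * (1 + K ^ 2) * φ (p, 1) * fderiv ℝ (fderiv ℝ φ) (p, 1) (w, 0) (w, 0) := by
  set P : Eu N × ℝ := (p, 1) with hP
  have hP0 : P ≠ 0 := by
    intro h
    have := congrArg Prod.snd h
    simp [hP] at this
  have hopen : IsOpen ({(0 : Eu N × ℝ)}ᶜ) := isOpen_compl_singleton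
  have hca : ∀ q : Eu N × ℝ, q ≠ 0 → ContDiffAt ℝ 2 φ q := fun q hq =>
    hreg.contDiffAt (hopen.mem_nhds hq)
  have hda : ∀ q : Eu N × ℝ, q ≠ 0 → HasFDerivAt φ (fderiv ℝ φ q) q := fun q hq =>
    ((hca q hq).differentiableAt (by simp)).hasFDerivAt
  have hD : HasFDerivAt (fderiv ℝ φ) (fderiv ℝ (fderiv ℝ φ) P) P :=
    (((hca P hP0).fderiv_right (m := 1) (by norm_num)).differentiableAt (by simp)).hasFDerivAt
  set H := fderiv ℝ (fderiv ℝ φ) P with hH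
  set L := fderiv ℝ φ P with hL
  have ev : ∀ᶠ q in nhds P, q ≠ 0 := hopen.mem_nhds hP0
  -- Euler
  have euler : ∀ q : Eu N × ℝ, q ≠ 0 → fderiv ℝ φ q q = φ q := by
    intro q hq
    have h1 : HasDerivAt (fun t : ℝ => t • q) ((1 : ℝ) • q) 1 := (hasDerivAt_id 1).smul_const q
    have h0 : HasFDerivAt φ (fderiv ℝ φ q) ((1 : ℝ) • q) := by
      rw [one_smul]; exact hda q hq
    have h2 := h0.comp_hasDerivAt (1 : ℝ) h1
    have h3 : HasDerivAt (fun t : ℝ => t * φ q) (1 * φ q) 1 := (hasDerivAt_id 1).mul_const _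
    have h4 : (fun t : ℝ => t * φ q) =ᶠ[nhds 1] (φ ∘ fun t : ℝ => t • q) := by
      filter_upwards [lt_mem_nhds (show (0 : ℝ) < 1 by norm_num)] with t ht
      exact (hom t ht q).symm
    have h5 := (h2.congr_of_eventuallyEq h4).unique h3
    simpa using h5
  have HP : ∀ v, H v P = 0 := by
    intro v
    have h1 := hD.clm_apply (hasFDerivAt_id P)
    have h2 : φ =ᶠ[nhds P] fun q => fderiv ℝ φ q (id q) := by
      filter_upwards [ev] with q hq
      exact (euler q hq).symm
    have h3 := (h1.congr_of_eventuallyEq h2).unique (hda P hP0)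
    have h4 := congrArg (fun T => T v) h3
    simp [← hL] at h4
    exact h4
  have symm : ∀ v w, H v w = H w v := by
    have := (hca P hP0).isSymmSndFDerivAt (by simp)
    intro v w
    exact this v w
  have sq : ∀ v, fderiv ℝ (fun q => fderiv ℝ (fun r => φ r ^ 2) q) P v v
      = 2 * (L v) ^ 2 + 2 * φ P * H v v := by
    intro v
    have h1 : (fun q => fderiv ℝ (fun r => φ r ^ 2) q) =ᶠ[nhds P]
        fun q => (2 * φ q) • fderiv ℝ φ q := by
      filter_upwards [ev] with q hq
      have := (hda q hq).pow 2
      rw [this.fderiv]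
      simp
    have h2 := ((hda P hP0).const_mul 2).smul hD
    have h3 := h2.congr_of_eventuallyEq h1
    rw [h3.fderiv]
    simp [← hL]
    ring
  have φP : 0 < φ P := pos P hP0
  set t : ℝ := - L (w, 0) / φ P with ht
  have LP : L P = φ P := euler P hP0
  set v : Eu N × ℝ := (w, 0) + t • P with hv
  have Lv : L v = 0 := by
    rw [hv, map_add, map_smul, LP, ht, smul_eq_mul]
    field_simp
    ring
  have Hv : H v v = H (w, 0) (w, 0) := by
    rw [hv]
    simp only [map_add, map_smul, HP, symm P, smul_zero, add_zero, ContinuousLinearMap.add_apply,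
      ContinuousLinearMap.smul_apply]
  have key := hconv P hP0 v
  rw [sq, Lv, Hv] at key
  have v1 : v.1 = w + t • p := by simp [hv, hP]
  have v2 : v.2 = t := by simp [hv, hP]
  rw [v1, v2] at key
  have tri : ‖w‖ ≤ ‖w + t • p‖ + |t| * K := by
    have h1 : ‖w‖ ≤ ‖w + t • p‖ + ‖t • p‖ := by
      have := norm_sub_le (w + t • p) (t • p)
      simpa using this
    rw [norm_smul, Real.norm_eq_abs] at h1
    have := mul_le_mul_of_nonneg_left hp (abs_nonneg t)
    linarith
  set A := ‖w + t • p‖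
  have hA : 0 ≤ A := norm_nonneg _
  have hK : 0 ≤ K := (norm_nonneg p).trans hp
  have tri2 : ‖w‖ ^ 2 ≤ (1 + K ^ 2) * (A ^ 2 + t ^ 2) := by
    have h1 : ‖w‖ ^ 2 ≤ (A + |t| * K) ^ 2 := by
      apply pow_le_pow_left₀ (norm_nonneg _) tri
    have h2 : t ^ 2 = |t| ^ 2 := (sq_abs t).symm
    rw [h2]
    nlinarith [sq_nonneg (A * K - |t|)]
  have h6 := mul_le_mul_of_nonneg_left tri2 hm.le
  have h7 := mul_le_mul_of_nonneg_left key (show 0 ≤ 1 + K ^ 2 by positivity)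
  nlinarith

lemma grad_sub_norm {N : ℕ} (f g : Eu N → ℝ) (x y : Eu N) :
    ‖gradient f x - gradient g y‖ = ‖fderiv ℝ f x - fderiv ℝ g y‖ := by
  rw [← toDual_gradient, ← toDual_gradient, ← map_sub, LinearIsometryEquiv.norm_map]

lemma F_facts {N : ℕ} {φ : Eu N × ℝ → ℝ}
    (hom : ∀ c : ℝ, 0 < c → ∀ p, φ (c • p) = c * φ p)
    (pos : ∀ p, p ≠ 0 → 0 < φ p)
    (hreg : ContDiffOn ℝ 2 φ {(0 : Eu N × ℝ)}ᶜ) {m : ℝ} (hm : 0 < m)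
    (hconv : ∀ p, p ≠ 0 → ∀ v : Eu N × ℝ,
      m * (‖v.1‖ ^ 2 + v.2 ^ 2) ≤ (fderiv ℝ (fun q => fderiv ℝ (fun r => φ r ^ 2) q) p v) v)
    (K : ℝ) (hK : 0 ≤ K) :
    ContDiff ℝ 2 (fun p : Eu N => φ (p, 1)) ∧ ∃ lam Lam : ℝ, 0 < lam ∧ 0 < Lam ∧
      ∀ p q : Eu N, ‖p‖ ≤ K → ‖q‖ ≤ K →
        lam * ‖p - q‖ ^ 2 ≤ ⟪gradient (fun p : Eu N => φ (p, 1)) p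
          - gradient (fun p : Eu N => φ (p, 1)) q, p - q⟫ ∧
        ‖gradient (fun p : Eu N => φ (p, 1)) p - gradient (fun p : Eu N => φ (p, 1)) q‖
          ≤ Lam * ‖p - q‖ := by
  have hopen : IsOpen ({(0 : Eu N × ℝ)}ᶜ) := isOpen_compl_singleton
  have hne : ∀ p : Eu N, ((p, 1) : Eu N × ℝ) ≠ 0 := by
    intro p h
    have := congrArg Prod.snd h
    simp at this
  have hca : ∀ p : Eu N, ContDiffAt ℝ 2 φ (p, 1) := fun p =>
    hreg.contDiffAt (hopen.mem_nhds (hne p))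
  have hda : ∀ p : Eu N, HasFDerivAt φ (fderiv ℝ φ (p, 1)) (p, 1) := fun p =>
    ((hca p).differentiableAt (by simp)).hasFDerivAt
  have hD : ∀ p : Eu N, HasFDerivAt (fderiv ℝ φ) (fderiv ℝ (fderiv ℝ φ) (p, 1)) (p, 1) := fun p =>
    (((hca p).fderiv_right (m := 1) (by norm_num)).differentiableAt (by simp)).hasFDerivAt
  have hF2 : ContDiff ℝ 2 (fun p : Eu N => φ (p, 1)) := by
    rw [contDiff_iff_contDiffAt]
    intro p
    exact (hca p).comp p (contDiffAt_id.prodMk contDiffAt_const)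
  have hfd : ∀ p w : Eu N, fderiv ℝ (fun p : Eu N => φ (p, 1)) p w = fderiv ℝ φ (p, 1) (w, 0) := by
    intro p w
    have h1 : HasFDerivAt (fun p : Eu N => ((p, 1) : Eu N × ℝ))
        ((ContinuousLinearMap.id ℝ (Eu N)).prod (0 : Eu N →L[ℝ] ℝ)) p :=
      (hasFDerivAt_id p).prodMk (hasFDerivAt_const (1 : ℝ) p)
    have h2 := (hda p).comp p h1
    have h3 : fderiv ℝ (fun p : Eu N => φ (p, 1)) p = _ := h2.fderiv
    rw [h3]; simp
  refine ⟨hF2, ?_⟩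
  obtain ⟨M, hM⟩ := (isCompact_closedBall (0 : Eu N) K).exists_bound_of_continuousOn
    hF2.continuous.continuousOn
  have hF1 : ContDiff ℝ 1 (fderiv ℝ (fun p : Eu N => φ (p, 1))) :=
    hF2.fderiv_right (m := 1) (by norm_num)
  obtain ⟨Lam, hLam⟩ := (isCompact_closedBall (0 : Eu N) K).exists_bound_of_continuousOn
    (hF1.continuous_fderiv (by simp)).continuousOn
  have hM0 : 0 < M := by
    have := hM 0 (by simpa using hK)
    rw [Real.norm_of_nonneg (pos _ (hne _)).le] at this
    exact (pos _ (hne _)).trans_le this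
  set lam : ℝ := m / (2 * (1 + K ^ 2) * M) with hlam
  have hlam0 : 0 < lam := by positivity
  have hess : ∀ p w : Eu N, ‖p‖ ≤ K →
      lam * ‖w‖ ^ 2 ≤ fderiv ℝ (fderiv ℝ φ) (p, 1) (w, 0) (w, 0) := by
    intro p w hp
    have h1 := hess_lb hom pos hreg hm hconv p w hp
    have h2 : φ (p, 1) ≤ M := by
      have := hM p (by simpa using hp)
      exact (le_abs_self _).trans this
    have h3 := pos _ (hne p)
    set h := fderiv ℝ (fderiv ℝ φ) (p, 1) (w, 0) (w, 0)
    have h0 : 0 ≤ h := by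
      by_contra hc
      push Not at hc
      have : 2 * (1 + K ^ 2) * φ (p, 1) * h < 0 := mul_neg_of_pos_of_neg (by positivity) hc
      have : 0 ≤ m * ‖w‖ ^ 2 := by positivity
      linarith
    rw [hlam, div_mul_eq_mul_div, div_le_iff₀ (by positivity)]
    have : 2 * (1 + K ^ 2) * φ (p, 1) * h ≤ 2 * (1 + K ^ 2) * M * h := by gcongr
    linarith
  refine ⟨lam, max Lam 1, hlam0, by positivity, fun p q hp hq => ⟨?_, ?_⟩⟩
  · rw [inner_sub_left, inner_gradient_left, inner_gradient_left, hfd, hfd]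
    set w := p - q with hw
    have hpath : ∀ t : ℝ, HasDerivAt (fun t : ℝ => ((q + t • w, 1) : Eu N × ℝ)) (w, 0) t := by
      intro t
      have h1 : HasDerivAt (fun t : ℝ => q + t • w) ((1 : ℝ) • w) t :=
        ((hasDerivAt_id t).smul_const w).const_add q
      rw [one_smul] at h1
      exact h1.prodMk (hasDerivAt_const t (1 : ℝ))
    have hg : ∀ t : ℝ, HasDerivAt (fun t : ℝ => fderiv ℝ φ (q + t • w, 1) (w, 0))
        (fderiv ℝ (fderiv ℝ φ) (q + t • w, 1) (w, 0) (w, 0)) t := by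
      intro t
      have h1 := (hD (q + t • w)).comp_hasDerivAt t (hpath t)
      have h2 := h1.clm_apply (hasDerivAt_const t ((w, 0) : Eu N × ℝ))
      simpa using h2
    obtain ⟨t, ht, hte⟩ := exists_hasDerivAt_eq_slope
      (fun t : ℝ => fderiv ℝ φ (q + t • w, 1) (w, 0)) _ (zero_lt_one)
      (fun t _ => (hg t).continuousAt.continuousWithinAt) (fun t _ => hg t)
    have hmem : ‖q + t • w‖ ≤ K := by
      have := (convex_closedBall (0 : Eu N) K) (x := q) (by simpa using hq) (y := p)
        (by simpa using hp) (a := 1 - t) (b := t) (by linarith [ht.2]) ht.1.le (by ring)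
      rw [mem_closedBall_zero_iff] at this
      have e : q + t • w = (1 - t) • q + t • p := by rw [hw]; module
      rw [e]; exact this
    have h5 := hess _ w hmem
    rw [hte] at h5
    have : q + w = p := by rw [hw]; abel
    simpa [this] using h5
  · rw [grad_sub_norm]
    refine ((convex_closedBall (0 : Eu N) K).norm_image_sub_le_of_norm_fderiv_le
      (fun x _ => hF1.differentiable (by simp) x) hLam (by simpa using hq)
      (by simpa using hp)).trans ?_
    gcongr
    exact le_max_left _ _

lemma affine_of_diff {N : ℕ} {u : Eu N → ℝ} (hu : Continuous u)
    (h : ∀ h x y : Eu N, u (x + h) - u x = u (y + h) - u y) :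
    ∃ (L : Eu N →L[ℝ] ℝ) (c : ℝ), ∀ x, u x = L x + c := by
  let f : Eu N →+ ℝ :=
    { toFun := fun x => u x - u 0
      map_zero' := by simp
      map_add' := by
        intro x y
        have := h y x 0
        rw [zero_add] at this
        linarith }
  have hf : Continuous f := hu.sub continuous_const
  refine ⟨f.toRealLinearMap hf, u 0, fun x => ?_⟩
  have : f.toRealLinearMap hf x = u x - u 0 := rfl
  rw [this]; ring

theorem main_aux (N : ℕ) (hN : 1 ≤ N)
    (φ : Eu N × ℝ → ℝ)
    (hom : ∀ c : ℝ, 0 < c → ∀ p, φ (c • p) = c * φ p)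
    (pos : ∀ p, p ≠ 0 → 0 < φ p)
    (hreg : ContDiffOn ℝ 2 φ {(0 : Eu N × ℝ)}ᶜ) {m : ℝ} (hm : 0 < m)
    (hconv : ∀ p, p ≠ 0 → ∀ v : Eu N × ℝ,
      m * (‖v.1‖ ^ 2 + v.2 ^ 2) ≤ (fderiv ℝ (fun q => fderiv ℝ (fun r => φ r ^ 2) q) p v) v)
    (u : Eu N → ℝ) (hu : ContDiff ℝ 2 u) (K : NNReal) (hK : LipschitzWith K u)
    (heq : ∀ x, diverg (fun y => gradient (fun p : Eu N => φ (p, 1)) (-(gradient u y))) x = 0) :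
    ∃ (L : Eu N →L[ℝ] ℝ) (c : ℝ), ∀ x, u x = L x + c := by
  obtain ⟨hF2, lam, Lam, hlam, hLam, hF⟩ := F_facts hom pos hreg hm hconv K K.2
  apply affine_of_diff hu.continuous
  intro h
  set V : Eu N → Eu N := fun y => gradient (fun p : Eu N => φ (p, 1)) (-(gradient u y)) with hVdef
  have hV : ContDiff ℝ 1 V := (grad_contDiff hF2).comp (grad_contDiff hu).neg
  have hgb : ∀ x, ‖-gradient u x‖ ≤ K := by
    intro x
    have h1 := grad_sub_norm u (fun _ => 0) x x
    have h2 : gradient (fun _ : Eu N => (0 : ℝ)) x = 0 := by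
      simp [gradient]
    rw [h2, sub_zero] at h1
    rw [norm_neg, h1]
    simpa using norm_fderiv_le_of_lipschitz ℝ hK
  have cs : ContDiff ℝ 1 (fun x : Eu N => x + h) := contDiff_id.add contDiff_const
  have hv1 : ContDiff ℝ 1 (fun x => u (x + h) - u x) :=
    ((hu.of_le (by norm_num)).comp cs).sub (hu.of_le (by norm_num))
  have hfd : ∀ x, fderiv ℝ (fun x => u (x + h) - u x) x = fderiv ℝ u (x + h) - fderiv ℝ u x := by
    intro x
    have d : ∀ x, DifferentiableAt ℝ u x := hu.differentiable (by simp)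
    have h1 : HasFDerivAt (fun x => u (x + h)) (fderiv ℝ u (x + h)) x :=
      (hasFDerivAt_comp_add_right h).2 (d (x + h)).hasFDerivAt
    exact (h1.sub (d x).hasFDerivAt).fderiv
  have ell : ∀ x, lam * ‖fderiv ℝ (fun x => u (x + h) - u x) x‖ ^ 2
      ≤ fderiv ℝ (fun x => u (x + h) - u x) x (V x - V (x + h)) := by
    intro x
    have h1 := (hF (-gradient u (x + h)) (-gradient u x) (hgb _) (hgb _)).1
    have e : -gradient u (x + h) - -gradient u x = -(gradient u (x + h) - gradient u x) := by abel
    rw [e, norm_neg, grad_sub_norm, inner_neg_right, real_inner_comm, inner_sub_left,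
      inner_gradient_left, inner_gradient_left] at h1
    rw [hfd]
    simp only [hVdef, map_sub, ContinuousLinearMap.sub_apply] at h1 ⊢
    linarith
  have bdd : ∀ x, ‖V x - V (x + h)‖ ≤ Lam * ‖fderiv ℝ (fun x => u (x + h) - u x) x‖ := by
    intro x
    have h1 := (hF (-gradient u (x + h)) (-gradient u x) (hgb _) (hgb _)).2
    have e : -gradient u (x + h) - -gradient u x = -(gradient u (x + h) - gradient u x) := by abel
    rw [e, norm_neg, grad_sub_norm u u] at h1
    rw [hfd, norm_sub_rev]
    exact h1
  rcases Nat.lt_or_ge N 2 with h2 | h2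
  · have hN1 : N = 1 := by omega
    have hVc : ∀ x y, V x = V y := by
      apply is_const_of_fderiv_eq_zero (𝕜 := ℝ) (hV.differentiable (by simp))
      intro x
      have := heq x
      subst hN1
      simp only [diverg, EuclideanSpace.inner_single_right] at this
      simp at this
      ext w i
      have hw : w = w 0 • EuclideanSpace.single (0 : Fin 1) (1 : ℝ) := by
        ext j; fin_cases j; simp
      rw [hw, map_smul]
      fin_cases i
      simp [this]
    apply is_const_of_fderiv_eq_zero (𝕜 := ℝ) (hv1.differentiable (by simp))
    intro x
    have := ell x
    rw [hVc x (x + h), sub_self, map_zero] at this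
    have h3 : ‖fderiv ℝ (fun x => u (x + h) - u x) x‖ ^ 2 ≤ 0 := by
      by_contra hc
      push Not at hc
      have := mul_pos hlam hc
      linarith
    have h4 : ‖fderiv ℝ (fun x => u (x + h) - u x) x‖ = 0 := by
      have := sq_nonneg ‖fderiv ℝ (fun x => u (x + h) - u x) x‖
      exact pow_eq_zero_iff (two_ne_zero) |>.1 (le_antisymm h3 this)
    exact norm_eq_zero.1 h4
  · have hsol : Sol lam Lam (fun x => u (x + h) - u x) (fun x => V x - V (x + h)) := by
      refine ⟨hv1, hV.continuous.sub (hV.continuous.comp cs.continuous), ?_, ell, bdd⟩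
      intro ζ hz hzc
      have w1 := div_weak hV heq ζ hz hzc
      have hVh : ContDiff ℝ 1 (fun x => V (x + h)) := hV.comp cs
      have w2 := div_weak hVh (fun x => by
        have e : fderiv ℝ (fun x => V (x + h)) x = fderiv ℝ V (x + h) :=
          fderiv_comp_add_right h
        have := heq (x + h)
        unfold diverg at this ⊢
        rw [e]; exact this) ζ hz hzc
      simp only [map_sub]
      have ii : ∀ X : Eu N → Eu N, Continuous X → Integrable fun x => fderiv ℝ ζ x (X x) := by
        intro X hX
        have c : Continuous fun x => fderiv ℝ ζ x (X x) :=
          (hz.continuous_fderiv (by simp)).clm_apply hX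
        refine c.integrable_of_hasCompactSupport ((hzc.fderiv ℝ).mono (fun x hx => ?_))
        simp only [Function.mem_support] at hx ⊢
        intro h0; apply hx; simp [h0]
      rw [integral_sub (ii _ hV.continuous) (ii _ hVh.continuous), w1, w2, sub_zero]
    refine liouville N h2 hlam hLam _ _ hsol (K * ‖h‖) (fun x => ?_)
    have := hK.dist_le_mul (x + h) x
    simpa [Real.dist_eq, dist_eq_norm] using this

end AuxLemmas

theorem stmt11 (N : ℕ) (hN : 1 ≤ N)
    (φ : EuclideanSpace ℝ (Fin N) × ℝ → ℝ)
    (hnorm : IsNormP φ)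
    (hreg : ContDiffOn ℝ 2 φ {(0 : EuclideanSpace ℝ (Fin N) × ℝ)}ᶜ)
    (hconv : UnifConvexSqP φ)
    (u₀ : EuclideanSpace ℝ (Fin N) → ℝ)
    (hsmooth : ContDiff ℝ (⊤ : ℕ∞) u₀)
    (hLip : ∃ K : NNReal, LipschitzWith K u₀)
    (heq : ∀ x : EuclideanSpace ℝ (Fin N),
      diverg (fun y => gradient (fun p : EuclideanSpace ℝ (Fin N) => φ (p, 1))
        (-(gradient u₀ y))) x = 0) :
    ∃ (L : EuclideanSpace ℝ (Fin N) →L[ℝ] ℝ) (c : ℝ),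
      ∀ x, u₀ x = L x + c := by
  obtain ⟨m, hm, hc⟩ := hconv
  obtain ⟨K, hK⟩ := hLip
  exact main_aux N hN φ hnorm.2.1 hnorm.2.2.2 hreg hm hc u₀
    (contDiff_infty.1 hsmooth 2) K hK heq
end
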